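/- Let p ≥ 5 be prime and write p − 1 = 2^a·o with o odd. Let G ≤ GL_{p−1}(ℚ) be an s.i.m.f. subgroup whose order is divisible by p. Then: if p ≡ 1 (mod 4), G is isomorphic as an abstract group to C_2 × (C_p ⋊ C_o), where C_o acts on C_p via an injective homomorphism C_o → Aut(C_p); and if p ≡ 3 (mod 4), G is isomorphic as an abstract group to C_2 × PSL(2, p). -/

import Mathlib

open Matrix
open scoped MatrixGroups

/-- `G ≤ GL_m(ℚ)` is symplectic if it fixes some invertible skew-symmetric form. -/
def IsSymplecticGroup {m : ℕ} (G : Subgroup (GL (Fin m) ℚ)) : Prop :=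
  ∃ A : Matrix (Fin m) (Fin m) ℚ, Aᵀ = -A ∧ IsUnit A ∧
    ∀ g ∈ G, (g : Matrix (Fin m) (Fin m) ℚ) * A * (g : Matrix (Fin m) (Fin m) ℚ)ᵀ = A

/-- A `ℚ`-subspace of the natural (right) module `ℚ^{1×m}` invariant under `G`. -/
def IsInvariantSubspace {m : ℕ} (G : Subgroup (GL (Fin m) ℚ))
    (W : Submodule ℚ (Fin m → ℚ)) : Prop :=
  ∀ g ∈ G, ∀ v ∈ W, v ᵥ* (g : Matrix (Fin m) (Fin m) ℚ) ∈ W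

/-- `G ≤ GL_m(ℚ)` is rationally irreducible. -/
def IsRatIrreducible {m : ℕ} (G : Subgroup (GL (Fin m) ℚ)) : Prop :=
  ∀ W : Submodule ℚ (Fin m → ℚ), IsInvariantSubspace G W → W = ⊥ ∨ W = ⊤

/-- `G ≤ GL_m(ℚ)` is s.i.m.f.: finite, symplectic, rationally irreducible, and maximal
among finite symplectic subgroups of `GL_m(ℚ)`. -/
def IsSIMF {m : ℕ} (G : Subgroup (GL (Fin m) ℚ)) : Prop :=
  (G : Set (GL (Fin m) ℚ)).Finite ∧ IsSymplecticGroup G ∧ IsRatIrreducible G ∧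
    ∀ H : Subgroup (GL (Fin m) ℚ), (H : Set (GL (Fin m) ℚ)).Finite →
      IsSymplecticGroup H → G ≤ H → H = G

open Polynomial in
/-- In characteristic `p`, a unipotent element `Y` with `(Y - 1) ^ (p - 1) = 0` has vanishing
norm `1 + Y + ⋯ + Y ^ (p - 1)`. -/
theorem geom_sum_eq_zero_of_sub_one_pow_eq_zero {k A : Type*} [Field k] [Ring A] [Algebra k A]
    {p : ℕ} [hp : Fact p.Prime] [CharP k p] {Y : A} (hY : (Y - 1) ^ (p - 1) = 0) :
    ∑ i ∈ Finset.range p, Y ^ i = 0 := by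
  have key : (∑ i ∈ Finset.range p, (X : k[X]) ^ i) = (X - 1) ^ (p - 1) := by
    have h1 : (X - 1 : k[X]) ≠ 0 := X_sub_C_ne_zero (1 : k)
    refine mul_right_cancel₀ h1 ?_
    rw [geom_sum_mul, ← pow_succ, Nat.sub_add_cancel hp.out.one_le, sub_pow_char, one_pow]
  have := congrArg (aeval Y) key
  simpa [hY] using this

/-- If a permutation of prime order `p` is intertwined with an operator of vanishing norm, then
only its fixed points contribute to the sum of an equivariant function. -/
theorem sum_eq_sum_fixed_of_equivariant {k W α : Type*} [Ring k] [AddCommGroup W] [Module k W]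
    [Fintype α] [DecidableEq α] {p : ℕ} (hp : p.Prime) (π : Equiv.Perm α) (hπ : π ^ p = 1)
    (X : Module.End k W) (hX : ∑ i ∈ Finset.range p, X ^ i = 0) (f : α → W)
    (hf : ∀ a, f (π a) = X (f a)) :
    ∑ a, f a = ∑ a with π a = a, f a := by
  have hfi : ∀ (i : ℕ) a, f ((π ^ i) a) = (X ^ i) (f a) := by
    intro i a
    induction i with
    | zero => simp
    | succ n ih => rw [pow_succ', pow_succ', Equiv.Perm.mul_apply, hf, ih]; rfl
  have aux : ∀ (n : ℕ) (s : Finset α), s.card = n → (∀ a ∈ s, π a ∈ s) → (∀ a ∈ s, π a ≠ a) →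
      ∑ a ∈ s, f a = 0 := by
    intro n
    induction n using Nat.strong_induction_on with
    | _ n ih =>
      intro s hs hstab hfix
      rcases s.eq_empty_or_nonempty with rfl | ⟨a, ha⟩
      · simp
      have hinj : Set.InjOn (fun i : ℕ => (π ^ i) a) (Finset.range p) := by
        have key : ∀ i j : ℕ, i < j → j < p → (π ^ i) a ≠ (π ^ j) a := by
          intro i j hij hj h
          have h1 : (π ^ (j - i)) a = a := by
            have : (π ^ j) a = (π ^ i) ((π ^ (j - i)) a) := by
              rw [← Equiv.Perm.mul_apply, ← pow_add]; congr 2; omega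
            rw [this] at h
            exact ((π ^ i).injective h).symm
          have hco : Nat.Coprime (j - i) p :=
            (hp.coprime_iff_not_dvd.2 (Nat.not_dvd_of_pos_of_lt (by omega) (by omega))).symm
          exact hfix a ha (by
            have h2 : Function.IsPeriodicPt π (j - i) a := by
              rw [Function.IsPeriodicPt, ← Equiv.Perm.coe_pow]; exact h1
            have h3 : Function.IsPeriodicPt π p a := by
              rw [Function.IsPeriodicPt, ← Equiv.Perm.coe_pow, hπ]; rfl
            have := h2.gcd h3
            rw [hco] at this
            simpa [Function.IsPeriodicPt, Function.IsFixedPt] using this)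
        intro i hi j hj hij
        simp only [Finset.coe_range, Set.mem_Iio] at hi hj
        rcases lt_trichotomy i j with h | h | h
        · exact absurd hij (key i j h hj)
        · exact h
        · exact absurd hij.symm (key j i h hi)
      set o := (Finset.range p).image (fun i : ℕ => (π ^ i) a) with ho
      have hmem : ∀ i : ℕ, (π ^ i) a ∈ s := by
        intro i
        induction i with
        | zero => simpa
        | succ m hm => rw [pow_succ', Equiv.Perm.mul_apply]; exact hstab _ hm
      have hos : o ⊆ s := by
        intro b hb
        obtain ⟨i, -, rfl⟩ := Finset.mem_image.1 hb
        exact hmem i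
      have hostab : ∀ b, π b ∈ o → b ∈ o := by
        intro b hb
        obtain ⟨i, hi, hib⟩ := Finset.mem_image.1 hb
        rw [Finset.mem_range] at hi
        rcases i with _ | i
        · refine Finset.mem_image.2 ⟨p - 1, Finset.mem_range.2 (by have := hp.pos; omega), ?_⟩
          apply π.injective
          rw [← hib, ← Equiv.Perm.mul_apply, ← pow_succ', Nat.sub_add_cancel hp.one_le, hπ]
          rfl
        · refine Finset.mem_image.2 ⟨i, Finset.mem_range.2 (by omega), ?_⟩
          apply π.injective
          rw [← hib, pow_succ', Equiv.Perm.mul_apply]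
      rw [← Finset.sum_sdiff hos]
      have h1 : ∑ b ∈ o, f b = 0 := by
        rw [ho, Finset.sum_image hinj]
        simp only [hfi]
        rw [← LinearMap.sum_apply, hX, LinearMap.zero_apply]
      have hapos : a ∈ o := Finset.mem_image.2 ⟨0, Finset.mem_range.2 hp.pos, rfl⟩
      rw [h1, add_zero]
      refine ih _ ?_ (s \ o) rfl ?_ ?_
      · rw [← hs]
        exact Finset.card_lt_card (Finset.sdiff_ssubset hos ⟨a, hapos⟩)
      · intro b hb
        rw [Finset.mem_sdiff] at hb ⊢
        exact ⟨hstab b hb.1, fun h => hb.2 (hostab b h)⟩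
      · intro b hb
        exact hfix b (Finset.mem_sdiff.1 hb).1
  rw [← Finset.sum_filter_add_sum_filter_not Finset.univ (fun a => π a = a)]
  rw [aux _ (Finset.univ.filter (fun a => ¬ π a = a)) rfl ?_ ?_, add_zero]
  · intro a ha
    simp only [Finset.mem_filter, Finset.mem_univ, true_and] at ha ⊢
    exact fun h => ha (π.injective h)
  · intro a ha
    simpa using ha

/-- The transfer of a `P`-endomorphism `φ` (with `P = ⟨x⟩` of order `p`): a `G`-endomorphism
which, on the `x`-fixed vectors, is the sum of the conjugates of `φ` over `N_G(P) / P`. -/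
theorem exists_transfer_endomorphism {k W G : Type*} [Field k] [AddCommGroup W] [Module k W]
    [Group G] [Finite G] {p : ℕ} [hp : Fact p.Prime] [CharP k p] (x : G) (hx : orderOf x = p)
    (ρ : G →* Module.End k W) (hX : ∑ i ∈ Finset.range p, ρ x ^ i = 0)
    (φ : Module.End k W) (hφ : Commute φ (ρ x)) (hidx : ¬ p ∣ (Subgroup.zpowers x).index) :
    ∃ (Φ : Module.End k W) (s : Finset G), (∀ g, Commute Φ (ρ g)) ∧ (s.card : k) ≠ 0 ∧
      (∀ n ∈ s, ∃ j : ℕ, n⁻¹ * x * n = x ^ j) ∧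
      ∀ w, ρ x w = w → Φ w = ∑ n ∈ s, ρ n (φ (ρ n⁻¹ w)) := by
  classical
  have : Fintype (G ⧸ Subgroup.zpowers x) := Fintype.ofFinite _
  have hφP : ∀ h ∈ Subgroup.zpowers x, ρ h * φ * ρ h⁻¹ = φ := by
    intro h hh
    obtain ⟨i, rfl⟩ := mem_powers_iff_mem_zpowers.2 hh
    have h1 : Commute φ (ρ (x ^ i)) := by rw [map_pow]; exact hφ.pow_right i
    rw [← h1.eq, mul_assoc, ← map_mul, mul_inv_cancel, map_one, mul_one]
  let F : G ⧸ Subgroup.zpowers x → Module.End k W :=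
    Quotient.lift (fun g => ρ g * φ * ρ g⁻¹) (by
      intro a b hab
      have hab' : a⁻¹ * b ∈ Subgroup.zpowers x := QuotientGroup.leftRel_apply.1 hab
      obtain ⟨h, rfl⟩ : ∃ h, b = a * h := ⟨a⁻¹ * b, by group⟩
      rw [inv_mul_cancel_left] at hab'
      rw [_root_.mul_inv_rev, map_mul, map_mul]
      conv_lhs => rw [← hφP _ hab']
      simp only [mul_assoc])
  have hFmk : ∀ g : G, F (g : G ⧸ Subgroup.zpowers x) = ρ g * φ * ρ g⁻¹ := fun g => rfl
  have hFsmul : ∀ (g : G) c, F (g • c) = ρ g * F c * ρ g⁻¹ := by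
    intro g c
    induction c using QuotientGroup.induction_on with
    | H a =>
      rw [MulAction.Quotient.smul_coe, hFmk, hFmk, smul_eq_mul, _root_.mul_inv_rev, map_mul, map_mul]
      simp only [mul_assoc]
  have hπ : (MulAction.toPerm x : Equiv.Perm (G ⧸ Subgroup.zpowers x)) ^ p = 1 := by
    rw [← MulAction.toPermHom_apply, ← map_pow, ← hx, pow_orderOf_eq_one, map_one]
  have hfixed : ∀ c : G ⧸ Subgroup.zpowers x, x • c = c → ∃ j : ℕ,
      c.out⁻¹ * x * c.out = x ^ j := by
    intro c hc
    have h1 : ((c.out : G) : G ⧸ Subgroup.zpowers x) = c := Quotient.out_eq' c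
    rw [← h1, MulAction.Quotient.smul_coe] at hc
    have h2 := QuotientGroup.eq.1 hc.symm
    obtain ⟨i, hi⟩ := mem_powers_iff_mem_zpowers.2 h2
    exact ⟨i, by simpa [mul_assoc] using hi.symm⟩
  refine ⟨∑ c, F c, (Finset.univ.filter (fun c : G ⧸ Subgroup.zpowers x => x • c = c)).image
    Quotient.out, ?_, ?_, ?_, ?_⟩
  · intro g
    have : ρ g * (∑ c, F c) * ρ g⁻¹ = ∑ c, F c := by
      rw [Finset.mul_sum, Finset.sum_mul]
      simp only [← hFsmul]
      exact Fintype.sum_equiv (MulAction.toPerm g) _ _ (fun _ => rfl)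
    have h2 := congrArg (· * ρ g) this
    simp only [mul_assoc] at h2
    rw [← map_mul, inv_mul_cancel, map_one, mul_one] at h2
    exact h2.symm
  · rw [Finset.card_image_of_injective _ Quotient.out_injective]
    have := sum_eq_sum_fixed_of_equivariant (k := k) hp.out
      (MulAction.toPerm x : Equiv.Perm (G ⧸ Subgroup.zpowers x)) hπ (1 : Module.End k k)
      (by
        ext
        simp) (fun _ => (1 : k)) (fun _ => rfl)
    simp only [Finset.sum_const, nsmul_eq_mul, mul_one, Finset.card_univ,
      MulAction.toPerm_apply] at this
    rw [← this]
    intro h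
    rw [CharP.cast_eq_zero_iff k p] at h
    rw [Subgroup.index, Nat.card_eq_fintype_card] at hidx
    exact hidx h
  · intro n hn
    obtain ⟨c, hc, rfl⟩ := Finset.mem_image.1 hn
    exact hfixed c (Finset.mem_filter.1 hc).2
  · intro w hw
    have hw' : ρ x⁻¹ w = w := by
      conv_lhs => rw [← hw, ← Module.End.mul_apply, ← map_mul, inv_mul_cancel, map_one]
      rfl
    have := sum_eq_sum_fixed_of_equivariant (k := k) hp.out
      (MulAction.toPerm x : Equiv.Perm (G ⧸ Subgroup.zpowers x)) hπ (ρ x) hX (fun c => F c w)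
      (fun c => by
        simp only [MulAction.toPerm_apply, hFsmul, Module.End.mul_apply, hw'])
    rw [LinearMap.sum_apply, this, Finset.sum_image (Quotient.out_injective.injOn)]
    simp only [MulAction.toPerm_apply]
    refine Finset.sum_congr rfl (fun c _ => ?_)
    conv_lhs => rw [← Quotient.out_eq' c]
    exact congrArg (fun f : Module.End k W => f w) (hFmk _)

/-- `t` is nilpotent on a `d`-dimensional space and consists of a single Jordan block, with
cyclic vector `v`. -/
structure IsRegularNilpotent {k V : Type*} [Field k] [AddCommGroup V] [Module k V]
    (t : Module.End k V) (v : V) (d : ℕ) : Prop where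
  pow_eq_zero : t ^ d = 0
  pow_apply_ne_zero : (t ^ (d - 1)) v ≠ 0
  finrank_eq : Module.finrank k V = d
  pos : 0 < d

namespace IsRegularNilpotent

variable {k V : Type*} [Field k] [AddCommGroup V] [Module k V] {t : Module.End k V} {v : V} {d : ℕ}

theorem pow_eq_zero_of_le (h : IsRegularNilpotent t v d) {n : ℕ} (hn : d ≤ n) : t ^ n = 0 :=
  _root_.pow_eq_zero_of_le hn h.pow_eq_zero

theorem linearIndependent (h : IsRegularNilpotent t v d) :
    LinearIndependent k (fun i : Fin d => (t ^ (i : ℕ)) v) := by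
  rw [Fintype.linearIndependent_iff]
  intro g hg
  have key : ∀ n (hn : n < d), g ⟨n, hn⟩ = 0 := by
    intro n
    induction n using Nat.strong_induction_on with
    | _ n ih =>
      intro hn
      have h1 := congrArg (t ^ (d - 1 - n)) hg
      rw [map_sum, map_zero, Finset.sum_eq_single ⟨n, hn⟩] at h1
      · rw [map_smul, ← Module.End.mul_apply, ← pow_add, Nat.sub_add_cancel (by omega)] at h1
        exact (smul_eq_zero.1 h1).resolve_right h.pow_apply_ne_zero
      · rintro ⟨j, hj⟩ - hjn
        rcases lt_trichotomy j n with hlt | heq | hgt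
        · rw [ih j hlt hj]; simp
        · exact absurd (Fin.ext heq) hjn
        · rw [map_smul, ← Module.End.mul_apply, ← pow_add,
            h.pow_eq_zero_of_le (by simp only; omega)]
          simp
      · simp
  exact fun i => key i i.2

theorem finiteDimensional (h : IsRegularNilpotent t v d) : Module.Finite k V :=
  Module.finite_of_finrank_pos (by rw [h.finrank_eq]; exact h.pos)

/-- The basis `v, t v, …, t ^ (d - 1) v`. -/
noncomputable def basis (h : IsRegularNilpotent t v d) : Module.Basis (Fin d) k V :=
  have : NeZero d := ⟨h.pos.ne'⟩
  basisOfLinearIndependentOfCardEqFinrank h.linearIndependent (by simp [h.finrank_eq])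

@[simp]
theorem basis_apply (h : IsRegularNilpotent t v d) (i : Fin d) : h.basis i = (t ^ (i : ℕ)) v := by
  have : NeZero d := ⟨h.pos.ne'⟩
  simp [basis]

theorem end_ext (h : IsRegularNilpotent t v d) {f g : Module.End k V}
    (hfg : ∀ i < d, f ((t ^ i) v) = g ((t ^ i) v)) : f = g :=
  h.basis.ext fun i => by simpa using hfg i i.2

theorem exists_aeval_of_commute (h : IsRegularNilpotent t v d) {w : Module.End k V}
    (hw : Commute w t) : ∃ f : Polynomial k, w = Polynomial.aeval t f := by
  refine ⟨∑ i : Fin d, Polynomial.monomial (i : ℕ) (h.basis.repr (w v) i), ?_⟩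
  refine h.end_ext fun i hi => ?_
  have h1 : w ((t ^ i) v) = (t ^ i) (w v) := by
    rw [← Module.End.mul_apply, (hw.pow_right i).eq]; rfl
  have h2 : ∀ f : Polynomial k, Polynomial.aeval t f ((t ^ i) v) =
      (t ^ i) (Polynomial.aeval t f v) := by
    intro f
    rw [← Module.End.mul_apply, ← Module.End.mul_apply]
    congr 1
    rw [← Polynomial.aeval_X_pow (R := k) t, ← map_mul, ← map_mul, mul_comm]
  rw [h1, h2]
  congr 1
  conv_lhs => rw [← h.basis.sum_repr (w v)]
  rw [map_sum, LinearMap.sum_apply]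
  refine Finset.sum_congr rfl fun j _ => ?_
  rw [Polynomial.aeval_monomial, basis_apply, Module.End.mul_apply]
  simp [Module.algebraMap_end_apply]

/-- The lowering operator of an `sl₂`-triple-like pair attached to a regular nilpotent `t`. -/
theorem exists_lowering (h : IsRegularNilpotent t v d) {p : ℕ} [Fact p.Prime] [CharP k p]
    (hp5 : 5 ≤ p) (hd2 : 2 ≤ d) (hdp : d + 1 < p) :
    ∃ s : Module.End k V, t * (t * s - s * t) - (t * s - s * t) * t = t ∧
      (∀ j ≠ 1, LinearMap.trace k V (s * t ^ j) = 0) ∧ LinearMap.trace k V (s * t) ≠ 0 := by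
  have hcast : ∀ n : ℕ, 0 < n → n < p → (n : k) ≠ 0 := by
    intro n hn hnp h0
    rw [CharP.cast_eq_zero_iff k p] at h0
    exact Nat.not_dvd_of_pos_of_lt hn hnp h0
  have h2 : (2 : k) ≠ 0 := by exact_mod_cast hcast 2 (by norm_num) (by omega)
  let c : ℕ → k := fun i => i * (i - d) / 2
  have hc0 : c 0 = 0 := by simp [c]
  have hcd : c d = 0 := by simp [c]
  have hcc : ∀ i, c i - 2 * c (i + 1) + c (i + 2) = 1 := by
    intro i
    simp only [c]
    field_simp
    push_cast
    ring
  let s : Module.End k V := h.basis.constr k (fun i => c i • (t ^ ((i : ℕ) - 1)) v)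
  have hs : ∀ i ≤ d, s ((t ^ i) v) = c i • (t ^ (i - 1)) v := by
    intro i hi
    rcases hi.lt_or_eq with hlt | rfl
    · have := h.basis.constr_basis k (fun i => c i • (t ^ ((i : ℕ) - 1)) v) ⟨i, hlt⟩
      rwa [basis_apply] at this
    · rw [h.pow_eq_zero, hcd]; simp
  have ht : ∀ i, t ((t ^ i) v) = (t ^ (i + 1)) v := by
    intro i; rw [pow_succ']; rfl
  have htr : ∀ j, LinearMap.trace k V (s * t ^ j) =
      ∑ i : Fin d, if j = 1 then c (i + 1) else 0 := by
    intro j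
    rw [LinearMap.trace_eq_matrix_trace k h.basis, Matrix.trace]
    refine Finset.sum_congr rfl fun i _ => ?_
    rw [Matrix.diag_apply, LinearMap.toMatrix_apply, basis_apply, Module.End.mul_apply,
      ← Module.End.mul_apply (t ^ j), ← pow_add]
    by_cases hle : j + i ≤ d
    · rw [hs _ hle, map_smul, Finsupp.smul_apply, smul_eq_mul]
      by_cases hji : j + i = 0
      · rw [hji, hc0]; simp; omega
      · have hlt : j + i - 1 < d := by omega
        have := h.basis_apply ⟨j + i - 1, hlt⟩
        simp only at this
        rw [← this, h.basis.repr_self, Finsupp.single_apply]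
        by_cases hj : j = 1
        · subst hj
          rw [if_pos, if_pos rfl, mul_one, add_comm]
          ext; simp
        · rw [if_neg, if_neg hj, mul_zero]
          intro h'; have := congrArg Fin.val h'; simp only at this; omega
    · rw [h.pow_eq_zero_of_le (by omega)]
      have : j ≠ 1 := by have := i.2; omega
      simp [this]
  refine ⟨s, ?_, ?_, ?_⟩
  · refine h.end_ext fun i hi => ?_
    simp only [LinearMap.sub_apply, Module.End.mul_apply, map_sub, ht]
    rcases Nat.eq_zero_or_pos i with rfl | hi0
    · rw [hs 0 (by omega), hs 1 (by omega), hs 2 (by omega), hc0]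
      simp only [map_smul, ht, zero_smul, Nat.zero_add]
      have := hcc 0
      rw [hc0] at this
      simp only [Nat.zero_add] at this
      simp only [Nat.sub_self, Nat.add_one_sub_one]
      rw [map_zero, map_zero]
      linear_combination (norm := module) this • (t ^ 1) v
    · rw [hs i hi.le, hs (i + 1) hi]
      have h3 : s ((t ^ (i + 1 + 1)) v) = c (i + 2) • (t ^ (i + 1)) v := by
        rcases Nat.lt_or_ge d (i + 2) with h' | h'
        · have : i + 1 = d := by omega
          rw [h.pow_eq_zero_of_le (by omega : d ≤ i + 1 + 1), this, h.pow_eq_zero]; simp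
        · exact hs (i + 2) h'
      obtain ⟨m, rfl⟩ : ∃ m, i = m + 1 := ⟨i - 1, by omega⟩
      rw [h3]
      simp only [map_smul, ht, Nat.add_one_sub_one]
      linear_combination (norm := module) (hcc (m + 1)) • (t ^ (m + 1 + 1)) v
  · intro j hj
    rw [htr]; simp [hj]
  · have := htr 1
    rw [pow_one] at this
    rw [this]
    simp only [if_true]
    rw [Fin.sum_univ_eq_sum_range (fun i => c (i + 1))]
    have hsum : ∀ n : ℕ, 12 * ∑ i ∈ Finset.range n, c (i + 1) =
        n * (n + 1) * (2 * n + 1) - 3 * d * (n * (n + 1)) := by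
      intro n
      induction n with
      | zero => simp
      | succ m ih =>
        rw [Finset.sum_range_succ, mul_add, ih]
        simp only [c]
        field_simp
        push_cast
        ring
    intro h0
    have h3 := hsum d
    rw [h0] at h3
    have h4 : ((d : ℕ) : k) * ((d + 1 : ℕ) : k) * ((d - 1 : ℕ) : k) = 0 := by
      push_cast [Nat.cast_sub (by omega : 1 ≤ d)]
      linear_combination h3
    rcases mul_eq_zero.1 h4 with h4 | h4
    · rcases mul_eq_zero.1 h4 with h4 | h4
      · exact hcast d (by omega) (by omega) h4
      · exact hcast (d + 1) (by omega) (by omega) h4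
    · exact hcast (d - 1) (by omega) (by omega) h4

end IsRegularNilpotent

/-- The conjugation action of `G` on `End V` induced by a representation on `V`. -/
def conjRep {k V G : Type*} [Field k] [AddCommGroup V] [Module k V] [Group G]
    (τ : G →* Module.End k V) : G →* Module.End k (Module.End k V) where
  toFun g := LinearMap.mulLeft k (τ g) * LinearMap.mulRight k (τ g⁻¹)
  map_one' := by ext; simp
  map_mul' g h := by
    refine LinearMap.ext fun w => ?_
    simp [mul_assoc]

section

variable {k V G : Type*} [Field k] [AddCommGroup V] [Module k V] [Group G]

theorem conjRep_apply (τ : G →* Module.End k V) (g : G) (w : Module.End k V) :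
    conjRep τ g w = τ g * w * τ g⁻¹ := by
  simp [conjRep, mul_assoc]

theorem conjRep_mul (τ : G →* Module.End k V) (g : G) (w w' : Module.End k V) :
    conjRep τ g (w * w') = conjRep τ g w * conjRep τ g w' := by
  simp only [conjRep_apply]
  have h : τ g⁻¹ * τ g = 1 := by rw [← map_mul, inv_mul_cancel, map_one]
  calc τ g * (w * w') * τ g⁻¹ = τ g * w * 1 * w' * τ g⁻¹ := by simp only [mul_assoc, one_mul]
    _ = _ := by rw [← h]; simp only [mul_assoc]

theorem conjRep_one (τ : G →* Module.End k V) (g : G) :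
    conjRep τ g 1 = 1 := by
  rw [conjRep_apply, mul_one, ← map_mul, mul_inv_cancel, map_one]

theorem conjRep_aeval (τ : G →* Module.End k V) (g : G) (w : Module.End k V)
    (f : Polynomial k) :
    conjRep τ g (Polynomial.aeval w f) = Polynomial.aeval (conjRep τ g w) f := by
  let A : Module.End k V →ₐ[k] Module.End k V :=
    AlgHom.ofLinearMap (conjRep τ g) (conjRep_one τ g) (conjRep_mul τ g)
  exact (Polynomial.aeval_algHom_apply A w f).symm

theorem conjRep_apply_self (τ : G →* Module.End k V) (g h : G) :
    conjRep τ g (τ h) = τ (g * h * g⁻¹) := by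
  simp [conjRep_apply]

theorem trace_conjRep (τ : G →* Module.End k V) (g : G) (w : Module.End k V) :
    LinearMap.trace k V (conjRep τ g w) = LinearMap.trace k V w := by
  rw [conjRep_apply, LinearMap.trace_mul_comm, ← mul_assoc, ← map_mul, inv_mul_cancel, map_one,
    one_mul]

/-- The inner derivation `w ↦ t w - w t` of `End V`. -/
def innerDer (t : Module.End k V) : Module.End k (Module.End k V) :=
  LinearMap.mulLeft k t - LinearMap.mulRight k t

@[simp]
theorem innerDer_apply (t w : Module.End k V) : innerDer t w = t * w - w * t := by
  simp [innerDer]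

theorem innerDer_eq_zero_iff {t w : Module.End k V} : innerDer t w = 0 ↔ Commute w t := by
  rw [innerDer_apply, sub_eq_zero]
  exact ⟨fun h => h.symm, fun h => h.symm⟩

theorem innerDer_mul_of_commute {t w a : Module.End k V} (ha : Commute a t) :
    innerDer t (w * a) = innerDer t w * a := by
  simp only [innerDer_apply, sub_mul, mul_assoc, ha.eq]

theorem trace_mul_innerDer (t u w : Module.End k V) :
    LinearMap.trace k V (u * innerDer t w) = - LinearMap.trace k V (innerDer t u * w) := by
  simp only [innerDer_apply, mul_sub, sub_mul, map_sub]
  have h1 : LinearMap.trace k V (u * (w * t)) = LinearMap.trace k V (t * u * w) := by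
    rw [← mul_assoc, LinearMap.trace_mul_comm, mul_assoc]
  rw [h1, ← mul_assoc]
  ring

theorem innerDer_pow_eq_zero {t : Module.End k V} {d : ℕ} (ht : t ^ d = 0) :
    innerDer t ^ (2 * d - 1) = 0 := by
  have h1 : Commute (LinearMap.mulLeft k t) (LinearMap.mulRight k t) :=
    LinearMap.commute_mulLeft_right t t
  rw [innerDer, sub_eq_add_neg]
  refine h1.neg_right.add_pow_eq_zero_of_add_le_succ_of_pow_eq_zero (m := d) (n := d) ?_ ?_
    (by omega)
  · rw [LinearMap.pow_mulLeft, ht, LinearMap.mulLeft_zero_eq_zero]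
  · rw [neg_pow, LinearMap.pow_mulRight, ht, LinearMap.mulRight_zero_eq_zero, mul_zero]

end

namespace IsRegularNilpotent

variable {k V : Type*} [Field k] [AddCommGroup V] [Module k V] {t : Module.End k V} {v : V} {d : ℕ}

theorem commute_aeval (t : Module.End k V) (f : Polynomial k) :
    Commute (Polynomial.aeval t f) t := by
  conv_rhs => rw [← Polynomial.aeval_X (R := k) t]
  rw [Commute, SemiconjBy, ← map_mul, ← map_mul, mul_comm]

theorem trace_aeval (h : IsRegularNilpotent t v d) (f : Polynomial k) :
    LinearMap.trace k V (Polynomial.aeval t f) = f.coeff 0 * d := by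
  have := h.finiteDimensional
  conv_lhs => rw [← Polynomial.X_mul_divX_add f]
  rw [map_add, map_mul, Polynomial.aeval_X, Polynomial.aeval_C, map_add,
    Algebra.algebraMap_eq_smul_one, map_smul, LinearMap.trace_one, h.finrank_eq]
  have h1 : IsNilpotent (t * Polynomial.aeval t f.divX) := by
    exact (commute_aeval t f.divX).symm.isNilpotent_mul_right ⟨d, h.pow_eq_zero⟩
  have h2 := (LinearMap.isNilpotent_trace_of_isNilpotent h1).eq_zero
  rw [h2, zero_add, smul_eq_mul]

theorem trace_lowering_mul_aeval {s : Module.End k V}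
    (hs : ∀ j ≠ 1, LinearMap.trace k V (s * t ^ j) = 0) (f : Polynomial k) :
    LinearMap.trace k V (s * Polynomial.aeval t f) = f.coeff 1 * LinearMap.trace k V (s * t) := by
  rw [Polynomial.aeval_eq_sum_range, Finset.mul_sum, map_sum]
  simp only [mul_smul_comm, map_smul, smul_eq_mul]
  rw [Finset.sum_eq_single 1]
  · rw [pow_one]
  · intro j _ hj
    rw [hs j hj, mul_zero]
  · intro h1
    rw [Finset.mem_range, not_lt] at h1
    rw [Polynomial.coeff_eq_zero_of_natDegree_lt (by omega), zero_mul]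

/-- A polynomial in `t` without constant term but with nonzero linear term generates the same
algebra as `t`. -/
theorem commute_of_commute_aeval (h : IsRegularNilpotent t v d) {f : Polynomial k}
    (hf0 : f.coeff 0 = 0) (hf1 : f.coeff 1 ≠ 0) {w : Module.End k V}
    (hw : Commute w (Polynomial.aeval t f)) : Commute w t := by
  obtain ⟨g, rfl⟩ : ∃ g, f = Polynomial.X * g := Polynomial.X_dvd_iff.2 hf0
  have hg : g.coeff 0 ≠ 0 := by simpa using hf1
  have hpow : ∀ n, (Polynomial.aeval t (Polynomial.X * g)) ^ n =
      t ^ n * Polynomial.aeval t (g ^ n) := by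
    intro n
    rw [← map_pow, mul_pow, map_mul, map_pow, Polynomial.aeval_X]
  have h2 : IsRegularNilpotent (Polynomial.aeval t (Polynomial.X * g)) v d := by
    refine ⟨by rw [hpow, h.pow_eq_zero, zero_mul], ?_, h.finrank_eq, h.pos⟩
    rw [hpow]
    have : t ^ (d - 1) * Polynomial.aeval t (g ^ (d - 1)) = (g.coeff 0 ^ (d - 1)) • t ^ (d - 1) := by
      rw [← Polynomial.X_mul_divX_add (g ^ (d - 1)), map_add, map_mul, Polynomial.aeval_X,
        Polynomial.aeval_C, mul_add, ← mul_assoc, ← pow_succ, Nat.sub_add_cancel h.pos,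
        h.pow_eq_zero, zero_mul, zero_add, Algebra.algebraMap_eq_smul_one, mul_smul_comm, mul_one,
        Polynomial.coeff_zero_eq_eval_zero, Polynomial.eval_pow, Polynomial.coeff_zero_eq_eval_zero]
    rw [this, LinearMap.smul_apply]
    exact smul_ne_zero (pow_ne_zero _ hg) h.pow_apply_ne_zero
  obtain ⟨q, hq⟩ := h2.exists_aeval_of_commute (commute_aeval t (Polynomial.X * g)).symm
  rw [hq]
  exact Polynomial.induction_on q
    (fun a => by rw [Polynomial.aeval_C]; exact (Algebra.commutes a w).symm)
    (fun p q hp hq => by rw [map_add]; exact hp.add_right hq)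
    (fun n a _ => by
      rw [map_mul, map_pow, Polynomial.aeval_C, Polynomial.aeval_X]
      exact Commute.mul_right (Algebra.commutes a w).symm (hw.pow_right _))

end IsRegularNilpotent

section

variable {k V G : Type*} [Field k] [AddCommGroup V] [Module k V] [Group G]

theorem commute_innerDer_conjRep {τ : G →* Module.End k V} {x : G} {t w : Module.End k V}
    (ht : τ x = 1 + t) : conjRep τ x w - w = innerDer t w * τ x⁻¹ := by
  have h : τ x * τ x⁻¹ = 1 := by rw [← map_mul, mul_inv_cancel, map_one]
  have ht' : t = τ x - 1 := by rw [ht]; abel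
  rw [conjRep_apply, innerDer_apply, ht']
  simp only [sub_mul, mul_sub, one_mul, mul_one, mul_assoc]
  rw [h, mul_one]
  abel

theorem conjRep_eq_self_iff {τ : G →* Module.End k V} {x : G} {t w : Module.End k V}
    (ht : τ x = 1 + t) : conjRep τ x w = w ↔ Commute w t := by
  rw [← sub_eq_zero, commute_innerDer_conjRep ht, ← innerDer_eq_zero_iff]
  refine ⟨fun h => ?_, fun h => by rw [h, zero_mul]⟩
  have h1 : τ x⁻¹ * τ x = 1 := by rw [← map_mul, inv_mul_cancel, map_one]
  rw [← mul_one (innerDer t w), ← h1, ← mul_assoc, h, zero_mul]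

theorem commute_inv_of_eq_one_add {τ : G →* Module.End k V} {x : G} {t : Module.End k V}
    (ht : τ x = 1 + t) : Commute (τ x⁻¹) t := by
  have ht' : t = τ x - 1 := by rw [ht]; abel
  have : Commute (τ x⁻¹) (τ x) := by
    rw [Commute, SemiconjBy, ← map_mul, ← map_mul, inv_mul_cancel, mul_inv_cancel]
  rw [ht']
  exact this.sub_right (Commute.one_right _)

theorem conjRep_sub_one_pow {τ : G →* Module.End k V} {x : G} {t : Module.End k V}
    (ht : τ x = 1 + t) (n : ℕ) (w : Module.End k V) :
    ((conjRep τ x - 1) ^ n) w = (innerDer t ^ n) w * τ x⁻¹ ^ n := by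
  induction n with
  | zero => simp
  | succ n ih =>
    rw [pow_succ', Module.End.mul_apply, ih, LinearMap.sub_apply, Module.End.one_apply,
      commute_innerDer_conjRep ht,
      innerDer_mul_of_commute ((commute_inv_of_eq_one_add ht).pow_left n), pow_succ' (innerDer t),
      Module.End.mul_apply, mul_assoc, ← pow_succ]

theorem trace_mul_innerDer_pow (t u w : Module.End k V) (n : ℕ) :
    LinearMap.trace k V (u * (innerDer t ^ n) w) =
      (-1) ^ n * LinearMap.trace k V ((innerDer t ^ n) u * w) := by
  induction n generalizing u with
  | zero => simp
  | succ n ih =>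
    rw [pow_succ' (innerDer t), Module.End.mul_apply, trace_mul_innerDer, ih, pow_succ,
      ← Module.End.mul_apply, ← pow_succ, pow_succ' (innerDer t)]
    ring

theorem innerDer_pow_mul_of_commute {t w a : Module.End k V} (ha : Commute a t) (n : ℕ) :
    (innerDer t ^ n) (w * a) = (innerDer t ^ n) w * a := by
  induction n with
  | zero => simp
  | succ n ih => simp only [pow_succ', Module.End.mul_apply, ih, innerDer_mul_of_commute ha]

theorem Polynomial.coeff_one_comp {f q : Polynomial k} (hq : q.coeff 0 = 0) :
    (f.comp q).coeff 1 = f.coeff 1 * q.coeff 1 := by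
  have h : ∀ r : Polynomial k, r.coeff 1 = r.derivative.eval 0 := by
    intro r
    rw [← Polynomial.coeff_zero_eq_eval_zero, Polynomial.coeff_derivative]
    simp
  rw [Polynomial.coeff_zero_eq_eval_zero] at hq
  rw [h, h f, h q, Polynomial.derivative_comp, Polynomial.eval_mul, Polynomial.eval_comp, hq,
    mul_comm]

namespace IsRegularNilpotent

variable {t : Module.End k V} {v : V} {d p : ℕ}

/-- The conjugation-invariant operator obtained by transferring the `sl₂`-type endomorphism
attached to a lowering operator `s`. -/
theorem exists_equivariant_endomorphism [Finite G] [hp : Fact p.Prime] [CharP k p]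
    (h : IsRegularNilpotent t v d) (hdp : 2 * d < p) {x : G} (hx : orderOf x = p)
    (hidx : ¬ p ∣ (Subgroup.zpowers x).index) {τ : G →* Module.End k V} (ht : τ x = 1 + t)
    {s : Module.End k V} (hs : (innerDer t ^ 2) s = t)
    (hs1 : ∀ j ≠ 1, LinearMap.trace k V (s * t ^ j) = 0)
    (hs2 : LinearMap.trace k V (s * t) ≠ 0) :
    ∃ (Φ : Module.End k (Module.End k V)) (f : Polynomial k),
      (∀ g, Commute Φ (conjRep τ g)) ∧ f.coeff 0 = 0 ∧ f.coeff 1 ≠ 0 ∧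
      ∀ w, Commute w t → Φ w = LinearMap.trace k V (s * w) • Polynomial.aeval t f := by
  set N : Module.End k (Module.End k V) := conjRep τ x - 1 with hN
  set a := τ x⁻¹ with ha
  have hat : Commute a t := commute_inv_of_eq_one_add ht
  have hNpow := conjRep_sub_one_pow (τ := τ) (x := x) ht
  rw [← hN] at hNpow
  let c : Module.End k V →ₗ[k] k := LinearMap.trace k V ∘ₗ LinearMap.mulLeft k s
  have hc : ∀ w, c w = LinearMap.trace k V (s * w) := fun w => rfl
  have hs3 : (innerDer t ^ 3) s = 0 := by
    rw [pow_succ', Module.End.mul_apply, hs, innerDer_eq_zero_iff]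
  have hNs : (N ^ 3) s = 0 := by rw [hNpow, hs3, zero_mul]
  have hcN : ∀ w, c ((N ^ 3) w) = 0 := by
    intro w
    rw [hc, hNpow, ← innerDer_pow_mul_of_commute (hat.pow_left 3), trace_mul_innerDer_pow, hs3]
    simp
  let φ : Module.End k (Module.End k V) :=
    (c ∘ₗ (N ^ 2)).smulRight s + (c ∘ₗ N).smulRight (N s) + c.smulRight ((N ^ 2) s)
  have hφ : ∀ w, φ w = c ((N ^ 2) w) • s + c (N w) • N s + c w • (N ^ 2) s := fun w => rfl
  have hφN : Commute φ N := by
    refine LinearMap.ext fun w => ?_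
    rw [Module.End.mul_apply, Module.End.mul_apply, hφ, hφ]
    simp only [map_add, map_smul]
    have e1 : (N ^ 2) (N w) = (N ^ 3) w := rfl
    have e2 : N (N w) = (N ^ 2) w := by rw [pow_two]; rfl
    have e3 : N (N s) = (N ^ 2) s := by rw [pow_two]; rfl
    have e4 : N ((N ^ 2) s) = (N ^ 3) s := by rw [pow_succ' N 2]; rfl
    rw [e1, e2, e3, e4, hNs, hcN]
    module
  have hNx : conjRep τ x = N + 1 := by rw [hN]; abel
  have hφx : Commute φ (conjRep τ x) := by
    rw [hNx]; exact hφN.add_right (Commute.one_right _)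
  have hNp : N ^ (p - 1) = 0 := by
    refine LinearMap.ext fun w => ?_
    rw [hNpow, _root_.pow_eq_zero_of_le (by omega : 2 * d - 1 ≤ p - 1)
      (innerDer_pow_eq_zero h.pow_eq_zero)]
    simp
  obtain ⟨Φ, S, hΦ, hS, hSj, hΦw⟩ := exists_transfer_endomorphism x hx (conjRep τ)
    (geom_sum_eq_zero_of_sub_one_pow_eq_zero (p := p) (k := k) hNp) φ hφx hidx
  have hcf : ∀ f : Polynomial k, c (Polynomial.aeval t f) =
      f.coeff 1 * LinearMap.trace k V (s * t) := trace_lowering_mul_aeval hs1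
  choose! j hj using hSj
  have hxpow : ∀ i : ℕ, τ (x ^ i) = Polynomial.aeval t ((1 + Polynomial.X) ^ i : Polynomial k) := by
    intro i; rw [map_pow, ht]; simp
  have hnt : ∀ n ∈ S, conjRep τ n⁻¹ t =
      Polynomial.aeval t ((1 + Polynomial.X) ^ (j n) - 1 : Polynomial k) := by
    intro n hn
    have e : t = τ x - 1 := by rw [ht]; abel
    conv_lhs => rw [e]
    rw [map_sub, conjRep_apply_self, inv_inv, hj n hn, conjRep_one, hxpow, map_sub, map_one]
  have hnw : ∀ n ∈ S, ∀ w, Commute w t → Commute (conjRep τ n⁻¹ w) t ∧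
      c (conjRep τ n⁻¹ w) = j n * c w := by
    intro n hn w hw
    obtain ⟨f, rfl⟩ := h.exists_aeval_of_commute hw
    rw [conjRep_aeval, hnt n hn, ← Polynomial.aeval_comp]
    refine ⟨commute_aeval t _, ?_⟩
    rw [hcf, hcf, Polynomial.coeff_one_comp]
    · rw [Polynomial.coeff_sub, Polynomial.coeff_one_add_X_pow]
      simp [Polynomial.coeff_one]
      ring
    · rw [Polynomial.coeff_sub, Polynomial.coeff_one_add_X_pow]
      simp
  set u := (N ^ 2) s with hu
  have hu' : u = t * a ^ 2 := by rw [hu, hNpow, hs]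
  have hut : Commute u t := by rw [hu']; exact (Commute.refl t).mul_left (hat.pow_left 2)
  have hua : u = Polynomial.aeval t
      (Polynomial.X * (1 + Polynomial.X) ^ ((p - 1) * 2) : Polynomial k) := by
    have : x⁻¹ = x ^ (p - 1) := by
      rw [inv_eq_iff_mul_eq_one, ← pow_succ', Nat.sub_add_cancel hp.out.one_le, ← hx,
        pow_orderOf_eq_one]
    rw [hu', ha, this, ← map_pow, ← pow_mul, hxpow, map_mul, Polynomial.aeval_X]
  have hcu : c u = LinearMap.trace k V (s * t) := by
    rw [hua, hcf, Polynomial.coeff_X_mul, Polynomial.coeff_zero_eq_eval_zero]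
    simp
  have htru : LinearMap.trace k V u = 0 := by
    rw [hua, h.trace_aeval]
    simp
  have hnu : ∀ n ∈ S, Commute (conjRep τ n u) t ∧ (j n : k) * c (conjRep τ n u) = c u := by
    intro n hn
    have e2 : conjRep τ n⁻¹ (conjRep τ n u) = u := by
      rw [← Module.End.mul_apply, ← map_mul, inv_mul_cancel, map_one]; rfl
    have e1 : Commute (conjRep τ n u) t := by
      rw [← conjRep_eq_self_iff ht, ← Module.End.mul_apply, ← map_mul]
      have : x * n = n * x ^ (j n) := by rw [← hj n hn]; group
      rw [this, map_mul, Module.End.mul_apply]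
      congr 1
      rw [map_pow, Module.End.pow_apply]
      exact Function.iterate_fixed ((conjRep_eq_self_iff ht).2 hut) (j n)
    refine ⟨e1, ?_⟩
    rw [← (hnw n hn _ e1).2, e2]
  set E : Module.End k V := ∑ n ∈ S, (j n : k) • conjRep τ n u with hE
  have hEt : Commute E t := by
    refine Commute.sum_left _ _ _ fun n hn => ?_
    exact (hnu n hn).1.smul_left _
  obtain ⟨f, hf⟩ := h.exists_aeval_of_commute hEt
  have hd0 : (d : k) ≠ 0 := by
    intro h0
    rw [CharP.cast_eq_zero_iff k p] at h0
    exact Nat.not_dvd_of_pos_of_lt h.pos (by omega) h0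
  refine ⟨Φ, f, hΦ, ?_, ?_, ?_⟩
  · have : LinearMap.trace k V E = 0 := by
      rw [hE, map_sum]
      refine Finset.sum_eq_zero fun n _ => ?_
      rw [map_smul, trace_conjRep, htru, smul_zero]
    rw [hf, h.trace_aeval] at this
    exact (mul_eq_zero.1 this).resolve_right hd0
  · have : c E = S.card * LinearMap.trace k V (s * t) := by
      rw [hE, map_sum]
      simp only [map_smul, smul_eq_mul]
      rw [Finset.sum_congr rfl fun n hn => (hnu n hn).2, Finset.sum_const, hcu, nsmul_eq_mul]
    intro h0
    rw [hf, hcf, h0, zero_mul] at this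
    exact mul_ne_zero hS hs2 this.symm
  · intro w hw
    rw [hΦw w ((conjRep_eq_self_iff ht).2 hw), ← hf, ← hc, hE, Finset.smul_sum]
    refine Finset.sum_congr rfl fun n hn => ?_
    obtain ⟨h1, h2⟩ := hnw n hn w hw
    have h3 : N (conjRep τ n⁻¹ w) = 0 := by
      rw [hN, LinearMap.sub_apply, (conjRep_eq_self_iff ht).2 h1, Module.End.one_apply, sub_self]
    rw [hφ, pow_two, Module.End.mul_apply, h3, map_zero, map_zero, zero_smul, zero_smul, zero_add,
      zero_add, h2, map_smul, smul_smul, mul_comm]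

end IsRegularNilpotent

end

namespace IsRegularNilpotent

variable {k V G : Type*} [Field k] [AddCommGroup V] [Module k V] [Group G]
variable {t : Module.End k V} {v : V} {d p : ℕ}

/-- `End V` contains a three-dimensional subrepresentation with an explicit basis
`e, N y, y`, where `N = x - 1` and `N² y = e`. -/
theorem exists_stable_three_dim [Finite G] [hp : Fact p.Prime] [CharP k p]
    (h : IsRegularNilpotent t v d) (hp5 : 5 ≤ p) (hd2 : 2 ≤ d) (hdp : 2 * d < p) {x : G}
    (hx : orderOf x = p) (hidx : ¬ p ∣ (Subgroup.zpowers x).index) {τ : G →* Module.End k V}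
    (ht : τ x = 1 + t) :
    ∃ e y z : Module.End k V, (∀ w, Commute w e → Commute w t) ∧
      conjRep τ x e = e ∧ conjRep τ x z = z + e ∧ conjRep τ x y = y + z ∧
      LinearMap.trace k V (e * e) = 0 ∧ LinearMap.trace k V (y * y) = 0 ∧
      LinearMap.trace k V (e * y) ≠ 0 ∧
      ∀ g, ∀ w ∈ Submodule.span k {e, z, y}, conjRep τ g w ∈ Submodule.span k {e, z, y} := by
  have := h.finiteDimensional
  obtain ⟨s, hs, hs1, hs2⟩ := h.exists_lowering hp5 hd2 (by omega)
  have hs' : (innerDer t ^ 2) s = t := by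
    rw [pow_two, Module.End.mul_apply, innerDer_apply, innerDer_apply, hs]
  obtain ⟨Φ, f, hΦ, hf0, hf1, hΦw⟩ :=
    h.exists_equivariant_endomorphism hdp hx hidx ht hs' hs1 hs2
  set E := Polynomial.aeval t f with hE
  have hEt : Commute E t := commute_aeval t f
  set N : Module.End k (Module.End k V) := conjRep τ x - 1 with hN
  have hNpow := conjRep_sub_one_pow (τ := τ) (x := x) ht
  rw [← hN] at hNpow
  have hN0 : ∀ w, N w = 0 ↔ Commute w t := by
    intro w
    rw [hN, LinearMap.sub_apply, Module.End.one_apply, sub_eq_zero, conjRep_eq_self_iff ht]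
  have hNnil : N ^ (2 * d - 1) = 0 := by
    refine LinearMap.ext fun w => ?_
    rw [hNpow, innerDer_pow_eq_zero h.pow_eq_zero]
    simp
  have hxx : τ x * τ x⁻¹ = 1 := by rw [← map_mul, mul_inv_cancel, map_one]
  have hxx' : τ x⁻¹ * τ x = 1 := by rw [← map_mul, inv_mul_cancel, map_one]
  have hat := commute_inv_of_eq_one_add ht
  have hxt : Commute (τ x) t := by rw [ht]; exact (Commute.one_left t).add_left (Commute.refl t)
  let c : Module.End k V →ₗ[k] k := LinearMap.trace k V ∘ₗ LinearMap.mulLeft k s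
  have hcE : c E ≠ 0 := by
    have : c E = f.coeff 1 * LinearMap.trace k V (s * t) := trace_lowering_mul_aeval hs1 f
    rw [this]; exact mul_ne_zero hf1 hs2
  have hΦc : ∀ w, Commute w t → Φ w = c w • E := hΦw
  have hΦN : Commute Φ N := (hΦ x).sub_right (Commute.one_right _)
  have hcN : ∀ w, c ((N ^ 3) w) = 0 := by
    intro w
    change LinearMap.trace k V (s * (N ^ 3) w) = 0
    have hs3 : (innerDer t ^ 3) s = 0 := by
      rw [pow_succ', Module.End.mul_apply, hs', innerDer_eq_zero_iff]
    rw [hNpow, ← innerDer_pow_mul_of_commute (hat.pow_left 3), trace_mul_innerDer_pow, hs3]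
    simp
  obtain ⟨n, hn1, hn⟩ : ∃ n, 1 ≤ n ∧
      IsCompl (LinearMap.ker (Φ ^ n)) (LinearMap.range (Φ ^ n)) := by
    obtain ⟨n, hn⟩ := Filter.eventually_atTop.1 Φ.eventually_isCompl_ker_pow_range_pow
    exact ⟨n + 1, by omega, hn _ (by omega)⟩
  set U := LinearMap.range (Φ ^ n) with hU
  have hUg : ∀ g, ∀ w ∈ U, conjRep τ g w ∈ U := by
    rintro g _ ⟨w, rfl⟩
    exact ⟨conjRep τ g w, by
      rw [← Module.End.mul_apply, ← Module.End.mul_apply, ((hΦ g).pow_left n).eq]⟩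
  have hUN : ∀ w ∈ U, N w ∈ U := fun w hw => by
    rw [hN, LinearMap.sub_apply, Module.End.one_apply]; exact U.sub_mem (hUg x w hw) hw
  have hΦE : ∀ m, (Φ ^ m) E = (c E) ^ m • E := by
    intro m
    induction m with
    | zero => simp
    | succ m ih =>
      rw [pow_succ', Module.End.mul_apply, ih, map_smul, hΦc E hEt, smul_smul, pow_succ]
  have hEU : E ∈ U := ⟨((c E) ^ n)⁻¹ • E, by
    rw [map_smul, hΦE, smul_smul, inv_mul_cancel₀ (pow_ne_zero _ hcE), one_smul]⟩
  have hker : ∀ w ∈ U, N w = 0 → ∃ l : k, w = l • E := by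
    intro w hw hNw
    refine ⟨(c E)⁻¹ * c w, ?_⟩
    rw [← sub_eq_zero]
    refine (Submodule.disjoint_def.1 hn.disjoint) _ ?_ (U.sub_mem hw (U.smul_mem _ hEU))
    rw [LinearMap.mem_ker, ← Nat.sub_add_cancel hn1, pow_succ, Module.End.mul_apply, map_sub,
      map_smul, hΦc w ((hN0 w).1 hNw), hΦc E hEt, smul_smul, mul_right_comm,
      inv_mul_cancel₀ hcE, one_mul, sub_self, map_zero]
  obtain ⟨g, hg⟩ : ∃ g, f = Polynomial.X * g := Polynomial.X_dvd_iff.2 hf0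
  have himD : ∀ q : Polynomial k, (innerDer t ^ 2) (s * Polynomial.aeval t q) =
      Polynomial.aeval t (Polynomial.X * q) := by
    intro q
    rw [innerDer_pow_mul_of_commute (commute_aeval t q), hs', map_mul, Polynomial.aeval_X]
  have himE : (innerDer t ^ 2) (s * Polynomial.aeval t g) = E := by rw [himD, ← hg]
  obtain ⟨y₀, hy₀U, hy₀⟩ : ∃ y ∈ U, (N ^ 2) y = E := by
    refine ⟨((c E) ^ n)⁻¹ • (Φ ^ n) (s * Polynomial.aeval t g * τ x ^ 2),
      U.smul_mem _ ⟨_, rfl⟩, ?_⟩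
    rw [map_smul, ← Module.End.mul_apply, ← (hΦN.pow_pow n 2).eq, Module.End.mul_apply, hNpow,
      innerDer_pow_mul_of_commute (hxt.pow_left 2), himE, mul_assoc, pow_two, pow_two,
      mul_assoc (τ x), ← mul_assoc (τ x) (τ x⁻¹), hxx, one_mul, hxx, mul_one, hΦE, smul_smul,
      inv_mul_cancel₀ (pow_ne_zero _ hcE), one_smul]
  have hN4 : ∀ w ∈ U, (N ^ 4) w = 0 → (N ^ 3) w = 0 := by
    intro w hw hw4
    obtain ⟨l, hl⟩ := hker ((N ^ 3) w) (by
      simp only [pow_succ', pow_zero, mul_one, Module.End.mul_apply]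
      exact hUN _ (hUN _ (hUN _ hw))) (by rw [← Module.End.mul_apply, ← pow_succ', hw4])
    have := hcN w
    rw [hl, map_smul, smul_eq_mul] at this
    rw [hl, (mul_eq_zero.1 this).resolve_right hcE, zero_smul]
  have hN3 : ∀ m, ∀ w ∈ U, (N ^ m) w = 0 → (N ^ 3) w = 0 := by
    intro m
    induction m with
    | zero => intro w _ h0; rw [pow_zero, Module.End.one_apply] at h0; rw [h0, map_zero]
    | succ m ih =>
      intro w hw hm
      refine hN4 w hw ?_
      rw [pow_succ, Module.End.mul_apply]
      refine ih _ (hUN w hw) ?_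
      rw [← Module.End.mul_apply, ← pow_succ, hm]
  have hUspan : ∀ w ∈ U, w ∈ Submodule.span k {E, N y₀, y₀} := by
    intro w hw
    have h3 := hN3 _ w hw (by rw [hNnil]; rfl)
    have e2 : ∀ w, (N ^ 2) w = N (N w) := fun w => by rw [pow_two]; rfl
    have e3 : ∀ w, (N ^ 3) w = N (N (N w)) := fun w => by
      simp only [pow_succ', pow_zero, mul_one]; rfl
    rw [e3] at h3
    rw [e2] at hy₀
    obtain ⟨l, hl⟩ := hker _ (hUN _ (hUN _ hw)) h3
    have hw1 : w - l • y₀ ∈ U := U.sub_mem hw (U.smul_mem _ hy₀U)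
    obtain ⟨m, hm⟩ := hker _ (hUN _ hw1) (by
      rw [map_sub, map_sub, map_smul, map_smul, hl, hy₀, sub_self])
    obtain ⟨r, hr⟩ := hker _ (U.sub_mem hw1 (U.smul_mem m (hUN _ hy₀U))) (by
      rw [map_sub, map_smul, hy₀, hm, sub_self])
    refine Submodule.mem_span_triple.2 ⟨r, m, l, ?_⟩
    rw [← hr]
    abel
  have htrEE : LinearMap.trace k V (E * E) = 0 := by
    rw [hE, ← map_mul, h.trace_aeval, Polynomial.mul_coeff_zero, hf0]
    simp
  have htrEy : LinearMap.trace k V (E * y₀) ≠ 0 := by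
    have hq : E * τ x ^ 2 = Polynomial.aeval t
        (Polynomial.X * (g * (1 + Polynomial.X) ^ 2) : Polynomial k) := by
      rw [← mul_assoc, ← hg, map_mul, ht, hE]; simp
    set q : Polynomial k := g * (1 + Polynomial.X) ^ 2 with hqdef
    set z := y₀ - s * Polynomial.aeval t q with hz
    have hDz : (innerDer t ^ 2) z = 0 := by
      have : (innerDer t ^ 2) y₀ = E * τ x ^ 2 := by
        rw [← hy₀, hNpow, mul_assoc, pow_two (τ x), pow_two (τ x⁻¹), mul_assoc (τ x⁻¹),
          ← mul_assoc (τ x⁻¹) (τ x), hxx', one_mul, hxx', mul_one]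
      rw [hz, map_sub, himD, this, hq, sub_self]
    have hEz : LinearMap.trace k V (E * z) = 0 := by
      have := trace_mul_innerDer_pow (k := k) t (s * Polynomial.aeval t g) z 2
      rw [hDz, mul_zero, map_zero, himE] at this
      simpa using this.symm
    have hy : y₀ = z + s * Polynomial.aeval t q := by rw [hz]; abel
    rw [hy, mul_add, map_add, hEz, zero_add, LinearMap.trace_mul_comm, mul_assoc, hE, ← map_mul,
      trace_lowering_mul_aeval hs1, hg, mul_left_comm, Polynomial.coeff_X_mul, hqdef,
      Polynomial.coeff_zero_eq_eval_zero]
    have hg0 : g.eval 0 ≠ 0 := by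
      rwa [hg, Polynomial.coeff_X_mul, Polynomial.coeff_zero_eq_eval_zero] at hf1
    simp [hg0, hs2]
  have h20 : (2 : k) ≠ 0 := by
    intro h0
    have : ((2 : ℕ) : k) = 0 := by exact_mod_cast h0
    rw [CharP.cast_eq_zero_iff k p] at this
    exact Nat.not_dvd_of_pos_of_lt two_pos (by omega) this
  set m := -(LinearMap.trace k V (y₀ * y₀)) / (2 * LinearMap.trace k V (E * y₀)) with hm
  have hNE : N E = 0 := (hN0 E).2 hEt
  have hNy : N (y₀ + m • E) = N y₀ := by rw [map_add, map_smul, hNE, smul_zero, add_zero]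
  have hspan : Submodule.span k {E, N y₀, y₀ + m • E} = Submodule.span k {E, N y₀, y₀} := by
    refine le_antisymm (Submodule.span_le.2 ?_) (Submodule.span_le.2 ?_)
    · rintro w (rfl | rfl | rfl)
      · exact Submodule.subset_span (by simp)
      · exact Submodule.subset_span (by simp)
      · exact Submodule.add_mem _ (Submodule.subset_span (by simp))
          (Submodule.smul_mem _ _ (Submodule.subset_span (by simp)))
    · rintro w (rfl | rfl | rfl)
      · exact Submodule.subset_span (by simp)
      · exact Submodule.subset_span (by simp)
      · exact Submodule.mem_span_triple.2 ⟨-m, 0, 1, by module⟩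
  have hNx : ∀ w, conjRep τ x w = w + N w := by
    intro w; rw [hN, LinearMap.sub_apply, Module.End.one_apply]; abel
  refine ⟨E, y₀ + m • E, N y₀, fun w hw => h.commute_of_commute_aeval hf0 hf1 hw, ?_, ?_, ?_,
    htrEE, ?_, ?_, ?_⟩
  · rw [hNx, hNE, add_zero]
  · rw [hNx, ← hy₀, pow_two]; rfl
  · rw [hNx, hNy]
  · have e : (y₀ + m • E) * (y₀ + m • E) = y₀ * y₀ + m • (E * y₀ + y₀ * E) + (m * m) • (E * E) := by
      simp only [mul_add, add_mul, smul_mul_assoc, mul_smul_comm, smul_add, smul_smul]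
      abel
    rw [e]
    simp only [map_add, map_smul, htrEE, LinearMap.trace_mul_comm k y₀ E, smul_eq_mul, hm]
    field_simp
    ring
  · rw [mul_add, mul_smul_comm, map_add, map_smul, htrEE, smul_zero, add_zero]
    exact htrEy
  · rw [hspan]
    intro g w hw
    refine hUspan _ (hUg g w ?_)
    refine Submodule.span_le.2 ?_ hw
    rintro w (rfl | rfl | rfl)
    · exact hEU
    · exact hUN _ hy₀U
    · exact hy₀U

end IsRegularNilpotent

/-- The discriminant form `α δ - γ²` of the symmetric matrix with rows `(α, γ)` and `(γ, δ)`. -/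
def symDet {k : Type*} [Field k] (w : k × k × k) : k := w.1 * w.2.2 - w.2.1 ^ 2

/-- The action of the symmetric square of a `2 × 2` matrix with rows `(a, b)`, `(c, d)`. -/
def symSq {k : Type*} [Field k] (a b c d : k) : Module.End k (k × k × k) where
  toFun w := (a ^ 2 * w.1 + 2 * a * b * w.2.1 + b ^ 2 * w.2.2,
    a * c * w.1 + (a * d + b * c) * w.2.1 + b * d * w.2.2,
    c ^ 2 * w.1 + 2 * c * d * w.2.1 + d ^ 2 * w.2.2)
  map_add' u w := by ext <;> simp <;> ring
  map_smul' r w := by ext <;> simp <;> ring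

theorem symSq_apply {k : Type*} [Field k] (a b c d : k) (w : k × k × k) :
    symSq a b c d w = (a ^ 2 * w.1 + 2 * a * b * w.2.1 + b ^ 2 * w.2.2,
    a * c * w.1 + (a * d + b * c) * w.2.1 + b * d * w.2.2,
    c ^ 2 * w.1 + 2 * c * d * w.2.1 + d ^ 2 * w.2.2) := rfl

/-- A linear map `ι` which transports the form `symDet` has trivial kernel. -/
theorem injective_of_symDet_eq {k M : Type*} [Field k] [AddCommGroup M] [Module k M]
    (ι : (k × k × k) →ₗ[k] M) (q : M → k) {β : k} (hβ : β ≠ 0)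
    (hq : ∀ w, q (ι w) = β * symDet w) : Function.Injective ι := by
  rw [injective_iff_map_eq_zero]
  rintro ⟨a, b, c⟩ h
  have key : ∀ w : k × k × k, symDet ((a, b, c) + w) = symDet w := by
    intro w
    apply mul_left_cancel₀ hβ
    rw [← hq, ← hq, map_add, h, zero_add]
  have h0 := key 0
  have h1 := key (1, 0, 0)
  have h2 := key (0, 0, 1)
  simp only [symDet, Prod.mk_add_mk, add_zero, Prod.fst_zero, Prod.snd_zero, mul_zero,
    mul_one] at h0 h1 h2
  have hc : c = 0 := by linear_combination h1 - h0
  have ha : a = 0 := by linear_combination h2 - h0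
  have hb : b ^ 2 = 0 := by rw [hc] at h0; linear_combination -h0
  rw [ha, hc, pow_eq_zero_iff (by norm_num) |>.1 hb]
  rfl

namespace IsRegularNilpotent

variable {k V G : Type*} [Field k] [AddCommGroup V] [Module k V] [Group G]
variable {t : Module.End k V} {v : V} {d p : ℕ}

/-- A finite linear group in characteristic `p` containing a regular unipotent element `x` of
order `p`, in dimension less than `p / 2` and with Sylow subgroup `⟨x⟩`, acts on a
three-dimensional quadratic space through which `x` acts as the symmetric square of a
transvection. -/
theorem exists_ternary_representation [Finite G] [hp : Fact p.Prime] [CharP k p]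
    (h : IsRegularNilpotent t v d) (hp5 : 5 ≤ p) (hd2 : 2 ≤ d) (hdp : 2 * d < p) {x : G}
    (hx : orderOf x = p) (hidx : ¬ p ∣ (Subgroup.zpowers x).index) {τ : G →* Module.End k V}
    (ht : τ x = 1 + t) :
    ∃ r : G →* Module.End k (k × k × k), (∀ g w, symDet (r g w) = symDet w) ∧
      r x = symSq 1 1 0 1 ∧ (∀ g, τ g = -1 → r g = 1) ∧
      ∀ g, r g = 1 → Commute (τ g) (τ x) := by
  obtain ⟨e, y, z, hcomm, hxe, hxz, hxy, hee, hyy, hey, hst⟩ :=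
    h.exists_stable_three_dim hp5 hd2 hdp hx hidx ht
  have h20 : (2 : k) ≠ 0 := by
    intro h0
    have : ((2 : ℕ) : k) = 0 := by exact_mod_cast h0
    rw [CharP.cast_eq_zero_iff k p] at this
    exact Nat.not_dvd_of_pos_of_lt two_pos (by omega) this
  set b : k := LinearMap.trace k V (e * y) with hb
  have tr : ∀ u w, LinearMap.trace k V (conjRep τ x u * conjRep τ x w) =
      LinearMap.trace k V (u * w) := by
    intro u w; rw [← conjRep_mul, trace_conjRep]
  have hye : LinearMap.trace k V (y * e) = b := by rw [LinearMap.trace_mul_comm]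
  have hez : LinearMap.trace k V (e * z) = 0 := by
    have := tr e y
    rw [hxe, hxy, mul_add, map_add] at this
    linear_combination this
  have hze : LinearMap.trace k V (z * e) = 0 := by rw [LinearMap.trace_mul_comm, hez]
  have hyz0 : LinearMap.trace k V (y * z) = LinearMap.trace k V (z * y) :=
    LinearMap.trace_mul_comm k y z
  have hzz : LinearMap.trace k V (z * z) = -b := by
    have := tr z y
    rw [hxz, hxy] at this
    simp only [mul_add, add_mul, map_add, hez] at this
    linear_combination this
  have hyz : LinearMap.trace k V (y * z) = b / 2 := by
    have := tr y y
    rw [hxy] at this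
    simp only [mul_add, add_mul, map_add, hzz] at this
    field_simp
    linear_combination this + hyz0
  have hzy : LinearMap.trace k V (z * y) = b / 2 := by rw [← hyz0, hyz]
  let ι : (k × k × k) →ₗ[k] Module.End k V :=
    { toFun := fun w => (w.1 / 2 - w.2.1 / 2) • e + w.2.1 • z + w.2.2 • y
      map_add' := fun u w => by
        simp only [Prod.fst_add, Prod.snd_add]
        module
      map_smul' := fun r w => by
        simp only [Prod.smul_fst, Prod.smul_snd, RingHom.id_apply, smul_eq_mul]
        module }
  have hι : ∀ w, ι w = (w.1 / 2 - w.2.1 / 2) • e + w.2.1 • z + w.2.2 • y := fun w => rfl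
  have hιq : ∀ w, LinearMap.trace k V (ι w * ι w) = b * symDet w := by
    intro w
    rw [hι]
    simp only [mul_add, add_mul, smul_mul_assoc, mul_smul_comm, map_add, map_smul, hee, hyy, hye,
      hez, hze, hzz, hyz, hzy, ← hb, smul_eq_mul, symDet]
    field_simp
    ring
  have hinj : Function.Injective ι := injective_of_symDet_eq ι
    (fun w => LinearMap.trace k V (w * w)) hey hιq
  have hspan : ∀ w, w ∈ Submodule.span k {e, z, y} ↔ ∃ u, ι u = w := by
    intro w
    rw [Submodule.mem_span_triple]
    constructor
    · rintro ⟨r, s, q, rfl⟩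
      refine ⟨(2 * r + s, s, q), ?_⟩
      rw [hι]
      congr 3
      field_simp
      ring
    · rintro ⟨u, rfl⟩
      exact ⟨_, _, _, rfl⟩
  have hstab : ∀ g u, ∃ u', ι u' = conjRep τ g (ι u) := fun g u =>
    (hspan _).1 (hst g _ ((hspan _).2 ⟨u, rfl⟩))
  choose f hf using hstab
  let r : G →* Module.End k (k × k × k) :=
    { toFun := fun g =>
        { toFun := f g
          map_add' := fun u w => hinj (by rw [map_add, hf, hf, hf, map_add, map_add])
          map_smul' := fun c u => hinj (by
            rw [RingHom.id_apply, map_smul, hf, hf, map_smul, map_smul]) }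
      map_one' := LinearMap.ext fun u => hinj (by
        change ι (f 1 u) = ι u
        rw [hf, map_one]; rfl)
      map_mul' := fun g g' => LinearMap.ext fun u => hinj (by
        change ι (f (g * g') u) = ι (f g (f g' u))
        rw [hf, hf, hf, map_mul]; rfl) }
  have hr : ∀ g u, ι (r g u) = conjRep τ g (ι u) := hf
  refine ⟨r, ?_, ?_, ?_, ?_⟩
  · intro g w
    apply mul_left_cancel₀ hey
    rw [← hιq, ← hιq, hr, ← conjRep_mul, trace_conjRep]
  · refine LinearMap.ext fun w => hinj ?_
    rw [hr, hι, hι, symSq_apply]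
    simp only [map_add, map_smul, hxe, hxz, hxy]
    have : ∀ a a' b b' c c' : k, a = a' → b = b' → c = c' →
      a • e + b • z + c • y = a' • e + b' • z + c' • y := by rintro _ _ _ _ _ _ rfl rfl rfl; rfl
    refine Eq.trans ?_ (this (w.1 / 2 - w.2.1 / 2 + w.2.1) _ (w.2.1 + w.2.2) _ w.2.2 _ ?_ ?_ ?_)
    · module
    · field_simp; ring
    · ring
    · ring
  · intro g hg
    refine LinearMap.ext fun w => hinj ?_
    have h1 : τ g * τ g⁻¹ = 1 := by rw [← map_mul, mul_inv_cancel, map_one]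
    rw [hg, neg_mul, one_mul] at h1
    rw [hr, conjRep_apply, hg, neg_eq_iff_eq_neg.1 h1, Module.End.one_apply]
    simp
  · intro g hg
    have h1 : conjRep τ g e = e := by
      have h2 := hr g (2, 0, 0)
      have h3 : ι (2, 0, 0) = e := by rw [hι]; simp [h20]
      rwa [hg, Module.End.one_apply, h3, eq_comm] at h2
    have h2 : Commute (τ g) e := by
      rw [conjRep_apply] at h1
      have h3 : τ g⁻¹ * τ g = 1 := by rw [← map_mul, inv_mul_cancel, map_one]
      rw [Commute, SemiconjBy]
      conv_rhs => rw [← h1]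
      rw [mul_assoc, h3, mul_one]
    rw [ht]
    exact (Commute.one_right _).add_right (hcomm _ h2)

end IsRegularNilpotent

section

variable {k : Type*} [Field k]

theorem symSq_mul (a b c d a' b' c' d' : k) : symSq a b c d * symSq a' b' c' d' =
    symSq (a * a' + b * c') (a * b' + b * d') (c * a' + d * c') (c * b' + d * d') := by
  refine LinearMap.ext fun w => ?_
  simp only [Module.End.mul_apply, symSq_apply]
  ext
  · ring
  · ring
  · ring

theorem symSq_one : symSq (1 : k) 0 0 1 = 1 := by
  refine LinearMap.ext fun w => ?_
  simp [symSq_apply]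

/-- The diagonal operator with entries `a, b, c`. -/
def diagThree (a b c : k) : Module.End k (k × k × k) where
  toFun w := (a * w.1, b * w.2.1, c * w.2.2)
  map_add' u w := by ext <;> simp <;> ring
  map_smul' r w := by ext <;> simp <;> ring

theorem diagThree_apply (a b c : k) (w : k × k × k) :
    diagThree a b c w = (a * w.1, b * w.2.1, c * w.2.2) := rfl

theorem End.ext_three {T T' : Module.End k (k × k × k)} (h1 : T (1, 0, 0) = T' (1, 0, 0))
    (h2 : T (0, 1, 0) = T' (0, 1, 0)) (h3 : T (0, 0, 1) = T' (0, 0, 1)) : T = T' := by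
  refine LinearMap.ext fun w => ?_
  have : w = w.1 • (1, 0, 0) + w.2.1 • (0, 1, 0) + w.2.2 • ((0, 0, 1) : k × k × k) := by
    ext <;> simp
  rw [this]
  simp only [map_add, map_smul, h1, h2, h3]

theorem symDet_polar {T : Module.End k (k × k × k)} (hT : ∀ w, symDet (T w) = symDet w)
    (u w : k × k × k) :
    (T u).1 * (T w).2.2 + (T w).1 * (T u).2.2 - 2 * (T u).2.1 * (T w).2.1 =
      u.1 * w.2.2 + w.1 * u.2.2 - 2 * u.2.1 * w.2.1 := by
  have h1 := hT (u + w)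
  have h2 := hT u
  have h3 := hT w
  rw [map_add] at h1
  simp only [symDet, Prod.fst_add, Prod.snd_add] at h1 h2 h3
  linear_combination h1 - h2 - h3

theorem symDet_symSq {a b c d : k} (h : a * d - b * c = 1) (w : k × k × k) :
    symDet (symSq a b c d w) = symDet w := by
  simp only [symDet, symSq_apply]
  linear_combination ((a * d - b * c + 1) * (w.1 * w.2.2 - w.2.1 ^ 2)) * h

/-- An isometry moving the isotropic line of `(1, 0, 0)` can be normalised on it. -/
theorem exists_symSq_mul_apply_eq {T : Module.End k (k × k × k)}
    (hT : ∀ w, symDet (T w) = symDet w) (h : (T (1, 0, 0)).2.2 ≠ 0) :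
    ∃ s : k, (symSq 1 s 0 1 * T) (1, 0, 0) = (0, 0, (T (1, 0, 0)).2.2) := by
  have h1 := hT (1, 0, 0)
  simp only [symDet, mul_zero] at h1
  refine ⟨-(T (1, 0, 0)).2.1 / (T (1, 0, 0)).2.2, ?_⟩
  rw [Module.End.mul_apply, symSq_apply]
  ext
  · simp only [one_pow, one_mul, mul_one]
    field_simp
    linear_combination h1
  · simp only [one_mul, mul_one, mul_zero, zero_mul, add_zero]
    field_simp
    ring
  · simp

/-- An isometry fixing the isotropic line of `(1, 0, 0)` is diagonal up to a transvection. -/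
theorem exists_symSq_mul_eq_diagThree {T : Module.End k (k × k × k)}
    (hT : ∀ w, symDet (T w) = symDet w) {a : k} (h : T (1, 0, 0) = (a, 0, 0)) :
    ∃ s ε : k, a ≠ 0 ∧ ε ^ 2 = 1 ∧ symSq 1 s 0 1 * T = diagThree a ε a⁻¹ := by
  have h12 := symDet_polar hT (1, 0, 0) (0, 1, 0)
  have h13 := symDet_polar hT (1, 0, 0) (0, 0, 1)
  have h23 := symDet_polar hT (0, 1, 0) (0, 0, 1)
  have e2 := hT (0, 1, 0)
  have e3 := hT (0, 0, 1)
  rw [h] at h12 h13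
  rcases hb : T (0, 1, 0) with ⟨b1, b2, b3⟩
  rcases hc : T (0, 0, 1) with ⟨c1, c2, c3⟩
  rw [hb] at h12 h23 e2
  rw [hc] at h13 h23 e3
  simp only [symDet] at e2 e3
  simp only [mul_zero, zero_mul, add_zero, sub_zero, mul_one, zero_sub, one_pow] at h12 h13 h23 e2 e3
  have ha : a ≠ 0 := by rintro rfl; simp at h13
  have hb3 : b3 = 0 := (mul_eq_zero.1 h12).resolve_left ha
  have hc3 : c3 = a⁻¹ := eq_inv_of_mul_eq_one_right h13
  subst hb3
  subst hc3
  refine ⟨-a * c2, b2, ha, by linear_combination -e2, End.ext_three ?_ ?_ ?_⟩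
  · rw [Module.End.mul_apply, h, symSq_apply, diagThree_apply]
    simp
  · rw [Module.End.mul_apply, hb, symSq_apply, diagThree_apply]
    have : b1 - 2 * a * c2 * b2 = 0 := by
      field_simp at h23
      linear_combination h23
    ext
    · simp only [one_pow, one_mul, mul_one, mul_zero, add_zero]
      linear_combination this
    · simp
    · simp
  · rw [Module.End.mul_apply, hc, symSq_apply, diagThree_apply]
    ext
    · simp only [one_pow, one_mul, mul_one, mul_zero]
      field_simp at e3 ⊢
      linear_combination e3
    · simp only [mul_one, mul_zero, zero_mul, zero_add]
      field_simp
      ring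
    · simp

theorem diagThree_mul_symSq {a e : k} (ha : a ≠ 0) (he : e ^ 2 = 1) (c : k) :
    diagThree a e a⁻¹ * symSq 1 c 0 1 = symSq 1 (a * e * c) 0 1 * diagThree a e a⁻¹ := by
  refine LinearMap.ext fun w => ?_
  simp only [Module.End.mul_apply, diagThree_apply, symSq_apply]
  ext
  · simp only [one_pow, one_mul, mul_one]
    field_simp
    linear_combination (-(2 * w.2.1 * c + w.2.2 * c ^ 2)) * he
  · simp only [one_mul, mul_one, mul_zero, zero_mul, zero_add, add_zero]
    field_simp
  · simp

theorem symSq_eq_of_ne_zero {a b c d : k} (h : a * d - b * c = 1) (hc : c ≠ 0) :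
    symSq a b c d = symSq 1 ((a - 1) / c) 0 1 * symSq 1 0 c 1 * symSq 1 ((d - 1) / c) 0 1 := by
  rw [symSq_mul, symSq_mul]
  congr 1
  · field_simp; ring
  · field_simp; linear_combination -h
  · ring
  · field_simp; ring

theorem symSq_eq_of_eq_zero {a b d : k} :
    symSq a b 0 d = symSq 1 0 (-1) 1 * symSq a b a (b + d) := by
  rw [symSq_mul]
  congr 1 <;> ring

end

/-- A group of isometries of the ternary form `symDet` over `𝔽_p` containing a transvection
square, whose normaliser in the group is small, is the full image of `SL₂(p)`. -/
theorem range_eq_symSq_of_ternary_representation {p : ℕ} [Fact p.Prime]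
    {G : Type*} [Group G] {x : G} (r : G →* Module.End (ZMod p) (ZMod p × ZMod p × ZMod p))
    (hr : ∀ g w, symDet (r g w) = symDet w) (hx : r x = symSq 1 1 0 1)
    (hN : ∀ g c, r g * r x = symSq 1 c 0 1 * r g →
      IsSquare c ∧ (c = 1 → ∃ i : ℕ, r g = r (x ^ i)))
    (hmove : ∃ g, ∀ a, r g (1, 0, 0) ≠ (a, 0, 0)) :
    (∀ a b c d, a * d - b * c = 1 → ∃ g, r g = symSq a b c d) ∧
      ∀ g, ∃ a b c d, a * d - b * c = 1 ∧ r g = symSq a b c d := by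
  have hxi : ∀ i : ℕ, r (x ^ i) = symSq 1 (i : ZMod p) 0 1 := by
    intro i
    induction i with
    | zero => rw [pow_zero, map_one, Nat.cast_zero, symSq_one]
    | succ i ih =>
      rw [pow_succ, map_mul, ih, hx, symSq_mul]
      congr 1 <;> simp; ring
  have hu : ∀ s : ZMod p, ∃ i : ℕ, r (x ^ i) = symSq 1 s 0 1 := fun s =>
    ⟨s.val, by rw [hxi, ZMod.natCast_zmod_val]⟩
  have hmv : ∀ g, (∃ a, r g (1, 0, 0) = (a, 0, 0)) ∨ (r g (1, 0, 0)).2.2 ≠ 0 := by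
    intro g
    by_cases h0 : (r g (1, 0, 0)).2.2 = 0
    · left
      have h1 := hr g (1, 0, 0)
      simp only [symDet, mul_zero, h0] at h1
      refine ⟨(r g (1, 0, 0)).1, ?_⟩
      ext
      · rfl
      · have : (r g (1, 0, 0)).2.1 ^ 2 = 0 := by linear_combination -h1
        exact pow_eq_zero_iff (by norm_num) |>.1 this
      · exact h0
    · exact Or.inr h0
  have hWeyl : ∀ g, (r g (1, 0, 0)).2.2 ≠ 0 → ∃ (i : ℕ) (δ : ZMod p), δ ≠ 0 ∧
      r (x ^ i * g) (1, 0, 0) = (0, 0, δ) := by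
    intro g hg
    obtain ⟨s, hs⟩ := exists_symSq_mul_apply_eq (hr g) hg
    obtain ⟨i, hi⟩ := hu s
    exact ⟨i, _, hg, by rw [map_mul, hi]; exact hs⟩
  have hlow : ∀ c : ZMod p, ∃ g, r g = symSq 1 0 c 1 := by
    obtain ⟨g, hg⟩ := hmove
    obtain ⟨i, δ, hδ, hi⟩ := hWeyl g ((hmv g).resolve_left (fun ⟨a, ha⟩ => hg a ha))
    set g₁ := x ^ i * g
    have hW : ∀ w, symDet (symSq (0 : ZMod p) 1 (-1) 0 w) = symDet w :=
      symDet_symSq (by ring)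
    obtain ⟨s, ε, -, hε, hs⟩ := exists_symSq_mul_eq_diagThree
      (T := symSq 0 1 (-1) 0 * r g₁) (a := δ)
      (fun w => by rw [Module.End.mul_apply, hW, hr]) (by
        rw [Module.End.mul_apply, hi, symSq_apply]; simp)
    have hδε : δ * ε ≠ 0 := mul_ne_zero hδ (by rintro rfl; simp at hε)
    have hg₁ : r g₁ = symSq 0 (-1) 1 0 * symSq 1 (-s) 0 1 * diagThree δ ε δ⁻¹ := by
      rw [← hs, ← mul_assoc, ← mul_assoc]
      simp only [symSq_mul]
      conv_lhs => rw [← one_mul (r g₁), ← symSq_one]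
      congr 2 <;> ring
    intro c
    obtain ⟨j, hj⟩ := hu (-(δ * ε)⁻¹ * c)
    refine ⟨g₁ * x ^ j * g₁⁻¹, ?_⟩
    have h1 : r g₁ * r (x ^ j) = symSq 1 0 c 1 * r g₁ := by
      have h2 : symSq 0 (-1) 1 0 * symSq 1 (-s) 0 1 *
          symSq 1 (δ * ε * (-(δ * ε)⁻¹ * c)) 0 1 =
          symSq 1 0 c 1 * (symSq 0 (-1) 1 0 * symSq 1 (-s) 0 1) := by
        have : δ * ε * (-(δ * ε)⁻¹ * c) = -c := by
          rw [neg_mul, mul_neg, mul_inv_cancel_left₀ hδε]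
        rw [this]
        simp only [symSq_mul]
        congr 1 <;> ring
      rw [hj, hg₁, mul_assoc, diagThree_mul_symSq hδ hε, ← mul_assoc, h2, mul_assoc]
    rw [map_mul, map_mul, h1, mul_assoc, ← map_mul, mul_inv_cancel, map_one, mul_one]
  have hSL : ∀ a b c d, a * d - b * c = 1 → ∃ g, r g = symSq a b c d := by
    have key : ∀ a b c d, c ≠ 0 → a * d - b * c = 1 → ∃ g, r g = symSq a b c d := by
      intro a b c d hc h
      obtain ⟨i, hi⟩ := hu ((a - 1) / c)
      obtain ⟨j, hj⟩ := hu ((d - 1) / c)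
      obtain ⟨g, hg⟩ := hlow c
      exact ⟨x ^ i * g * x ^ j, by rw [map_mul, map_mul, hi, hj, hg, symSq_eq_of_ne_zero h hc]⟩
    intro a b c d h
    by_cases hc : c = 0
    · subst hc
      obtain ⟨g, hg⟩ := hlow (-1)
      obtain ⟨g', hg'⟩ := key a b a (b + d) (by rintro rfl; simp at h) (by linear_combination h)
      exact ⟨g * g', by rw [map_mul, hg, hg', symSq_eq_of_eq_zero]⟩
    · exact key a b c d hc h
  refine ⟨hSL, ?_⟩
  have hfix : ∀ g a, r g (1, 0, 0) = (a, 0, 0) →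
      ∃ a b c d, a * d - b * c = 1 ∧ r g = symSq a b c d := by
    intro g a h
    obtain ⟨s, ε, ha, hε, hs⟩ := exists_symSq_mul_eq_diagThree (hr g) h
    obtain ⟨i, hi⟩ := hu s
    have hg' : r (x ^ i * g) = diagThree a ε a⁻¹ := by rw [map_mul, hi, hs]
    obtain ⟨⟨μ, hμ⟩, -⟩ := hN (x ^ i * g) (a * ε) (by rw [hg', hx, ← mul_one (a * ε), diagThree_mul_symSq ha hε])
    have hε0 : ε ≠ 0 := by rintro rfl; simp at hε
    have hμ0 : μ ≠ 0 := by rintro rfl; simp [ha, hε0] at hμ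
    obtain ⟨g₂, hg₂⟩ := hSL μ⁻¹ 0 0 μ (by field_simp; ring)
    have hg₃ : r (g₂ * (x ^ i * g)) = diagThree ε ε ε⁻¹ := by
      rw [map_mul, hg₂, hg']
      have haε : a = ε * μ * μ := by linear_combination ε * hμ - a * hε
      refine LinearMap.ext fun w => ?_
      simp only [Module.End.mul_apply, diagThree_apply, symSq_apply]
      ext
      · simp only [haε]; field_simp; ring
      · simp; field_simp
      · simp [haε]; field_simp
    obtain ⟨-, h3⟩ := hN (g₂ * (x ^ i * g)) 1 (by
      rw [hg₃, hx, diagThree_mul_symSq hε0 hε, ← pow_two, hε, one_mul])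
    obtain ⟨j, hj⟩ := h3 rfl
    have hε1 : ε = 1 := by
      have := congrArg (fun T => (T ((1 : ZMod p), (0 : ZMod p), (0 : ZMod p))).1) hj
      rw [hg₃, hxi] at this
      simpa [diagThree_apply, symSq_apply] using this
    have hg1 : r g₂ * symSq 1 s 0 1 * r g = 1 := by
      rw [mul_assoc, ← hi, ← map_mul, ← map_mul, hg₃, hε1]
      refine LinearMap.ext fun w => ?_
      simp [diagThree_apply]
    refine ⟨μ, -s * μ⁻¹, 0, μ⁻¹, by field_simp; ring, ?_⟩
    have hinv : symSq μ (-s * μ⁻¹) 0 μ⁻¹ * (r g₂ * symSq 1 s 0 1) = 1 := by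
      rw [hg₂, symSq_mul, symSq_mul, ← symSq_one]
      congr 1 <;> field_simp <;> ring
    rw [← one_mul (r g), ← hinv, mul_assoc, hg1, mul_one]
  intro g
  rcases hmv g with ⟨a, ha⟩ | h
  · exact hfix g a ha
  · obtain ⟨i, δ, hδ, hi⟩ := hWeyl g h
    obtain ⟨g', hg'⟩ := hSL 0 1 (-1) 0 (by ring)
    obtain ⟨a, b, c, d, hdet, h3⟩ := hfix (g' * (x ^ i * g)) δ (by
      rw [map_mul, hg', Module.End.mul_apply, hi, symSq_apply]
      simp)
    rw [map_mul, hg', map_mul, hxi] at h3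
    have hinv : symSq 1 (-(i : ZMod p)) 0 1 * symSq 0 (-1) 1 0 *
        (symSq 0 1 (-1) 0 * symSq 1 (i : ZMod p) 0 1) = 1 := by
      simp only [symSq_mul]
      rw [← symSq_one]
      congr 1 <;> ring
    have h4 : r g = symSq 1 (-(i : ZMod p)) 0 1 * symSq 0 (-1) 1 0 * symSq a b c d := by
      rw [← h3, ← mul_assoc (symSq 0 1 (-1) 0), ← mul_assoc, hinv, one_mul]
    rw [h4, symSq_mul, symSq_mul]
    exact ⟨_, _, _, _, by linear_combination hdet, rfl⟩

/-- The symmetric square representation of `SL₂`. -/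
def symSqHom (k : Type*) [Field k] : SL(2, k) →* Module.End k (k × k × k) where
  toFun M := symSq (M 0 0) (M 0 1) (M 1 0) (M 1 1)
  map_one' := by simp [symSq_one]
  map_mul' M N := by
    rw [symSq_mul]
    simp [Matrix.mul_apply, Fin.sum_univ_two]

theorem symSqHom_apply {k : Type*} [Field k] (M : SL(2, k)) :
    symSqHom k M = symSq (M 0 0) (M 0 1) (M 1 0) (M 1 1) := rfl

theorem exists_symSqHom_eq {k : Type*} [Field k] {a b c d : k} (h : a * d - b * c = 1) :
    ∃ M, symSqHom k M = symSq a b c d :=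
  ⟨⟨!![a, b; c, d], by rw [Matrix.det_fin_two_of, h]⟩, rfl⟩

theorem ker_symSqHom_toHomUnits {k : Type*} [Field k] :
    (symSqHom k).toHomUnits.ker = Subgroup.center SL(2, k) := by
  ext M
  rw [MonoidHom.mem_ker, Matrix.SpecialLinearGroup.mem_center_iff, ← Units.val_inj]
  change symSqHom k M = 1 ↔ _
  have hdet : M 0 0 * M 1 1 - M 0 1 * M 1 0 = 1 := by
    rw [← Matrix.det_fin_two]; exact M.2
  constructor
  · intro h
    have h1 := congrArg (fun T => T ((1 : k), (0 : k), (0 : k))) h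
    have h3 := congrArg (fun T => T ((0 : k), (0 : k), (1 : k))) h
    simp only [symSqHom_apply, symSq_apply, Module.End.one_apply, mul_one, mul_zero, add_zero,
      zero_add, Prod.mk.injEq] at h1 h3
    have h10 : M 1 0 = 0 := pow_eq_zero_iff (two_ne_zero) |>.1 h1.2.2
    have h01 : M 0 1 = 0 := pow_eq_zero_iff (two_ne_zero) |>.1 h3.1
    refine ⟨M 0 0, by simpa using h1.1, ?_⟩
    have h11 : M 1 1 = M 0 0 := by
      rw [h10, mul_zero, sub_zero] at hdet
      linear_combination M 0 0 * hdet - M 1 1 * h1.1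
    ext i j
    fin_cases i <;> fin_cases j <;> simp [h10, h01, h11]
  · rintro ⟨r, hr, hM⟩
    have hr' : r ^ 2 = 1 := by simpa using hr
    refine LinearMap.ext fun w => ?_
    rw [symSqHom_apply, ← hM, symSq_apply]
    simp [hr', ← pow_two]

/-- Recognition of `C₂ × PSL₂(p)` from its action on the symmetric square. -/
theorem nonempty_mulEquiv_prod_projectiveSpecialLinearGroup {p : ℕ} [Fact p.Prime]
    {G : Type*} [Group G]
    (r : G →* Module.End (ZMod p) (ZMod p × ZMod p × ZMod p))
    (hr : ∀ a b c d, a * d - b * c = 1 → ∃ g, r g = symSq a b c d)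
    (hr' : ∀ g, ∃ a b c d, a * d - b * c = 1 ∧ r g = symSq a b c d)
    (z : G) (hz : r z = 1) (hker : ∀ g, r g = 1 → g = 1 ∨ g = z)
    (χ : G →* ℤˣ) (hχ : χ z = -1) :
    Nonempty (G ≃* (Multiplicative (ZMod 2) ×
        Matrix.ProjectiveSpecialLinearGroup (Fin 2) (ZMod p))) := by
  have hrange : r.toHomUnits.range = (symSqHom (ZMod p)).toHomUnits.range := by
    ext T
    simp only [MonoidHom.mem_range, ← Units.val_inj]
    constructor
    · rintro ⟨g, hg⟩
      obtain ⟨a, b, c, d, h, hg'⟩ := hr' g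
      obtain ⟨M, hM⟩ := exists_symSqHom_eq h
      exact ⟨M, hM.trans (hg'.symm.trans hg)⟩
    · rintro ⟨M, hM⟩
      obtain ⟨g, hg⟩ := hr (M 0 0) (M 0 1) (M 1 0) (M 1 1) (by
        rw [← Matrix.det_fin_two]; exact M.2)
      exact ⟨g, hg.trans hM⟩
  let e : (symSqHom (ZMod p)).toHomUnits.range ≃*
      Matrix.ProjectiveSpecialLinearGroup (Fin 2) (ZMod p) :=
    (QuotientGroup.quotientKerEquivRange (symSqHom (ZMod p)).toHomUnits).symm.trans
      (QuotientGroup.quotientMulEquivOfEq ker_symSqHom_toHomUnits)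
  let ψ : G →* Matrix.ProjectiveSpecialLinearGroup (Fin 2) (ZMod p) :=
    ((MulEquiv.subgroupCongr hrange).trans e).toMonoidHom.comp r.toHomUnits.rangeRestrict
  have hψs : Function.Surjective ψ :=
    ((MulEquiv.subgroupCongr hrange).trans e).surjective.comp
      r.toHomUnits.rangeRestrict_surjective
  have hψ : ∀ g, ψ g = 1 ↔ r g = 1 := by
    intro g
    change ((MulEquiv.subgroupCongr hrange).trans e) (r.toHomUnits.rangeRestrict g) = 1 ↔ _
    rw [map_eq_one_iff _ (MulEquiv.injective _), ← Subtype.coe_inj, ← Units.val_inj]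
    rfl
  have hC2 : Nat.card ℤˣ = 2 := by simp
  have : Fact (Nat.Prime 2) := ⟨Nat.prime_two⟩
  let u : ℤˣ ≃* Multiplicative (ZMod 2) := mulEquivOfPrimeCardEq (p := 2) hC2 (by simp)
  have hbij : Function.Bijective (χ.prod ψ) := by
    constructor
    · rw [injective_iff_map_eq_one]
      intro g hg
      rw [MonoidHom.prod_apply, Prod.mk_eq_one, hψ] at hg
      rcases hker g hg.2 with h | rfl
      · exact h
      · rw [hχ] at hg
        exact absurd hg.1 (by decide)
    · rintro ⟨ε, Q⟩
      obtain ⟨g, rfl⟩ := hψs Q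
      by_cases h : χ g = ε
      · exact ⟨g, by rw [MonoidHom.prod_apply, h]⟩
      · refine ⟨g * z, ?_⟩
        rw [MonoidHom.prod_apply, map_mul, map_mul, hχ, (hψ z).2 hz, mul_one, Prod.mk.injEq]
        refine ⟨?_, rfl⟩
        rcases Int.units_eq_one_or (χ g) with h1 | h1 <;>
          rcases Int.units_eq_one_or ε with h2 | h2 <;> simp_all
  exact ⟨(MulEquiv.ofBijective _ hbij).trans (u.prodCongr (MulEquiv.refl _))⟩

/-- A finite linear group over `𝔽_p` in odd dimension `d < p / 2` with a self-centralising
(up to sign) non-normal Sylow subgroup `⟨x⟩`, where `x` is a regular unipotent element, whose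
normaliser acts on it by automorphisms of odd order, is `C₂ × PSL₂(p)`, and `p ≡ 3 mod 4`. -/
theorem mulEquiv_prod_projectiveSpecialLinearGroup_of_regular_unipotent {p d : ℕ}
    [hp : Fact p.Prime] {V G : Type*} [AddCommGroup V] [Module (ZMod p) V] [Group G] [Finite G]
    {t : Module.End (ZMod p) V} {v : V} (h : IsRegularNilpotent t v d) (hp5 : 5 ≤ p)
    (hd2 : 2 ≤ d) (hd : Odd d) (hdp : 2 * d < p) {x : G} (hx : orderOf x = p)
    (hidx : ¬ p ∣ (Subgroup.zpowers x).index) {τ : G →* Module.End (ZMod p) V}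
    (hτ : Function.Injective τ) (ht : τ x = 1 + t) {z : G} (hz : τ z = -1)
    (hcent : ∀ g, Commute g x → ∃ i : ℕ, g = x ^ i ∨ g = z * x ^ i)
    (hnorm : ∀ g, ∀ i : ℕ, g * x * g⁻¹ = x ^ i → ∃ m, Odd m ∧ (i : ZMod p) ^ m = 1)
    (hnn : ∃ g, ∀ i : ℕ, g * x * g⁻¹ ≠ x ^ i) :
    p % 4 = 3 ∧ Nonempty (G ≃* (Multiplicative (ZMod 2) ×
        Matrix.ProjectiveSpecialLinearGroup (Fin 2) (ZMod p))) := by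
  have hpodd : Odd p := hp.out.odd_of_ne_two (by omega)
  have : Fact (2 < p) := ⟨by omega⟩
  have hneg : (-1 : ZMod p) ≠ 1 := ZMod.neg_one_ne_one
  obtain ⟨r, hr, hrx, hrz, hrc⟩ := h.exists_ternary_representation hp5 hd2 hdp hx hidx ht
  have hrzz := hrz z hz
  have hz2 : z ^ 2 = 1 := hτ (by rw [map_pow, hz, map_one]; simp)
  have hz1 : z ≠ 1 := by
    rintro rfl
    rw [map_one] at hz
    have hv : v = -v := congrArg (fun T : Module.End (ZMod p) V => T v) hz
    have h2v : (2 : ZMod p) • v = 0 := by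
      rw [two_smul]
      nth_rewrite 2 [hv]
      rw [add_neg_cancel]
    have h2 : (2 : ZMod p) ≠ 0 := by
      intro h2
      exact hneg (by linear_combination -h2)
    rw [smul_eq_zero_iff_right h2] at h2v
    exact h.pow_apply_ne_zero (by rw [h2v, map_zero])
  have hxi : ∀ i : ℕ, r (x ^ i) = symSq 1 (i : ZMod p) 0 1 := by
    intro i
    induction i with
    | zero => rw [pow_zero, map_one, Nat.cast_zero, symSq_one]
    | succ i ih =>
      rw [pow_succ, map_mul, ih, hrx, symSq_mul]
      congr 1 <;> simp; ring
  have hxi1 : ∀ i : ℕ, r (x ^ i) = 1 → x ^ i = 1 := by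
    intro i hi
    rw [hxi] at hi
    have := congrArg (fun T => (T ((0 : ZMod p), (0 : ZMod p), (1 : ZMod p))).2.1) hi
    simp only [symSq_apply, Module.End.one_apply, mul_zero, mul_one, add_zero,
      zero_add] at this
    rw [← orderOf_dvd_iff_pow_eq_one, hx]
    exact (CharP.cast_eq_zero_iff (ZMod p) p i).1 this
  have hker : ∀ g, r g = 1 → g = 1 ∨ g = z := by
    intro g hg
    have hc : Commute g x := by
      apply hτ
      rw [map_mul, map_mul]
      exact hrc g hg
    obtain ⟨i, rfl | rfl⟩ := hcent g hc
    · exact Or.inl (hxi1 i hg)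
    · rw [map_mul, hrzz, one_mul] at hg
      exact Or.inr (by rw [hxi1 i hg, mul_one])
  have hconj : ∀ g (c : ZMod p), r g * r x = symSq 1 c 0 1 * r g → g * x * g⁻¹ = x ^ c.val := by
    intro g c hg
    have hzx : ∀ w, z * w = w * z := by
      intro w
      apply hτ
      rw [map_mul, map_mul, hz]; simp
    have h1 : r (g * x * g⁻¹ * (x ^ c.val)⁻¹) = 1 := by
      rw [map_mul, map_mul, map_mul, hg, mul_assoc (symSq 1 c 0 1), ← map_mul, mul_inv_cancel,
        map_one, mul_one]
      have : symSq 1 c 0 1 = r (x ^ c.val) := by rw [hxi, ZMod.natCast_zmod_val]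
      rw [this, ← map_mul, mul_inv_cancel, map_one]
    rcases hker _ h1 with h2 | h2
    · exact mul_inv_eq_one.1 h2
    · exfalso
      have h3 : g * x * g⁻¹ = z * x ^ c.val := mul_inv_eq_iff_eq_mul.1 h2
      have h4 : (g * x * g⁻¹) ^ p = 1 := by rw [conj_pow, ← hx, pow_orderOf_eq_one]; group
      rw [h3, Commute.mul_pow (hzx _), ← pow_mul, mul_comm c.val, pow_mul x p]
      at h4
      rw [show x ^ p = 1 by rw [← hx, pow_orderOf_eq_one], one_pow, mul_one] at h4
      obtain ⟨m, hm⟩ := hpodd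
      rw [hm, pow_succ, pow_mul, hz2, one_pow, one_mul] at h4
      exact hz1 h4
  have hsq : ∀ g c, r g * r x = symSq 1 c 0 1 * r g → ∃ m, Odd m ∧ c ^ m = 1 := by
    intro g c hg
    obtain ⟨m, hm, h1⟩ := hnorm g _ (hconj g c hg)
    exact ⟨m, hm, by rwa [ZMod.natCast_zmod_val] at h1⟩
  obtain ⟨hsurj, himg⟩ := range_eq_symSq_of_ternary_representation r hr hrx (by
    intro g c hg
    obtain ⟨m, ⟨q, rfl⟩, h1⟩ := hsq g c hg
    refine ⟨⟨c ^ (q + 1), ?_⟩, ?_⟩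
    · rw [← pow_add, show q + 1 + (q + 1) = (2 * q + 1) + 1 by ring, pow_succ, h1, one_mul]
    · rintro rfl
      have h2 := hconj g 1 hg
      rw [ZMod.val_one, pow_one, mul_inv_eq_iff_eq_mul] at h2
      obtain ⟨i, rfl | rfl⟩ := hcent g h2
      · exact ⟨i, rfl⟩
      · exact ⟨i, by rw [map_mul, hrzz, one_mul]⟩) (by
    obtain ⟨g, hg⟩ := hnn
    refine ⟨g, fun a ha => ?_⟩
    obtain ⟨s, ε, ha0, hε, hs⟩ := exists_symSq_mul_eq_diagThree (hr g) ha
    have h1 : r (x ^ s.val * g) = diagThree a ε a⁻¹ := by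
      rw [map_mul, hxi, ZMod.natCast_zmod_val, hs]
    have h2 := hconj (x ^ s.val * g) (a * ε * 1) (by
      rw [h1, hrx, diagThree_mul_symSq ha0 hε])
    apply hg (a * ε * 1).val
    have h3 : g * x * g⁻¹ = (x ^ s.val)⁻¹ * (x ^ s.val * g * x * (x ^ s.val * g)⁻¹) * x ^ s.val := by
      group
    rw [h3, h2, mul_assoc, ((Commute.refl x).pow_pow _ s.val).eq, inv_mul_cancel_left])
  have hp4 : ¬ IsSquare (-1 : ZMod p) := by
    rintro ⟨μ, hμ⟩
    have hμ0 : μ ≠ 0 := by rintro rfl; simp at hμ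
    obtain ⟨g, hg⟩ := hsurj μ 0 0 (-μ) (by linear_combination hμ)
    obtain ⟨m, hm, h1⟩ := hsq g (-1) (by
      rw [hg, hrx, symSq_mul, symSq_mul]
      congr 1 <;> ring_nf)
    rw [hm.neg_one_pow] at h1
    exact hneg h1
  have hp3 : p % 4 = 3 := by
    by_contra h3
    exact hp4 (ZMod.exists_sq_eq_neg_one_iff.2 h3)
  refine ⟨hp3, ?_⟩
  let χ : G →* ℤˣ := ((quadraticChar (ZMod p)).toMonoidHom.comp
    ((LinearMap.det : Module.End (ZMod p) V →* ZMod p).comp τ)).toHomUnits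
  refine nonempty_mulEquiv_prod_projectiveSpecialLinearGroup r hsurj himg z hrzz hker χ ?_
  rw [← Units.val_inj]
  change quadraticChar (ZMod p) (LinearMap.det (τ z)) = -1
  have h1 : (-1 : Module.End (ZMod p) V) = (-1 : ZMod p) • 1 := by simp
  rw [hz, h1, LinearMap.det_smul, h.finrank_eq, hd.neg_one_pow, map_one, mul_one]
  exact quadraticChar_neg_one_iff_not_isSquare.2 hp4

section CyclotomicChar

variable (p : ℕ) [hp : Fact p.Prime] (L : Type*) [Field L] [CharZero L]
  [IsCyclotomicExtension {p} ℚ L]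

/-- The additive character `i ↦ ζ ^ i` of `ℤ/p` with values in the `p`-th cyclotomic field. -/
noncomputable def cyclotomicChar : AddChar (ZMod p) L :=
  AddChar.zmodChar p (IsCyclotomicExtension.zeta_spec p ℚ L).pow_eq_one

/-- The isomorphism of `(ℤ/p)ˣ` with the Galois group of the `p`-th cyclotomic field. -/
noncomputable def cyclotomicAut : (ZMod p)ˣ ≃* (L ≃ₐ[ℚ] L) :=
  (IsCyclotomicExtension.autEquivPow L
    (Polynomial.cyclotomic.irreducible_rat hp.out.pos)).symm

variable {L}

theorem cyclotomicChar_natCast (n : ℕ) :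
    cyclotomicChar p L n = (cyclotomicChar p L 1) ^ n := by
  rw [← AddChar.map_nsmul_eq_pow, nsmul_one]

theorem isPrimitiveRoot_cyclotomicChar_one : IsPrimitiveRoot (cyclotomicChar p L 1) p := by
  have h : cyclotomicChar p L 1 = IsCyclotomicExtension.zeta p ℚ L := by
    have : Fact (1 < p) := ⟨hp.out.one_lt⟩
    rw [cyclotomicChar, AddChar.zmodChar_apply, ZMod.val_one, pow_one]
  rw [h]
  exact IsCyclotomicExtension.zeta_spec p ℚ L

theorem cyclotomicAut_char (k : (ZMod p)ˣ) (i : ZMod p) :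
    cyclotomicAut p L k (cyclotomicChar p L i) = cyclotomicChar p L (k * i) := by
  have h : cyclotomicAut p L k (IsCyclotomicExtension.zeta p ℚ L) =
      IsCyclotomicExtension.zeta p ℚ L ^ (k : ZMod p).val := by
    have := (IsCyclotomicExtension.zeta_spec p ℚ L).autToPow_spec ℚ (cyclotomicAut p L k)
    rw [← this]
    congr 3
    have h2 := MulEquiv.apply_symm_apply (IsCyclotomicExtension.autEquivPow L
      (Polynomial.cyclotomic.irreducible_rat hp.out.pos)) k
    exact h2
  have h1 : cyclotomicChar p L 1 = IsCyclotomicExtension.zeta p ℚ L := by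
    have : Fact (1 < p) := ⟨hp.out.one_lt⟩
    rw [cyclotomicChar, AddChar.zmodChar_apply, ZMod.val_one, pow_one]
  have hi : i = ((i.val : ℕ) : ZMod p) := (ZMod.natCast_zmod_val i).symm
  have hk : (k : ZMod p) = (((k : ZMod p).val : ℕ) : ZMod p) := (ZMod.natCast_zmod_val _).symm
  rw [hi, hk, ← Nat.cast_mul, cyclotomicChar_natCast, cyclotomicChar_natCast, map_pow, h1, h,
    ← pow_mul]

theorem cyclotomicChar_injective : Function.Injective (cyclotomicChar p L) := by
  intro i j hij
  rw [← ZMod.natCast_zmod_val i, ← ZMod.natCast_zmod_val j, cyclotomicChar_natCast,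
    cyclotomicChar_natCast] at hij
  exact ZMod.val_injective p ((isPrimitiveRoot_cyclotomicChar_one p).pow_inj (ZMod.val_lt i)
    (ZMod.val_lt j) hij)

theorem cyclotomicChar_ne_zero (i : ZMod p) : cyclotomicChar p L i ≠ 0 :=
  ((cyclotomicChar p L).val_isUnit i).ne_zero

theorem span_range_cyclotomicChar :
    Submodule.span ℚ (Set.range (cyclotomicChar p L)) = ⊤ := by
  have h := IsCyclotomicExtension.adjoin_primitive_root_eq_top (A := ℚ)
    (isPrimitiveRoot_cyclotomicChar_one p (L := L))
  rw [← Algebra.top_toSubmodule, ← h, Algebra.adjoin_eq_span]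
  congr 1
  ext x
  rw [SetLike.mem_coe, Submonoid.mem_closure_singleton, Set.mem_range]
  constructor
  · rintro ⟨i, rfl⟩
    exact ⟨i.val, by rw [← cyclotomicChar_natCast, ZMod.natCast_zmod_val]⟩
  · rintro ⟨n, rfl⟩
    exact ⟨n, cyclotomicChar_natCast p n⟩

/-- A `ℚ`-linear operator on the `p`-th cyclotomic field that is semilinear with respect to
multiplication by a root of unity is a Galois automorphism up to a scalar. -/
theorem eq_mul_cyclotomicAut (f : L →ₗ[ℚ] L) (k : (ZMod p)ˣ)
    (hf : ∀ a, f (cyclotomicChar p L 1 * a) = cyclotomicChar p L k * f a) (a : L) :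
    f a = f 1 * cyclotomicAut p L k a := by
  have h : ∀ n : ℕ, f (cyclotomicChar p L n) = f 1 * cyclotomicAut p L k (cyclotomicChar p L n) := by
    intro n
    induction n with
    | zero => simp
    | succ n ih =>
      rw [Nat.cast_succ, add_comm, AddChar.map_add_eq_mul, hf, ih, map_mul, cyclotomicAut_char _ _ 1,
        mul_one]
      ring
  have h2 : f = (LinearMap.mulLeft ℚ (f 1)) ∘ₗ (cyclotomicAut p L k).toLinearMap := by
    refine LinearMap.ext_on (span_range_cyclotomicChar p) ?_
    rintro _ ⟨i, rfl⟩
    have := h i.val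
    rw [ZMod.natCast_zmod_val] at this
    simpa using this
  simpa using LinearMap.congr_fun h2 a

theorem eq_mul_of_commute_cyclotomicChar (f : L →ₗ[ℚ] L)
    (hf : ∀ a, f (cyclotomicChar p L 1 * a) = cyclotomicChar p L 1 * f a) (a : L) :
    f a = f 1 * a := by
  have := eq_mul_cyclotomicAut p f 1 (by simpa using hf) a
  simpa using this

theorem exists_eq_cyclotomicChar_of_isOfFinOrder (hodd : Odd p) {c : L} (hc : IsOfFinOrder c) :
    ∃ i, c = cyclotomicChar p L i ∨ c = -cyclotomicChar p L i := by
  have : NumberField L := IsCyclotomicExtension.numberField {p} ℚ L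
  obtain ⟨r, -, hr⟩ := (isPrimitiveRoot_cyclotomicChar_one p (L := L)
    ).exists_pow_or_neg_mul_pow_of_isOfFinOrder hodd hc
  exact ⟨r, by simpa only [cyclotomicChar_natCast] using hr⟩

end CyclotomicChar

/-- A group of automorphisms of a rational vector space is symplectic if it preserves some
nondegenerate skew-symmetric bilinear form. -/
def IsSymplecticLinearGroup {V : Type*} [AddCommGroup V] [Module ℚ V]
    (Δ : Subgroup (V ≃ₗ[ℚ] V)) : Prop :=
  ∃ B : V →ₗ[ℚ] V →ₗ[ℚ] ℚ, (∀ a b, B a b = -B b a) ∧ (∀ a, (∀ b, B a b = 0) → a = 0) ∧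
    ∀ g ∈ Δ, ∀ a b, B (g a) (g b) = B a b

/-- A finite group of automorphisms of a finite-dimensional rational vector space preserves a
positive definite symmetric bilinear form. -/
theorem exists_posDef_invariant_form {V : Type*} [AddCommGroup V] [Module ℚ V]
    [Module.Finite ℚ V] (Δ : Subgroup (V ≃ₗ[ℚ] V)) [Finite Δ] :
    ∃ S : V →ₗ[ℚ] V →ₗ[ℚ] ℚ, (∀ a b, S a b = S b a) ∧ (∀ a, a ≠ 0 → 0 < S a a) ∧
      ∀ g ∈ Δ, ∀ a b, S (g a) (g b) = S a b := by
  have : Fintype Δ := Fintype.ofFinite Δ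
  let b := Module.finBasis ℚ V
  let S₀ : V →ₗ[ℚ] V →ₗ[ℚ] ℚ := ∑ i, (LinearMap.mul ℚ ℚ).compl₁₂ (b.coord i) (b.coord i)
  have hS₀ : ∀ x y, S₀ x y = ∑ i, b.repr x i * b.repr y i := fun x y => by
    simp [S₀, LinearMap.sum_apply]
  have hpos : ∀ x, 0 ≤ S₀ x x := fun x => by
    rw [hS₀]
    exact Finset.sum_nonneg fun i _ => mul_self_nonneg _
  have hpos' : ∀ x, x ≠ 0 → 0 < S₀ x x := fun x hx => by
    refine lt_of_le_of_ne (hpos x) fun h0 => hx ?_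
    rw [hS₀, eq_comm, Finset.sum_eq_zero_iff_of_nonneg fun i _ => mul_self_nonneg _] at h0
    apply b.repr.injective
    ext i
    simpa using h0 i (Finset.mem_univ i)
  let S : V →ₗ[ℚ] V →ₗ[ℚ] ℚ := ∑ g : Δ, S₀.compl₁₂ (g.1 : V →ₗ[ℚ] V) (g.1 : V →ₗ[ℚ] V)
  have hS : ∀ x y, S x y = ∑ g : Δ, S₀ (g.1 x) (g.1 y) := fun x y => by
    simp [S, LinearMap.sum_apply]
  refine ⟨S, fun x y => ?_, fun x hx => ?_, fun g hg x y => ?_⟩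
  · simp only [hS, hS₀, mul_comm]
  · rw [hS]
    exact Finset.sum_pos (fun g _ => hpos' _ fun h0 => hx (g.1.map_eq_zero_iff.1 h0))
      ⟨1, Finset.mem_univ 1⟩
  · rw [hS, hS]
    exact Fintype.sum_equiv (Equiv.mulRight (⟨g, hg⟩ : Δ)) _ _ fun h => rfl

section CyclotomicOperators

variable (p : ℕ) [hp : Fact p.Prime] (L : Type*) [Field L] [CharZero L]
  [IsCyclotomicExtension {p} ℚ L]

/-- Multiplication by a `p`-th root of unity. -/
noncomputable def cyclotomicRotation (i : ZMod p) : L ≃ₗ[ℚ] L :=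
  DistribMulAction.toModuleAut ℚ L
    (Units.mk0 (cyclotomicChar p L i) (cyclotomicChar_ne_zero p i))

variable {L}

@[simp]
theorem cyclotomicRotation_apply (i : ZMod p) (a : L) :
    cyclotomicRotation p L i a = cyclotomicChar p L i * a := rfl

theorem cyclotomicRotation_one_pow (n : ℕ) :
    cyclotomicRotation p L 1 ^ n = cyclotomicRotation p L n := by
  induction n with
  | zero => ext a; simp
  | succ n ih =>
    ext a
    rw [pow_succ', ih]
    simp [add_comm (n : ZMod p), AddChar.map_add_eq_mul, mul_assoc]

theorem cyclotomicRotation_mem {Δ : Subgroup (L ≃ₗ[ℚ] L)} (hΔ : cyclotomicRotation p L 1 ∈ Δ)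
    (i : ZMod p) : cyclotomicRotation p L i ∈ Δ := by
  rw [← ZMod.natCast_zmod_val i, ← cyclotomicRotation_one_pow]
  exact pow_mem hΔ _

/-- Complex conjugation is the adjunction for a rotation-invariant bilinear form. -/
theorem form_mul_left_eq {Δ : Subgroup (L ≃ₗ[ℚ] L)} (hΔ : cyclotomicRotation p L 1 ∈ Δ)
    {S : L →ₗ[ℚ] L →ₗ[ℚ] ℚ} (hS : ∀ g ∈ Δ, ∀ a b, S (g a) (g b) = S a b) (c a b : L) :
    S (c * a) b = S a (cyclotomicAut p L (-1) c * b) := by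
  have hc : c ∈ Submodule.span ℚ (Set.range (cyclotomicChar p L)) := by
    rw [span_range_cyclotomicChar]; trivial
  induction hc using Submodule.span_induction with
  | mem x hx =>
    obtain ⟨i, rfl⟩ := hx
    have h := hS _ (cyclotomicRotation_mem p hΔ i) a (cyclotomicChar p L (-i) * b)
    rw [cyclotomicRotation_apply, cyclotomicRotation_apply, ← mul_assoc, ← AddChar.map_add_eq_mul,
      add_neg_cancel, AddChar.map_zero_eq_one, one_mul] at h
    rw [h, cyclotomicAut_char]
    simp
  | zero => simp
  | add x y _ _ hx hy => rw [add_mul, map_add, LinearMap.add_apply, hx, hy, map_add, add_mul,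
      map_add]
  | smul r x _ hx => rw [smul_mul_assoc, map_smul, LinearMap.smul_apply, hx,
      map_rat_smul, smul_mul_assoc, map_smul]

/-- A finite group of operators on the cyclotomic field containing the rotations is symplectic
if and only if it commutes with multiplication by a nonzero totally imaginary scalar. -/
theorem isSymplecticLinearGroup_iff_exists_mul {Δ : Subgroup (L ≃ₗ[ℚ] L)} [Finite Δ]
    (hΔ : cyclotomicRotation p L 1 ∈ Δ) :
    IsSymplecticLinearGroup Δ ↔ ∃ θ : L, θ ≠ 0 ∧ cyclotomicAut p L (-1) θ = -θ ∧
      ∀ g ∈ Δ, ∀ a, g (θ * a) = θ * g a := by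
  have : FiniteDimensional ℚ L := IsCyclotomicExtension.finiteDimensional {p} ℚ L
  obtain ⟨S, hSs, hSp, hSi⟩ := exists_posDef_invariant_form Δ
  have hSn : ∀ x y, (∀ b, S x b = S y b) → x = y := fun x y h => by
    by_contra hne
    have := hSp (x - y) (sub_ne_zero.2 hne)
    rw [map_sub S x y, LinearMap.sub_apply, h, sub_self] at this
    exact this.false
  constructor
  · rintro ⟨B, hBs, hBn, hBi⟩
    have hinj : Function.Injective S := fun x y h => hSn x y fun b => by rw [h]
    let E : L ≃ₗ[ℚ] Module.Dual ℚ L :=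
      LinearMap.linearEquivOfInjective S hinj (Subspace.dual_finrank_eq (K := ℚ) (V := L)).symm
    let A : L →ₗ[ℚ] L := E.symm.toLinearMap ∘ₗ B
    have hA : ∀ a b, S (A a) b = B a b := fun a b => by
      have h : E (A a) = B a := E.apply_symm_apply (B a)
      exact LinearMap.congr_fun h b
    have hAc : ∀ g ∈ Δ, ∀ a, A (g a) = g (A a) := fun g hg a => by
      refine hSn _ _ fun b => ?_
      obtain ⟨b, rfl⟩ := g.surjective b
      rw [hA, hSi g hg, hBi g hg, hA]
    have hAm := eq_mul_of_commute_cyclotomicChar p A fun a => hAc _ hΔ a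
    refine ⟨A 1, fun h0 => one_ne_zero (hBn (1 : L) fun b => ?_), ?_, fun g hg a => ?_⟩
    · rw [← hA, h0, map_zero, LinearMap.zero_apply]
    · refine hSn _ _ fun b => ?_
      have h1 := form_mul_left_eq p hΔ hSi (A 1) b 1
      rw [← hAm, mul_one, hA, hBs, ← hA, hSs b] at h1
      rw [map_neg, LinearMap.neg_apply, ← h1]
    · rw [← hAm, ← hAm, hAc g hg]
  · rintro ⟨θ, hθ0, hθ, hc⟩
    refine ⟨S ∘ₗ LinearMap.mulLeft ℚ θ, fun a b => ?_, fun a h => ?_, fun g hg a b => ?_⟩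
    · simp only [LinearMap.comp_apply, LinearMap.mulLeft_apply]
      rw [form_mul_left_eq p hΔ hSi, hθ, neg_mul, map_neg, hSs]
    · have := hSn (θ * a) 0 fun b => by simpa using h b
      exact (mul_eq_zero.1 this).resolve_left hθ0
    · simp only [LinearMap.comp_apply, LinearMap.mulLeft_apply]
      rw [← hc g hg, hSi g hg]

end CyclotomicOperators

section

variable (p : ℕ) [hp : Fact p.Prime] {L : Type*} [Field L] [CharZero L]
  [IsCyclotomicExtension {p} ℚ L]

theorem orderOf_cyclotomicRotation_one : orderOf (cyclotomicRotation p L 1) = p := by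
  refine orderOf_eq_prime ?_ fun h => ?_
  · rw [cyclotomicRotation_one_pow]
    ext a
    simp
  · have := LinearEquiv.congr_fun h 1
    rw [cyclotomicRotation_apply, mul_one, LinearEquiv.coe_one, id,
      ← AddChar.map_zero_eq_one (cyclotomicChar p L)] at this
    exact one_ne_zero (cyclotomicChar_injective p this)

/-- The centraliser of a rotation consists, up to sign, of rotations, as far as elements of
finite order are concerned. -/
theorem eq_cyclotomicRotation_of_commute (hodd : Odd p) {g : L ≃ₗ[ℚ] L} (hg : IsOfFinOrder g)
    (hc : Commute g (cyclotomicRotation p L 1)) :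
    ∃ i, g = cyclotomicRotation p L i ∨ g = LinearEquiv.neg ℚ * cyclotomicRotation p L i := by
  have h := eq_mul_of_commute_cyclotomicChar p (g : L →ₗ[ℚ] L) fun a =>
    LinearEquiv.congr_fun hc.eq a
  have hpow : ∀ n : ℕ, (g ^ n) 1 = g 1 ^ n := by
    intro n
    induction n with
    | zero => simp
    | succ n ih =>
      rw [pow_succ', LinearEquiv.mul_apply, ih, pow_succ']
      exact h _
  obtain ⟨n, hn, hgn⟩ := isOfFinOrder_iff_pow_eq_one.1 hg
  obtain ⟨i, hi⟩ := exists_eq_cyclotomicChar_of_isOfFinOrder p hodd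
    (isOfFinOrder_iff_pow_eq_one.2 ⟨n, hn, show g 1 ^ n = 1 by rw [← hpow, hgn]; rfl⟩)
  refine ⟨i, hi.imp (fun hi => ?_) fun hi => ?_⟩
  · ext a
    exact (h a).trans (by rw [LinearEquiv.coe_coe, hi]; rfl)
  · ext a
    refine (h a).trans ?_
    rw [LinearEquiv.coe_coe, hi, LinearEquiv.mul_apply, cyclotomicRotation_apply, neg_mul]
    rfl

theorem eq_mul_cyclotomicAut_of_conj {g : L ≃ₗ[ℚ] L} {k : (ZMod p)ˣ}
    (h : g * cyclotomicRotation p L 1 = cyclotomicRotation p L k * g) (a : L) :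
    g a = g 1 * cyclotomicAut p L k a :=
  eq_mul_cyclotomicAut p (g : L →ₗ[ℚ] L) k (fun a => LinearEquiv.congr_fun h a) a

/-- An element normalising the group of rotations and commuting with a scalar acts on the
rotations through the stabiliser of that scalar. -/
theorem cyclotomicAut_eq_of_conj {g : L ≃ₗ[ℚ] L} {k : (ZMod p)ˣ}
    (h : g * cyclotomicRotation p L 1 = cyclotomicRotation p L k * g) {θ : L}
    (hθ : ∀ a, g (θ * a) = θ * g a) : cyclotomicAut p L k θ = θ := by
  have h1 := eq_mul_cyclotomicAut_of_conj p h θ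
  have h2 := hθ 1
  rw [mul_one, h1, mul_comm] at h2
  exact mul_right_cancel₀ (fun h0 => one_ne_zero (g.map_eq_zero_iff.1 h0)) h2

/-- The stabiliser in `(ℤ/p)ˣ` of an element of the cyclotomic field. -/
noncomputable def cyclotomicStabilizer (θ : L) : Subgroup (ZMod p)ˣ where
  carrier := {k | cyclotomicAut p L k θ = θ}
  one_mem' := by simp
  mul_mem' := by
    intro a b ha hb
    rw [Set.mem_ofPred_eq] at ha hb ⊢
    rw [map_mul, AlgEquiv.mul_apply, hb, ha]
  inv_mem' := by
    intro a ha
    rw [Set.mem_ofPred_eq] at ha ⊢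
    rw [map_inv, AlgEquiv.aut_inv, AlgEquiv.symm_apply_eq, ha]

theorem mem_cyclotomicStabilizer {θ : L} {k : (ZMod p)ˣ} :
    k ∈ cyclotomicStabilizer p θ ↔ cyclotomicAut p L k θ = θ := Iff.rfl

/-- The stabiliser of a totally imaginary element has odd order. -/
theorem odd_card_cyclotomicStabilizer {θ : L} (h0 : θ ≠ 0)
    (hθ : cyclotomicAut p L (-1) θ = -θ) : Odd (Nat.card (cyclotomicStabilizer p θ)) := by
  rw [← Nat.not_even_iff_odd, even_iff_two_dvd]
  intro h2
  obtain ⟨k, hk⟩ := exists_prime_orderOf_dvd_card' 2 h2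
  have hk1 : (k : (ZMod p)ˣ) ^ 2 = 1 := by
    have := pow_orderOf_eq_one k
    rw [hk] at this
    simpa using congrArg Subtype.val this
  have hk2 : ((k : (ZMod p)ˣ) : ZMod p) * (k : (ZMod p)ˣ) = 1 := by
    rw [← Units.val_mul, ← sq, hk1, Units.val_one]
  rcases mul_self_eq_one_iff.1 hk2 with h | h
  · have : k = 1 := Subtype.ext (Units.ext h)
    rw [this, orderOf_one] at hk
    exact absurd hk (by norm_num)
  · have hk3 : (k : (ZMod p)ˣ) = -1 := Units.ext (by rw [h, Units.val_neg, Units.val_one])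
    have h4 := (mem_cyclotomicStabilizer p).1 k.2
    rw [hk3, hθ, neg_eq_self] at h4
    exact h0 h4

theorem two_mul_card_cyclotomicStabilizer_lt (hp2 : Odd p) {θ : L} (h0 : θ ≠ 0)
    (hθ : cyclotomicAut p L (-1) θ = -θ) : 2 * Nat.card (cyclotomicStabilizer p θ) < p := by
  obtain ⟨m, hm⟩ := (cyclotomicStabilizer p θ).card_subgroup_dvd_card
  rw [Nat.card_eq_fintype_card (α := (ZMod p)ˣ), ZMod.card_units] at hm
  have hodd := odd_card_cyclotomicStabilizer p h0 hθ
  have hev : Even (p - 1) := Nat.Odd.sub_odd hp2 odd_one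
  rw [hm, Nat.even_mul] at hev
  have hme : Even m := hev.resolve_left (Nat.not_even_iff_odd.2 hodd)
  obtain ⟨r, rfl⟩ := hme
  have hr : r ≠ 0 := by
    rintro rfl
    have := hp.out.two_le
    omega
  have h1 : Nat.card (cyclotomicStabilizer p θ) * 2 ≤
      Nat.card (cyclotomicStabilizer p θ) * (r + r) := Nat.mul_le_mul_left _ (by omega)
  have := hp.out.two_le
  omega

/-- Multiplication by an element fixed by the stabiliser of `θ` commutes with every operator that
commutes with multiplication by `θ`. -/
theorem map_mul_of_stabilizer_fixed {θ c : L}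
    (hc : ∀ k ∈ cyclotomicStabilizer p θ, cyclotomicAut p L k c = c) {g : L →ₗ[ℚ] L}
    (hg : ∀ a, g (θ * a) = θ * g a) (a : L) : g (c * a) = c * g a := by
  have : FiniteDimensional ℚ L := IsCyclotomicExtension.finiteDimensional {p} ℚ L
  have : IsGalois ℚ L := IsCyclotomicExtension.isGalois {p} ℚ L
  have hmem : c ∈ IntermediateField.adjoin ℚ {θ} := by
    rw [← IsGalois.fixedField_fixingSubgroup (IntermediateField.adjoin ℚ {θ})]
    rintro ⟨s, hs⟩
    obtain ⟨k, rfl⟩ := (cyclotomicAut p L).surjective s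
    exact hc k (hs ⟨θ, IntermediateField.mem_adjoin_simple_self ℚ θ⟩)
  rw [← IntermediateField.mem_toSubalgebra,
    IntermediateField.adjoin_simple_toSubalgebra_of_isAlgebraic (Algebra.IsAlgebraic.isAlgebraic θ)]
    at hmem
  clear hc
  induction hmem using Algebra.adjoin_induction generalizing a with
  | mem x hx => rw [Set.mem_singleton_iff.1 hx, hg]
  | algebraMap r => rw [← Algebra.smul_def, ← Algebra.smul_def, map_smul]
  | add x y _ _ hx hy => rw [add_mul, map_add, hx, hy, add_mul]
  | mul x y _ _ hx hy => rw [mul_assoc, hx, hy, mul_assoc]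

/-- The rotations form a Sylow subgroup of any finite group of operators containing them. -/
theorem not_dvd_index_zpowers_cyclotomicRotation (hodd : Odd p) {Δ : Subgroup (L ≃ₗ[ℚ] L)}
    [Finite Δ] {x : Δ} (hx : (x : L ≃ₗ[ℚ] L) = cyclotomicRotation p L 1) :
    ¬ p ∣ (Subgroup.zpowers x).index := by
  intro hdvd
  have hox : orderOf x = p := by
    rw [← Subgroup.orderOf_coe, hx, orderOf_cyclotomicRotation_one]
  have hcard : Nat.card (Subgroup.zpowers x) = p ^ 1 := by rw [Nat.card_zpowers, hox, pow_one]
  have hdvd2 : p ^ (1 + 1) ∣ Nat.card Δ := by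
    rw [← (Subgroup.zpowers x).card_mul_index, hcard, pow_succ]
    exact mul_dvd_mul_left _ hdvd
  obtain ⟨Q, hQ, hle⟩ := Sylow.exists_subgroup_card_pow_succ hdvd2 hcard
  have hab := (IsPGroup.isMulCommutative_of_card_eq_prime_sq hQ).is_comm.comm
  have hmem : ∀ q ∈ Q, q ∈ Subgroup.zpowers x := by
    intro q hq
    have hcomm : Commute (q : L ≃ₗ[ℚ] L) (cyclotomicRotation p L 1) := by
      have := hab ⟨q, hq⟩ ⟨x, hle (Subgroup.mem_zpowers x)⟩
      rw [← hx]
      exact congrArg (fun y : Q => (y.1 : L ≃ₗ[ℚ] L)) this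
    have hfin : IsOfFinOrder (q : L ≃ₗ[ℚ] L) :=
      Submonoid.isOfFinOrder_coe.2 (isOfFinOrder_of_finite q)
    obtain ⟨i, hi | hi⟩ := eq_cyclotomicRotation_of_commute p hodd hfin hcomm
    · refine Subgroup.mem_zpowers_iff.2 ⟨i.val, Subtype.ext ?_⟩
      rw [hi, zpow_natCast, SubmonoidClass.coe_pow, hx, cyclotomicRotation_one_pow,
        ZMod.natCast_zmod_val]
    · exfalso
      have h1 : (⟨q, hq⟩ : Q) ^ (p ^ 2) = 1 := by rw [← hQ]; exact pow_card_eq_one'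
      have h2 : (q : L ≃ₗ[ℚ] L) ^ (p ^ 2) = 1 := congrArg (fun y : Q => (y.1 : L ≃ₗ[ℚ] L)) h1
      have hneg : (LinearEquiv.neg ℚ : L ≃ₗ[ℚ] L) ^ (p ^ 2) = LinearEquiv.neg ℚ := by
        obtain ⟨m, hm⟩ := hodd.pow (n := 2)
        have h3 : (LinearEquiv.neg ℚ : L ≃ₗ[ℚ] L) ^ 2 = 1 := by ext a; simp [sq]
        rw [hm, pow_succ, pow_mul, h3, one_pow, one_mul]
      have hrot : cyclotomicRotation p L i ^ (p ^ 2) = 1 := by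
        have h3 : cyclotomicRotation p L 1 ^ p = 1 :=
          orderOf_dvd_iff_pow_eq_one.1 (orderOf_cyclotomicRotation_one p).dvd
        rw [← ZMod.natCast_zmod_val i, ← cyclotomicRotation_one_pow, ← pow_mul, mul_comm, sq,
          mul_assoc, pow_mul, h3, one_pow]
      have hcom : Commute (LinearEquiv.neg ℚ : L ≃ₗ[ℚ] L) (cyclotomicRotation p L i) := by
        ext a; simp
      rw [hi, hcom.mul_pow, hneg, hrot, mul_one] at h2
      have h3 := LinearEquiv.congr_fun h2 (1 : L)
      rw [LinearEquiv.neg_apply, LinearEquiv.coe_one, id, neg_eq_self] at h3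
      exact one_ne_zero h3
  have := Subgroup.card_le_of_le hmem
  rw [hQ, hcard] at this
  have h2 := Nat.pow_lt_pow_right hp.out.one_lt (show 1 < 1 + 1 by norm_num)
  omega

end

/-- The index of the image of a full lattice in a rational vector space under an injective linear
operator stabilising the lattice is the absolute value of the determinant. -/
theorem card_lattice_quotient_range_restrict {V : Type*} [AddCommGroup V] [Module ℚ V]
    (Λ : Submodule ℤ V) [Module.Finite ℤ Λ]
    (hspan : Submodule.span ℚ (Λ : Set V) = ⊤) {f : V →ₗ[ℚ] V} (hinj : Function.Injective f)
    (hf : ∀ a ∈ Λ, f.restrictScalars ℤ a ∈ Λ) :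
    (Nat.card (Λ ⧸ LinearMap.range ((f.restrictScalars ℤ).restrict hf)) : ℚ) =
      |LinearMap.det f| := by
  have : IsAddTorsionFree V := .of_module_rat V
  have hloc : IsLocalizedModule (nonZeroDivisors ℤ) Λ.subtype := by
    constructor
    · intro s
      have hs : ((s : ℤ) : ℚ) ≠ 0 := Int.cast_ne_zero.2 (nonZeroDivisors.ne_zero s.2)
      rw [Module.End.isUnit_iff]
      constructor
      · intro x y hxy
        exact smul_right_injective V (nonZeroDivisors.ne_zero s.2) hxy
      · intro x
        refine ⟨((s : ℤ) : ℚ)⁻¹ • x, ?_⟩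
        rw [Module.algebraMap_end_apply, ← Int.cast_smul_eq_zsmul ℚ, smul_inv_smul₀ hs]
    · intro y
      have hy : y ∈ Submodule.span ℚ (Λ : Set V) := by rw [hspan]; trivial
      induction hy using Submodule.span_induction with
      | mem x hx => exact ⟨⟨⟨x, hx⟩, 1⟩, one_smul _ _⟩
      | zero => exact ⟨⟨0, 1⟩, by simp⟩
      | add x y _ _ hx hy =>
        obtain ⟨⟨a, s⟩, ha⟩ := hx
        obtain ⟨⟨b, t⟩, hb⟩ := hy
        refine ⟨⟨(t : ℤ) • a + (s : ℤ) • b, s * t⟩, ?_⟩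
        simp only [Submonoid.smul_def] at ha hb
        rw [map_add, map_smul, map_smul, ← ha, ← hb, Submonoid.smul_def, Submonoid.coe_mul,
          smul_add, smul_smul, smul_smul, mul_comm (t : ℤ)]
      | smul q x _ hx =>
        obtain ⟨⟨a, s⟩, ha⟩ := hx
        have hq : (q.den : ℤ) ≠ 0 := Int.natCast_ne_zero.2 q.den_nz
        refine ⟨⟨q.num • a, ⟨q.den, mem_nonZeroDivisors_of_ne_zero hq⟩ * s⟩, ?_⟩
        simp only [Submonoid.smul_def] at ha
        rw [map_smul, ← ha, Submonoid.smul_def, Submonoid.coe_mul]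
        simp only [← Int.cast_smul_eq_zsmul ℚ, smul_smul]
        congr 1
        push_cast
        nth_rewrite 2 [← Rat.num_div_den q]
        have : (q.den : ℚ) ≠ 0 := Nat.cast_ne_zero.2 q.den_nz
        field_simp
    · intro x y hxy
      exact ⟨1, by rw [Subtype.ext hxy]⟩
  let b := Module.Free.chooseBasis ℤ Λ
  let B := b.ofIsLocalizedModule ℚ (nonZeroDivisors ℤ) Λ.subtype
  set r := (f.restrictScalars ℤ).restrict hf
  have hrinj : Function.Injective r := fun x y hxy => Subtype.ext (hinj (congrArg Subtype.val hxy))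
  have h1 := Submodule.natAbs_det_equiv (LinearMap.range r) (LinearEquiv.ofInjective r hrinj)
  have h2 : (LinearMap.range r).subtype ∘ₗ
      AddMonoidHom.toIntLinearMap (LinearEquiv.ofInjective r hrinj) = r := by
    ext x; rfl
  rw [← h1]
  have h3 : LinearMap.det f = (LinearMap.det r : ℤ) := by
    rw [← LinearMap.det_toMatrix B, ← LinearMap.det_toMatrix b, Int.cast_det]
    congr 1
    ext i j
    rw [LinearMap.toMatrix_apply, Matrix.map_apply, LinearMap.toMatrix_apply]
    have h4 : f (B j) = Λ.subtype (r (b j)) := by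
      rw [Module.Basis.ofIsLocalizedModule_apply]; rfl
    rw [h4, Module.Basis.ofIsLocalizedModule_repr_apply]
    rfl
  rw [h3, ← Int.cast_abs, Int.abs_eq_natAbs, Int.cast_natCast]
  exact congrArg (fun t : Λ →ₗ[ℤ] Λ => ((LinearMap.det t).natAbs : ℚ)) h2

section

variable (p : ℕ) [hp : Fact p.Prime] {L : Type*} [Field L] [CharZero L]
  [IsCyclotomicExtension {p} ℚ L]

theorem cyclotomicChar_mem_adjoin (i : ZMod p) :
    cyclotomicChar p L i ∈ Algebra.adjoin ℤ (Set.range (cyclotomicChar p L)) :=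
  Algebra.subset_adjoin ⟨i, rfl⟩

/-- In the ring of cyclotomic integers `ζ ^ k - 1` divides `ζ - 1`. -/
theorem cyclotomicChar_sub_one_dvd (k : (ZMod p)ˣ) :
    ∃ c ∈ Algebra.adjoin ℤ (Set.range (cyclotomicChar p L)),
      cyclotomicChar p L 1 - 1 = (cyclotomicChar p L k - 1) * c := by
  refine ⟨∑ j ∈ Finset.range ((k⁻¹ : (ZMod p)ˣ) : ZMod p).val, cyclotomicChar p L k ^ j,
    sum_mem fun j _ => pow_mem (cyclotomicChar_mem_adjoin p _) j, ?_⟩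
  rw [mul_geom_sum, ← AddChar.map_nsmul_eq_pow, nsmul_eq_mul, ZMod.natCast_zmod_val,
    Units.inv_mul]

theorem prod_cyclotomicChar_sub_one_dvd (s : Finset (ZMod p)ˣ) :
    ∃ c ∈ Algebra.adjoin ℤ (Set.range (cyclotomicChar p L)),
      (cyclotomicChar p L 1 - 1) ^ s.card = (∏ k ∈ s, (cyclotomicChar p L k - 1)) * c := by
  choose c hc h using cyclotomicChar_sub_one_dvd p (L := L)
  refine ⟨∏ k ∈ s, c k, prod_mem fun k _ => hc k, ?_⟩
  rw [← Finset.prod_mul_distrib, ← Finset.prod_const]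
  exact Finset.prod_congr rfl fun k _ => h k

theorem norm_cyclotomicChar_sub_one (hodd : Odd p) (k : (ZMod p)ˣ) :
    Algebra.norm ℚ (cyclotomicChar p L k - 1) = p := by
  have h : IsPrimitiveRoot (cyclotomicChar p L k) p := by
    rw [← ZMod.natCast_zmod_val (k : ZMod p), cyclotomicChar_natCast]
    exact (isPrimitiveRoot_cyclotomicChar_one p).pow_of_coprime _ (ZMod.val_coe_unit_coprime k)
  refine h.norm_sub_one_of_prime_ne_two' (Polynomial.cyclotomic.irreducible_rat hp.out.pos) ?_
  rintro rfl
  exact absurd hodd (by decide)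

theorem prod_cyclotomicChar_sub_one (hodd : Odd p) :
    ∏ k : (ZMod p)ˣ, (cyclotomicChar p L k - 1) = p := by
  have : FiniteDimensional ℚ L := IsCyclotomicExtension.finiteDimensional {p} ℚ L
  have : IsGalois ℚ L := IsCyclotomicExtension.isGalois {p} ℚ L
  have h := Algebra.norm_eq_prod_automorphisms ℚ (cyclotomicChar p L ((1 : (ZMod p)ˣ) : ZMod p) - 1)
  rw [norm_cyclotomicChar_sub_one p hodd, map_natCast] at h
  rw [h]
  refine Fintype.prod_equiv (cyclotomicAut p L).toEquiv _ _ fun k => ?_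
  simp [cyclotomicAut_char]

/-- The product of `ζ ^ h - 1` over a subgroup of exponents. -/
noncomputable def cyclotomicProd (L : Type*) [Field L] [CharZero L]
    [IsCyclotomicExtension {p} ℚ L] (H : Subgroup (ZMod p)ˣ) : L :=
  open scoped Classical in
  ∏ k : (ZMod p)ˣ with k ∈ H, (cyclotomicChar p L k - 1)

open scoped Classical in
theorem card_filter_mem_subgroup (H : Subgroup (ZMod p)ˣ) :
    (Finset.univ.filter (· ∈ H)).card = Nat.card H := by
  rw [Nat.card_eq_fintype_card, Fintype.card_subtype]

theorem cyclotomicAut_cyclotomicProd {H : Subgroup (ZMod p)ˣ} {k : (ZMod p)ˣ} (hk : k ∈ H) :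
    cyclotomicAut p L k (cyclotomicProd p L H) = cyclotomicProd p L H := by
  classical
  rw [cyclotomicProd, map_prod]
  refine Finset.prod_equiv (Equiv.mulLeft k) (fun i => ?_) fun i _ => ?_
  · simp [H.mul_mem_cancel_left hk]
  · simp [cyclotomicAut_char]

theorem norm_cyclotomicProd (hodd : Odd p) (H : Subgroup (ZMod p)ˣ) :
    Algebra.norm ℚ (cyclotomicProd p L H) = (p : ℚ) ^ Nat.card H := by
  classical
  rw [cyclotomicProd, map_prod, Finset.prod_congr rfl fun k _ => norm_cyclotomicChar_sub_one p hodd k,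
    Finset.prod_const, card_filter_mem_subgroup]

theorem pow_card_eq_cyclotomicProd_mul (H : Subgroup (ZMod p)ˣ) :
    ∃ c ∈ Algebra.adjoin ℤ (Set.range (cyclotomicChar p L)),
      (cyclotomicChar p L 1 - 1) ^ Nat.card H = cyclotomicProd p L H * c := by
  classical
  obtain ⟨c, hc, h⟩ := prod_cyclotomicChar_sub_one_dvd p (L := L) (Finset.univ.filter (· ∈ H))
  exact ⟨c, hc, by rw [cyclotomicProd, ← h, card_filter_mem_subgroup]⟩

theorem natCast_eq_cyclotomicProd_mul (hodd : Odd p) (H : Subgroup (ZMod p)ˣ) :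
    ∃ c ∈ Algebra.adjoin ℤ (Set.range (cyclotomicChar p L)),
      (p : L) = cyclotomicProd p L H * c := by
  classical
  refine ⟨∏ k : (ZMod p)ˣ with k ∉ H, (cyclotomicChar p L k - 1), Subalgebra.prod_mem _ fun k _ =>
    Subalgebra.sub_mem _ (cyclotomicChar_mem_adjoin p _) (one_mem _), ?_⟩
  rw [cyclotomicProd, Finset.prod_filter_mul_prod_filter_not, prod_cyclotomicChar_sub_one p hodd]

theorem cyclotomicProd_pow_eq_natCast_mul (hodd : Odd p) (H : Subgroup (ZMod p)ˣ) :
    ∃ c ∈ Algebra.adjoin ℤ (Set.range (cyclotomicChar p L)),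
      cyclotomicProd p L H ^ (p - 1) = p * c := by
  classical
  obtain ⟨c, hc, h⟩ := prod_cyclotomicChar_sub_one_dvd p (L := L) Finset.univ
  rw [prod_cyclotomicChar_sub_one p hodd, Finset.card_univ, ZMod.card_units] at h
  have h1 : (1 : (ZMod p)ˣ) ∈ Finset.univ.filter (· ∈ H) := by simp [H.one_mem]
  refine ⟨c * (∏ k ∈ (Finset.univ.filter (· ∈ H)).erase 1, (cyclotomicChar p L k - 1)) ^ (p - 1),
    mul_mem hc (pow_mem (Subalgebra.prod_mem _ fun k _ =>
      Subalgebra.sub_mem _ (cyclotomicChar_mem_adjoin p _) (one_mem _)) _), ?_⟩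
  rw [cyclotomicProd, ← Finset.mul_prod_erase _ _ h1, mul_pow, Units.val_one, h, mul_assoc]

theorem mul_mem_of_mem_adjoin {Λ : Submodule ℤ L}
    (hΛ : ∀ i, ∀ a ∈ Λ, cyclotomicChar p L i * a ∈ Λ) {c : L}
    (hc : c ∈ Algebra.adjoin ℤ (Set.range (cyclotomicChar p L))) {a : L} (ha : a ∈ Λ) :
    c * a ∈ Λ := by
  induction hc using Algebra.adjoin_induction generalizing a with
  | mem x hx => obtain ⟨i, rfl⟩ := hx; exact hΛ i a ha
  | algebraMap r => rw [← Algebra.smul_def]; exact Λ.smul_mem r ha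
  | add x y _ _ hx hy => rw [add_mul]; exact Λ.add_mem (hx ha) (hy ha)
  | mul x y _ _ hx hy => rw [mul_assoc]; exact hx (hy ha)

end

section

variable (p : ℕ) [hp : Fact p.Prime] {L : Type*} [Field L] [CharZero L]
  [IsCyclotomicExtension {p} ℚ L]

/-- An operator of order prime to `p` stabilising a lattice and acting trivially on the lattice
modulo `ϖ` is trivial on the lattice. -/
theorem eq_self_of_trivial_mod_cyclotomicProd (hodd : Odd p) (H : Subgroup (ZMod p)ˣ)
    {Λ : Submodule ℤ L} (hfg : Λ.FG) (hΛ : ∀ i, ∀ a ∈ Λ, cyclotomicChar p L i * a ∈ Λ)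
    {g : Module.End ℚ L} (hgΛ : ∀ a ∈ Λ, g a ∈ Λ) {n : ℕ} (hn : g ^ n = 1) (hpn : ¬ p ∣ n)
    (hc : ∀ a, g (cyclotomicProd p L H * a) = cyclotomicProd p L H * g a)
    (htriv : ∀ a ∈ Λ, ∃ b ∈ Λ, g a - a = cyclotomicProd p L H * b) {a : L} (ha : a ∈ Λ) :
    g a = a := by
  set ϖ := cyclotomicProd p L H with hϖ
  have hp0 : (p : L) ≠ 0 := Nat.cast_ne_zero.2 hp.out.ne_zero
  obtain ⟨c₁, hc₁, hpϖ⟩ := natCast_eq_cyclotomicProd_mul p (L := L) hodd H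
  obtain ⟨c₂, hc₂, hϖp⟩ := cyclotomicProd_pow_eq_natCast_mul p (L := L) hodd H
  rw [← hϖ] at hpϖ hϖp
  have hϖ0 : ϖ ≠ 0 := by
    rintro h0
    rw [h0, zero_mul] at hpϖ
    exact hp0 hpϖ
  have hgi : ∀ (i : ℕ), ∀ a ∈ Λ, (g ^ i) a ∈ Λ ∧ ∃ b ∈ Λ, (g ^ i) a - a = ϖ * b := by
    intro i
    induction i with
    | zero => exact fun a ha => ⟨ha, 0, Λ.zero_mem, by simp⟩
    | succ i ih =>
      intro a ha
      obtain ⟨h1, b, hb, hb'⟩ := ih a ha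
      obtain ⟨b', hb1, hb2⟩ := htriv _ h1
      rw [pow_succ']
      exact ⟨hgΛ _ h1, b' + b, Λ.add_mem hb1 hb, by
        rw [mul_add, ← hb2, ← hb']; simp⟩
  have hgc : ∀ (i : ℕ) a, (g ^ i) (ϖ * a) = ϖ * (g ^ i) a := by
    intro i
    induction i with
    | zero => simp
    | succ i ih => intro a; rw [pow_succ', Module.End.mul_apply, ih, hc]; rfl
  let s : Module.End ℚ L := ∑ i ∈ Finset.range n, g ^ i
  have hs : ∀ a, s a = ∑ i ∈ Finset.range n, (g ^ i) a := fun a => by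
    simp [s, LinearMap.sum_apply]
  have hsc : ∀ a, s (ϖ * a) = ϖ * s a := fun a => by simp only [hs, hgc, Finset.mul_sum]
  have hdiv : ∀ a ∈ Λ, s a = 0 → ∃ b ∈ Λ, s b = 0 ∧ a = ϖ * b := by
    intro a ha hsa
    have h1 : ∃ b ∈ Λ, (n : L) * a = ϖ * b := by
      choose! b hb hb' using fun i => (hgi i a ha).2
      refine ⟨-∑ i ∈ Finset.range n, b i, Λ.neg_mem (sum_mem fun i _ => hb i), ?_⟩
      rw [mul_neg, Finset.mul_sum, ← Finset.sum_congr rfl fun i _ => hb' i,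
        Finset.sum_sub_distrib, ← hs, hsa]
      simp
    obtain ⟨b, hb, hb'⟩ := h1
    have hcop : IsCoprime (n : ℤ) (p : ℤ) :=
      Nat.isCoprime_iff_coprime.2 ((Nat.Prime.coprime_iff_not_dvd hp.out).2 hpn).symm
    obtain ⟨u, v, huv⟩ := hcop
    have huv' : (u : L) * n + v * p = 1 := by exact_mod_cast congrArg (Int.cast (R := L)) huv
    have h2 : a = ϖ * (u • b + v • (c₁ * a)) := by
      rw [zsmul_eq_mul, zsmul_eq_mul]
      linear_combination (-a) * huv' + (u : L) * hb' + (v : L) * a * hpϖ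
    refine ⟨_, Λ.add_mem (Λ.smul_mem u hb) (Λ.smul_mem v (mul_mem_of_mem_adjoin p hΛ hc₁ ha)),
      ?_, h2⟩
    rw [h2, hsc] at hsa
    exact (mul_eq_zero.1 hsa).resolve_left hϖ0
  have hdivp : ∀ (m : ℕ) a, a ∈ Λ → s a = 0 → ∃ b ∈ Λ, s b = 0 ∧ a = ϖ ^ m * b := by
    intro m
    induction m with
    | zero => exact fun a ha h => ⟨a, ha, h, by simp⟩
    | succ m ih =>
      intro a ha h
      obtain ⟨b, hb, hsb, rfl⟩ := ih a ha h
      obtain ⟨c, hc, hsc, rfl⟩ := hdiv b hb hsb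
      exact ⟨c, hc, hsc, by ring⟩
  let N : Submodule ℤ L := Λ ⊓ LinearMap.ker (s.restrictScalars ℤ)
  have hNfg : N.FG := by
    have : Module.Finite ℤ Λ := Module.Finite.of_fg hfg
    have : IsNoetherian ℤ Λ := inferInstance
    exact isNoetherian_submodule.1 this N inf_le_left
  have hNp : N ≤ Ideal.span {(p : ℤ)} • N := by
    rintro a ⟨ha, hsa⟩
    obtain ⟨b, hb, hsb, hab⟩ := hdivp (p - 1) a ha hsa
    have h1 : a = (p : ℤ) • (c₂ * b) := by rw [hab, hϖp, zsmul_eq_mul]; push_cast; ring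
    rw [h1]
    refine Submodule.smul_mem_smul (Ideal.mem_span_singleton_self _)
      ⟨mul_mem_of_mem_adjoin p hΛ hc₂ hb, ?_⟩
    rw [SetLike.mem_coe, LinearMap.mem_ker, LinearMap.coe_restrictScalars] at hsa ⊢
    rw [h1, map_zsmul, zsmul_eq_mul] at hsa
    exact (mul_eq_zero.1 hsa).resolve_left (by exact_mod_cast hp0)
  obtain ⟨r, hr, hrN⟩ :=
    Submodule.exists_sub_one_mem_and_smul_eq_zero_of_fg_of_le_smul _ N hNfg hNp
  have hr0 : r ≠ 0 := by
    rintro rfl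
    rw [Ideal.mem_span_singleton, zero_sub, dvd_neg] at hr
    have := Int.natCast_dvd_natCast.1 (by simpa using hr : (p : ℤ) ∣ (1 : ℕ))
    exact hp.out.one_lt.ne' (Nat.dvd_one.1 this)
  have hmem : g a - a ∈ N := by
    refine ⟨Λ.sub_mem (hgΛ a ha) ha, ?_⟩
    rw [SetLike.mem_coe, LinearMap.mem_ker, LinearMap.coe_restrictScalars]
    have h1 : s * (g - 1) = 0 := by rw [geom_sum_mul, hn, sub_self]
    simpa using LinearMap.congr_fun h1 a
  have := hrN _ hmem
  rw [zsmul_eq_mul] at this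
  exact sub_eq_zero.1 ((mul_eq_zero.1 this).resolve_left (Int.cast_ne_zero.2 hr0))

end

/-- The action on the quotient by a stable subgroup, as a `ZMod p`-linear representation. -/
def quotientZModRep (p : ℕ) {Γ M : Type*} [Monoid Γ] [AddCommGroup M]
    (ρ : Γ →* Module.End ℤ M) (N : Submodule ℤ M) (hN : ∀ g, N ≤ N.comap (ρ g))
    [Module (ZMod p) (M ⧸ N)] : Γ →* Module.End (ZMod p) (M ⧸ N) where
  toFun g := (N.mapQ N (ρ g) (hN g)).toAddMonoidHom.toZModLinearMap p
  map_one' := by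
    refine LinearMap.ext fun x => ?_
    obtain ⟨x, rfl⟩ := N.mkQ_surjective x
    change N.mapQ N (ρ 1) (hN 1) (N.mkQ x) = N.mkQ x
    simp
  map_mul' g h := by
    refine LinearMap.ext fun x => ?_
    obtain ⟨x, rfl⟩ := N.mkQ_surjective x
    change N.mapQ N (ρ (g * h)) (hN _) (N.mkQ x) =
      N.mapQ N (ρ g) (hN g) (N.mapQ N (ρ h) (hN h) (N.mkQ x))
    simp

section

variable (p : ℕ) [hp : Fact p.Prime] {L : Type*} [Field L] [CharZero L]
  [IsCyclotomicExtension {p} ℚ L]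

/-- The order-`p` elements of a finite group with a cyclic Sylow subgroup of order `p` that lie in
a normal subgroup exist only if the Sylow subgroup does. -/
theorem mem_of_normal_of_dvd_card {G : Type*} [Group G] [Finite G] {x : G} (hx : orderOf x = p)
    (hidx : ¬ p ∣ (Subgroup.zpowers x).index) (K : Subgroup G) [hK : K.Normal]
    (hdvd : p ∣ Nat.card K) : x ∈ K := by
  obtain ⟨y, hy⟩ := exists_prime_orderOf_dvd_card' p hdvd
  have hpg : IsPGroup p (Subgroup.zpowers x) := IsPGroup.of_card (n := 1) (by
    rw [Nat.card_zpowers, hx, pow_one])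
  have hpy : IsPGroup p (Subgroup.zpowers (y : G)) := IsPGroup.of_card (n := 1) (by
    rw [Nat.card_zpowers, Subgroup.orderOf_coe, hy, pow_one])
  let P : Sylow p G := hpg.toSylow hidx
  obtain ⟨Q, hQ⟩ := hpy.exists_le_sylow
  obtain ⟨g, hg⟩ := MulAction.exists_smul_eq G Q P
  have hmem : g * y * g⁻¹ ∈ Subgroup.zpowers x := by
    have h1 : g * y * g⁻¹ ∈ (P : Subgroup G) := by
      rw [← hg, Sylow.coe_subgroup_smul]
      exact Subgroup.smul_mem_pointwise_smul _ (MulAut.conj g) _ (hQ (Subgroup.mem_zpowers _))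
    exact h1
  have hmK : g * y * g⁻¹ ∈ K := hK.conj_mem _ y.2 g
  have hle : Subgroup.zpowers (g * y * g⁻¹) ≤ Subgroup.zpowers x := by
    rwa [Subgroup.zpowers_le]
  have hoc : orderOf (g * y * g⁻¹) = p := by
    rw [← hy, ← Subgroup.orderOf_coe]
    exact (MulAut.conj g).orderOf_eq (y : G)
  have heq : Subgroup.zpowers (g * y * g⁻¹) = Subgroup.zpowers x :=
    Subgroup.eq_of_le_of_card_ge hle (by rw [Nat.card_zpowers, Nat.card_zpowers, hoc, hx])
  have : x ∈ Subgroup.zpowers (g * y * g⁻¹) := heq ▸ Subgroup.mem_zpowers x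
  exact (Subgroup.zpowers_le.2 hmK) this

/-- Conjugation takes the rotation by `ζ` to a nontrivial rotation. -/
theorem exists_eq_unit_of_conj {g : L ≃ₗ[ℚ] L} {i : ZMod p}
    (h : g * cyclotomicRotation p L 1 = cyclotomicRotation p L i * g) :
    ∃ k : (ZMod p)ˣ, i = k := by
  refine ⟨Units.mk0 i ?_, rfl⟩
  rintro rfl
  have h1 := LinearEquiv.congr_fun h 1
  simp only [LinearEquiv.mul_apply, cyclotomicRotation_apply, AddChar.map_zero_eq_one, one_mul,
    mul_one] at h1
  have h2 := g.injective h1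
  rw [← AddChar.map_zero_eq_one (cyclotomicChar p L)] at h2
  exact one_ne_zero (cyclotomicChar_injective p h2)

/-- The submodule `cΛ ∩ Λ` of `Λ`. -/
def mulSubmodule {K : Type*} [CommRing K] (Λ : Submodule ℤ K) (c : K) : Submodule ℤ Λ :=
  (Λ.map (LinearMap.mulLeft ℤ c)).comap Λ.subtype

theorem mem_mulSubmodule {K : Type*} [CommRing K] {Λ : Submodule ℤ K} {c : K} {a : Λ} :
    a ∈ mulSubmodule Λ c ↔ ∃ b ∈ Λ, c * b = a := Iff.rfl

theorem card_quotient_mulSubmodule {K : Type*} [Field K] [Algebra ℚ K] {Λ : Submodule ℤ K}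
    [Module.Finite ℤ Λ] (hspan : Submodule.span ℚ (Λ : Set K) = ⊤) {c : K} (hc0 : c ≠ 0)
    (hc : ∀ a ∈ Λ, c * a ∈ Λ) :
    (Nat.card (Λ ⧸ mulSubmodule Λ c) : ℚ) = |Algebra.norm ℚ c| := by
  have h := card_lattice_quotient_range_restrict Λ hspan (f := LinearMap.mulLeft ℚ c)
    (mul_right_injective₀ hc0) hc
  have heq : mulSubmodule Λ c =
      LinearMap.range (((LinearMap.mulLeft ℚ c).restrictScalars ℤ).restrict hc) := by
    ext a
    rw [mem_mulSubmodule, LinearMap.mem_range]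
    constructor
    · rintro ⟨b, hb, hba⟩
      exact ⟨⟨b, hb⟩, Subtype.ext hba⟩
    · rintro ⟨b, rfl⟩
      exact ⟨b, b.2, rfl⟩
  rw [heq, h, Algebra.norm_apply]
  rfl

/-- A finite group of operators on the cyclotomic field commuting with a totally imaginary scalar,
in which the group of rotations is not normal, is `C₂ × PSL₂(p)`, and `p ≡ 3 mod 4`. -/
theorem mulEquiv_of_not_normal (hp5 : 5 ≤ p) {Γ : Subgroup (L ≃ₗ[ℚ] L)} [Finite Γ] {x z : Γ}
    (hx : (x : L ≃ₗ[ℚ] L) = cyclotomicRotation p L 1) (hz : (z : L ≃ₗ[ℚ] L) = LinearEquiv.neg ℚ)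
    {θ : L} (hθ0 : θ ≠ 0) (hθ : cyclotomicAut p L (-1) θ = -θ)
    (hcomm : ∀ g ∈ Γ, ∀ a, g (θ * a) = θ * g a)
    (hnn : ∃ g : Γ, ∀ i : ℕ, g * x * g⁻¹ ≠ x ^ i) :
    p % 4 = 3 ∧ Nonempty (Γ ≃* (Multiplicative (ZMod 2) ×
        Matrix.ProjectiveSpecialLinearGroup (Fin 2) (ZMod p))) := by
  have hodd : Odd p := hp.out.odd_of_ne_two (by omega)
  have hfd : FiniteDimensional ℚ L := IsCyclotomicExtension.finiteDimensional {p} ℚ L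
  set H := cyclotomicStabilizer p θ with hH
  set d := Nat.card H with hd
  set ϖ := cyclotomicProd p L H with hϖ
  have hdodd : Odd d := odd_card_cyclotomicStabilizer p hθ0 hθ
  have hdp : 2 * d < p := two_mul_card_cyclotomicStabilizer_lt p hodd hθ0 hθ
  have hcϖ : ∀ g ∈ Γ, ∀ a, g (ϖ * a) = ϖ * g a := fun g hg =>
    map_mul_of_stabilizer_fixed p (fun k hk => cyclotomicAut_cyclotomicProd p hk)
      (g := (g : L →ₗ[ℚ] L)) (hcomm g hg)
  have hox : orderOf x = p := by
    rw [← Subgroup.orderOf_coe, hx, orderOf_cyclotomicRotation_one]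
  have hxi : ∀ i : ℕ, ((x ^ i : Γ) : L ≃ₗ[ℚ] L) = cyclotomicRotation p L i := fun i => by
    rw [SubmonoidClass.coe_pow, hx, cyclotomicRotation_one_pow]
  have hidx := not_dvd_index_zpowers_cyclotomicRotation p hodd hx
  have hcent : ∀ g : Γ, Commute g x → ∃ i : ℕ, g = x ^ i ∨ g = z * x ^ i := by
    intro g hg
    have hfin : IsOfFinOrder (g : L ≃ₗ[ℚ] L) :=
      Submonoid.isOfFinOrder_coe.2 (isOfFinOrder_of_finite g)
    have hg' : Commute (g : L ≃ₗ[ℚ] L) (cyclotomicRotation p L 1) := by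
      rw [← hx]; exact congrArg Subtype.val hg.eq
    obtain ⟨i, hi⟩ := eq_cyclotomicRotation_of_commute p hodd hfin hg'
    refine ⟨i.val, hi.imp (fun hi => Subtype.ext ?_) fun hi => Subtype.ext ?_⟩
    · rw [hxi, hi, ZMod.natCast_zmod_val]
    · rw [Subgroup.coe_mul, hxi, hz, hi, ZMod.natCast_zmod_val]
  have hnormH : ∀ g : Γ, ∀ i : ℕ, g * x * g⁻¹ = x ^ i → ∃ k ∈ H, (i : ZMod p) = (k : (ZMod p)ˣ) := by
    intro g i hgi
    have h : (g : L ≃ₗ[ℚ] L) * cyclotomicRotation p L 1 = cyclotomicRotation p L i * g := by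
      have := congrArg Subtype.val (mul_inv_eq_iff_eq_mul.1 hgi)
      rwa [Subgroup.coe_mul, Subgroup.coe_mul, hxi, hx] at this
    obtain ⟨k, hk⟩ := exists_eq_unit_of_conj p h
    exact ⟨k, cyclotomicAut_eq_of_conj p (hk ▸ h) (hcomm g g.2), hk⟩
  have hnorm : ∀ g : Γ, ∀ i : ℕ, g * x * g⁻¹ = x ^ i → ∃ m, Odd m ∧ (i : ZMod p) ^ m = 1 := by
    intro g i hgi
    obtain ⟨k, hk, hik⟩ := hnormH g i hgi
    refine ⟨d, hdodd, ?_⟩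
    have : (⟨k, hk⟩ : H) ^ d = 1 := pow_card_eq_one'
    have h2 : k ^ d = 1 := congrArg Subtype.val this
    rw [hik, ← Units.val_pow_eq_pow_val, h2, Units.val_one]
  have hd2 : 2 ≤ d := by
    by_contra hlt
    have hd1 : d = 1 := by obtain ⟨r, hr⟩ := hdodd; omega
    have hH1 : ∀ k ∈ H, k = 1 := fun k hk =>
      Subgroup.mem_bot.1 ((Subgroup.card_eq_one.1 hd1) ▸ hk)
    obtain ⟨g, hg⟩ := hnn
    apply hg 1
    rw [pow_one, mul_inv_eq_iff_eq_mul]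
    apply Subtype.ext
    ext a
    rw [Subgroup.coe_mul, Subgroup.coe_mul, hx]
    exact map_mul_of_stabilizer_fixed p (fun k hk => by rw [hH1 k hk]; simp)
      (g := ((g : L ≃ₗ[ℚ] L) : L →ₗ[ℚ] L)) (hcomm g g.2) a
  let Λ : Submodule ℤ L := Submodule.span ℤ (Set.range fun g : Γ => (g : L ≃ₗ[ℚ] L) 1)
  have hfg : Λ.FG := Submodule.fg_span (Set.finite_range _)
  have : Module.Finite ℤ Λ := Module.Finite.of_fg hfg
  have hΓΛ : ∀ g : Γ, ∀ a ∈ Λ, (g : L ≃ₗ[ℚ] L) a ∈ Λ := by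
    intro g a ha
    have : Λ ≤ Λ.comap (((g : L ≃ₗ[ℚ] L) : L →ₗ[ℚ] L).restrictScalars ℤ) := by
      refine Submodule.span_le.2 ?_
      rintro _ ⟨h, rfl⟩
      exact Submodule.subset_span ⟨g * h, rfl⟩
    exact this ha
  have hΛ : ∀ i, ∀ a ∈ Λ, cyclotomicChar p L i * a ∈ Λ := by
    intro i a ha
    have := hΓΛ (x ^ i.val) a ha
    rwa [hxi, ZMod.natCast_zmod_val] at this
  have hone : (1 : L) ∈ Λ := Submodule.subset_span ⟨1, rfl⟩
  have hspan : Submodule.span ℚ (Λ : Set L) = ⊤ := by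
    refine top_unique ?_
    rw [← span_range_cyclotomicChar p, Submodule.span_le]
    rintro _ ⟨i, rfl⟩
    exact Submodule.subset_span (by simpa using hΛ i 1 hone)
  have hA : ∀ c ∈ Algebra.adjoin ℤ (Set.range (cyclotomicChar p L)), ∀ a ∈ Λ, c * a ∈ Λ :=
    fun c hc a ha => mul_mem_of_mem_adjoin p hΛ hc ha
  obtain ⟨c₁, hc₁, hpϖ⟩ := natCast_eq_cyclotomicProd_mul p (L := L) hodd H
  obtain ⟨c₂, hc₂, hπϖ⟩ := pow_card_eq_cyclotomicProd_mul p (L := L) H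
  rw [← hϖ] at hpϖ hπϖ
  have hϖ0 : ϖ ≠ 0 := by
    intro h0
    rw [h0, zero_mul] at hpϖ
    exact hp.out.ne_zero (Nat.cast_eq_zero.1 hpϖ)
  have hϖA : ϖ ∈ Algebra.adjoin ℤ (Set.range (cyclotomicChar p L)) :=
    Subalgebra.prod_mem _ fun k _ =>
      Subalgebra.sub_mem _ (cyclotomicChar_mem_adjoin p _) (one_mem _)
  set N := mulSubmodule Λ ϖ with hN
  have hcardN : Nat.card (Λ ⧸ N) = p ^ d := by
    have := card_quotient_mulSubmodule hspan hϖ0 (hA ϖ hϖA)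
    rw [norm_cyclotomicProd p hodd, abs_of_nonneg (by positivity)] at this
    exact_mod_cast this
  obtain ⟨_⟩ : Nonempty (Module (ZMod p) (Λ ⧸ N)) := by
    refine ⟨AddCommGroup.zmodModule fun q => ?_⟩
    obtain ⟨a, rfl⟩ := N.mkQ_surjective q
    rw [← map_nsmul, Submodule.mkQ_apply, Submodule.Quotient.mk_eq_zero]
    refine mem_mulSubmodule.2 ⟨c₁ * a, hA c₁ hc₁ a a.2, ?_⟩
    rw [← mul_assoc, ← hpϖ, ← nsmul_eq_mul]
    rfl
  have : Finite (Λ ⧸ N) := Nat.finite_of_card_ne_zero (by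
    rw [hcardN]; exact pow_ne_zero _ hp.out.ne_zero)
  have hfr : Module.finrank (ZMod p) (Λ ⧸ N) = d := by
    have : Module.Finite (ZMod p) (Λ ⧸ N) := .of_finite
    have := Module.natCard_eq_pow_finrank (K := ZMod p) (V := Λ ⧸ N)
    rw [hcardN, Nat.card_zmod] at this
    exact (Nat.pow_right_injective hp.out.two_le this).symm
  let ρ : Γ →* Module.End ℤ Λ :=
    { toFun := fun g => (((g : L ≃ₗ[ℚ] L) : L →ₗ[ℚ] L).restrictScalars ℤ).restrict (hΓΛ g)
      map_one' := rfl
      map_mul' := fun _ _ => rfl }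
  have hρ : ∀ (g : Γ) (a : Λ), ((ρ g a : Λ) : L) = (g : L ≃ₗ[ℚ] L) a := fun _ _ => rfl
  have hρN : ∀ g, N ≤ N.comap (ρ g) := by
    rintro g a ⟨b, hb, hba⟩
    exact ⟨(g : L ≃ₗ[ℚ] L) b, hΓΛ g b hb, by
      change ϖ * (g : L ≃ₗ[ℚ] L) b = (g : L ≃ₗ[ℚ] L) a
      rw [← hcϖ g g.2]; exact congrArg _ hba⟩
  let τ := quotientZModRep p ρ N hρN
  have hτ : ∀ g a, τ g (N.mkQ a) = N.mkQ (ρ g a) := fun _ _ => rfl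
  set π : L := cyclotomicChar p L 1 - 1 with hπ
  have hπA : π ∈ Algebra.adjoin ℤ (Set.range (cyclotomicChar p L)) :=
    Subalgebra.sub_mem _ (cyclotomicChar_mem_adjoin p _) (one_mem _)
  have htpow : ∀ (n : ℕ) (a : Λ), ((τ x - 1) ^ n) (N.mkQ a) =
      N.mkQ ⟨π ^ n * a, hA _ (pow_mem hπA n) a a.2⟩ := by
    intro n
    induction n with
    | zero => intro a; simp
    | succ n ih =>
      intro a
      have h1 : (τ x - 1) (N.mkQ a) = N.mkQ ⟨π * a, hA _ hπA a a.2⟩ := by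
        rw [LinearMap.sub_apply, hτ, Module.End.one_apply, ← map_sub]
        congr 1
        apply Subtype.ext
        rw [Submodule.coe_sub, hρ, hx, cyclotomicRotation_apply]
        exact (sub_one_mul _ _).symm
      rw [pow_succ, Module.End.mul_apply, h1, ih]
      congr 2
      rw [← mul_assoc, pow_succ]
  have hmk : ∀ a : Λ, N.mkQ a = 0 ↔ ∃ b ∈ Λ, ϖ * b = a := fun a => by
    rw [Submodule.mkQ_apply, Submodule.Quotient.mk_eq_zero, hN, mem_mulSubmodule]
  have hn : Algebra.norm ℚ π = p := by
    have := norm_cyclotomicChar_sub_one p (L := L) hodd 1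
    rwa [Units.val_one] at this
  have hπ0 : π ≠ 0 := by
    intro h0
    rw [h0, Algebra.norm_zero] at hn
    exact hp.out.ne_zero (Nat.cast_eq_zero.1 hn.symm)
  obtain ⟨v, hv⟩ : ∃ v, ((τ x - 1) ^ (d - 1)) v ≠ 0 := by
    by_contra! hall
    have hle : mulSubmodule Λ (π ^ (d - 1)) ≤ N := by
      rintro a ⟨b, hb, hba⟩
      have := hall (N.mkQ ⟨b, hb⟩)
      rw [htpow, hmk] at this
      obtain ⟨e, he, hee⟩ := this
      exact ⟨e, he, hee.trans hba⟩
    have hcard := card_quotient_mulSubmodule hspan (pow_ne_zero (d - 1) hπ0)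
      (hA _ (pow_mem hπA (d - 1)))
    rw [map_pow, hn, abs_of_nonneg (by positivity)] at hcard
    have hcard' : Nat.card (Λ ⧸ mulSubmodule Λ (π ^ (d - 1))) = p ^ (d - 1) := by
      exact_mod_cast hcard
    have : Finite (Λ ⧸ mulSubmodule Λ (π ^ (d - 1))) := Nat.finite_of_card_ne_zero (by
      rw [hcard']; exact pow_ne_zero _ hp.out.ne_zero)
    have hsurj := Nat.card_le_card_of_surjective _ (Submodule.factor_surjective hle)
    rw [hcardN, hcard'] at hsurj
    have := (Nat.pow_le_pow_iff_right hp.out.one_lt).1 hsurj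
    omega
  have hreg : IsRegularNilpotent (τ x - 1) v d :=
    { pow_eq_zero := by
        refine LinearMap.ext fun q => ?_
        obtain ⟨a, rfl⟩ := N.mkQ_surjective q
        rw [htpow, LinearMap.zero_apply, hmk]
        exact ⟨c₂ * a, hA _ hc₂ a a.2, by rw [← mul_assoc, ← hπϖ]⟩
      pow_apply_ne_zero := hv
      finrank_eq := hfr
      pos := by omega }
  have hτinj : Function.Injective τ := by
    rw [injective_iff_map_eq_one]
    intro g hg
    have hpK : ¬ p ∣ Nat.card τ.ker := by
      intro hdvd
      have hxK := mem_of_normal_of_dvd_card p hox hidx τ.ker hdvd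
      rw [MonoidHom.mem_ker] at hxK
      apply hreg.pow_apply_ne_zero
      rw [hxK, sub_self, zero_pow (by omega), LinearMap.zero_apply]
    have hgn : g ^ Nat.card τ.ker = 1 := by
      have : (⟨g, hg⟩ : τ.ker) ^ Nat.card τ.ker = 1 := pow_card_eq_one'
      exact congrArg Subtype.val this
    have hid : ∀ a ∈ Λ, (g : L ≃ₗ[ℚ] L) a = a := by
      intro a ha
      refine eq_self_of_trivial_mod_cyclotomicProd p hodd H hfg hΛ
        (g := ((g : L ≃ₗ[ℚ] L) : L →ₗ[ℚ] L)) (hΓΛ g) (n := Nat.card τ.ker) ?_ hpK (hcϖ g g.2) ?_ ha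
      · have h2 := congrArg (fun h : Γ => ((h : L ≃ₗ[ℚ] L) : L →ₗ[ℚ] L)) hgn
        have h3 : (((g ^ Nat.card τ.ker : Γ) : L ≃ₗ[ℚ] L) : L →ₗ[ℚ] L) =
            ((g : L ≃ₗ[ℚ] L) : L →ₗ[ℚ] L) ^ Nat.card τ.ker :=
          map_pow ((LinearEquiv.automorphismGroup.toLinearMapMonoidHom (R := ℚ) (M := L)).comp
            Γ.subtype) g _
        rw [← h3]; exact h2
      · intro a ha
        have h2 : τ g (N.mkQ ⟨a, ha⟩) = N.mkQ ⟨a, ha⟩ := by rw [hg, Module.End.one_apply]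
        rw [hτ, ← sub_eq_zero, ← map_sub, hmk] at h2
        obtain ⟨b, hb, hba⟩ := h2
        exact ⟨b, hb, hba.symm⟩
    apply Subtype.ext
    apply LinearEquiv.toLinearMap_injective
    refine LinearMap.ext_on hspan fun a ha => hid a ha
  have hτz : τ z = -1 := by
    refine LinearMap.ext fun q => ?_
    obtain ⟨a, rfl⟩ := N.mkQ_surjective q
    rw [hτ, LinearMap.neg_apply, Module.End.one_apply, ← map_neg]
    congr 1
    apply Subtype.ext
    rw [hρ, hz]
    rfl
  exact mulEquiv_prod_projectiveSpecialLinearGroup_of_regular_unipotent hreg hp5 hd2 hdodd hdp hox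
    hidx hτinj (by abel) hτz hcent hnorm hnn

end

section

variable (p : ℕ) [hp : Fact p.Prime] {L : Type*} [Field L] [CharZero L]
  [IsCyclotomicExtension {p} ℚ L]

/-- Semilinear maps attached to distinct automorphisms do not cancel. -/
theorem exists_sum_mul_cyclotomicAut_ne_zero {ι : Type*} [Fintype ι] [Nonempty ι] {c : ι → L}
    (hc : ∀ i, c i ≠ 0) {k : ι → (ZMod p)ˣ} (hk : Function.Injective k) :
    ∃ w, ∑ i, c i * cyclotomicAut p L (k i) w ≠ 0 := by
  by_contra! h
  have hli := (linearIndependent_monoidHom L L).comp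
    (fun i => ((cyclotomicAut p L (k i) : L ≃ₐ[ℚ] L) : L →* L)) fun i j hij => hk
      ((cyclotomicAut p L).injective (AlgEquiv.ext fun a => DFunLike.congr_fun hij a))
  rw [Fintype.linearIndependent_iff] at hli
  refine hc (Classical.arbitrary ι) (hli c (funext fun w => ?_) _)
  rw [Finset.sum_apply]
  exact h w

/-- A finite group of operators normalising the group of rotations, and commuting with a totally
imaginary scalar, is monomial: its elements permute, up to sign, the lines `ζ ^ i v`. -/
theorem exists_apply_mul_eq_of_normal (hodd : Odd p) {Γ : Subgroup (L ≃ₗ[ℚ] L)} [Finite Γ] {x : Γ}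
    (hx : (x : L ≃ₗ[ℚ] L) = cyclotomicRotation p L 1) {θ : L} (hθ0 : θ ≠ 0)
    (hθ : cyclotomicAut p L (-1) θ = -θ) (hcomm : ∀ g ∈ Γ, ∀ a, g (θ * a) = θ * g a)
    (hnorm : ∀ g : Γ, ∃ i : ℕ, g * x * g⁻¹ = x ^ i) :
    ∃ v : L, v ≠ 0 ∧ ∀ g ∈ Γ, ∃ k ∈ cyclotomicStabilizer p θ, ∃ i,
      (∀ a, g (v * a) = v * (cyclotomicChar p L i * cyclotomicAut p L k a)) ∨
      ∀ a, g (v * a) = -(v * (cyclotomicChar p L i * cyclotomicAut p L k a)) := by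
  have hxi : ∀ i : ℕ, ((x ^ i : Γ) : L ≃ₗ[ℚ] L) = cyclotomicRotation p L i := fun i => by
    rw [SubmonoidClass.coe_pow, hx, cyclotomicRotation_one_pow]
  have hconj : ∀ g : Γ, ∃ k ∈ cyclotomicStabilizer p θ,
      (g : L ≃ₗ[ℚ] L) * cyclotomicRotation p L 1 = cyclotomicRotation p L (k : (ZMod p)ˣ) * g := by
    intro g
    obtain ⟨i, hi⟩ := hnorm g
    have h : (g : L ≃ₗ[ℚ] L) * cyclotomicRotation p L 1 = cyclotomicRotation p L i * g := by
      have := congrArg Subtype.val (mul_inv_eq_iff_eq_mul.1 hi)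
      rwa [Subgroup.coe_mul, Subgroup.coe_mul, hxi, hx] at this
    obtain ⟨k, hk⟩ := exists_eq_unit_of_conj p h
    exact ⟨k, cyclotomicAut_eq_of_conj p (hk ▸ h) (hcomm g g.2), hk ▸ h⟩
  choose k hkH hk using hconj
  have hg : ∀ (g : Γ) a, (g : L ≃ₗ[ℚ] L) a = (g : L ≃ₗ[ℚ] L) 1 * cyclotomicAut p L (k g) a :=
    fun g => eq_mul_cyclotomicAut_of_conj p (hk g)
  have hg1 : ∀ g : Γ, (g : L ≃ₗ[ℚ] L) 1 ≠ 0 := fun g h0 =>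
    one_ne_zero ((g : L ≃ₗ[ℚ] L).map_eq_zero_iff.1 h0)
  have hkmul : ∀ g h, k (g * h) = k g * k h := by
    intro g h
    apply (cyclotomicAut p L).injective
    ext a
    have h1 : (g : L ≃ₗ[ℚ] L) ((h : L ≃ₗ[ℚ] L) a) = _ := hg (g * h) a
    have h2 : ((g * h : Γ) : L ≃ₗ[ℚ] L) 1 = (g : L ≃ₗ[ℚ] L) ((h : L ≃ₗ[ℚ] L) 1) := rfl
    rw [hg h a, hg g (_ * _), h2, hg g ((h : L ≃ₗ[ℚ] L) 1), map_mul, ← mul_assoc] at h1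
    rw [map_mul, AlgEquiv.mul_apply]
    refine (mul_left_cancel₀ (mul_ne_zero (hg1 g) ?_) h1).symm
    exact (map_ne_zero _).2 (hg1 h)
  let κ : Γ →* (ZMod p)ˣ := MonoidHom.mk' k hkmul
  have hrot : ∀ g ∈ κ.ker, ∃ i, (g : L ≃ₗ[ℚ] L) = cyclotomicRotation p L i ∨
      (g : L ≃ₗ[ℚ] L) = LinearEquiv.neg ℚ * cyclotomicRotation p L i := by
    intro g hgk
    refine eq_cyclotomicRotation_of_commute p hodd
      (Submonoid.isOfFinOrder_coe.2 (isOfFinOrder_of_finite g)) ?_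
    have h1 : k g = 1 := hgk
    have := hk g
    rwa [h1, Units.val_one] at this
  have hcop : Nat.Coprime (Nat.card κ.ker) κ.ker.index := by
    refine Nat.Coprime.symm (Nat.coprime_of_dvd fun q hq hqi hqc => ?_)
    rw [Subgroup.index_ker] at hqi
    have := Fact.mk hq
    obtain ⟨y, hy⟩ := exists_prime_orderOf_dvd_card' q hqc
    have hy2 : y ^ (2 * p) = 1 := by
      obtain ⟨i, hi⟩ := hrot y y.2
      have h1 : cyclotomicRotation p L i ^ p = 1 := by
        rw [← ZMod.natCast_zmod_val i, ← cyclotomicRotation_one_pow, ← pow_mul, mul_comm, pow_mul,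
          orderOf_dvd_iff_pow_eq_one.1 (orderOf_cyclotomicRotation_one p (L := L)).dvd, one_pow]
      have h2 : (LinearEquiv.neg ℚ : L ≃ₗ[ℚ] L) ^ 2 = 1 := by
        ext a
        simp [pow_two]
      apply Subtype.ext
      apply Subtype.ext
      change ((y : Γ) : L ≃ₗ[ℚ] L) ^ (2 * p) = 1
      rcases hi with hi | hi
      · rw [hi, mul_comm, pow_mul, h1, one_pow]
      · have hc : Commute (LinearEquiv.neg ℚ : L ≃ₗ[ℚ] L) (cyclotomicRotation p L i) := by
          ext a
          simp
        rw [hi, hc.mul_pow, pow_mul, h2, one_pow, mul_comm 2, pow_mul, h1, one_pow, one_mul]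
    rw [← orderOf_dvd_iff_pow_eq_one, hy] at hy2
    rcases (Nat.Prime.dvd_mul hq).1 hy2 with h2 | h2
    · have h3 := hqi.trans (Subgroup.card_dvd_of_le (H := κ.range)
        (K := cyclotomicStabilizer p θ) (by rintro _ ⟨g, rfl⟩; exact hkH g))
      rw [(Nat.prime_dvd_prime_iff_eq hq Nat.prime_two).1 h2] at h3
      exact Nat.not_even_iff_odd.2 (odd_card_cyclotomicStabilizer p hθ0 hθ) (even_iff_two_dvd.2 h3)
    · have h3 := hqi.trans κ.range.card_subgroup_dvd_card
      rw [(Nat.prime_dvd_prime_iff_eq hq hp.out).1 h2, Nat.card_eq_fintype_card,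
        ZMod.card_units] at h3
      have := Nat.le_of_dvd (by have := hp.out.two_le; omega) h3
      have := hp.out.two_le
      omega
  obtain ⟨C, hC⟩ := Subgroup.exists_right_complement'_of_coprime hcop
  have := Fintype.ofFinite C
  obtain ⟨w, hw⟩ := exists_sum_mul_cyclotomicAut_ne_zero p (ι := C)
    (c := fun c => ((c : Γ) : L ≃ₗ[ℚ] L) 1) (fun c => hg1 c) (k := fun c => k c) (by
      intro c c' h
      have h1 : (c : Γ)⁻¹ * c' ∈ κ.ker := by
        rw [MonoidHom.mem_ker, map_mul, map_inv]
        exact inv_mul_eq_one.2 h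
      have h2 : (c : Γ)⁻¹ * c' ∈ C := C.mul_mem (C.inv_mem c.2) c'.2
      exact Subtype.ext (inv_mul_eq_one.1 (Subgroup.disjoint_def.1 hC.disjoint h1 h2)))
  have hfix : ∀ c : C, ((c : Γ) : L ≃ₗ[ℚ] L)
      (∑ c : C, ((c : Γ) : L ≃ₗ[ℚ] L) 1 * cyclotomicAut p L (k c) w) =
      ∑ c : C, ((c : Γ) : L ≃ₗ[ℚ] L) 1 * cyclotomicAut p L (k c) w := by
    intro c
    rw [map_sum]
    refine Fintype.sum_equiv (Equiv.mulLeft c) _ _ fun c' => ?_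
    rw [← hg, ← hg]
    rfl
  refine ⟨_, hw, fun g hgΓ => ⟨k ⟨g, hgΓ⟩, hkH _, ?_⟩⟩
  obtain ⟨⟨n, c⟩, hnc⟩ := hC.2 ⟨g, hgΓ⟩
  obtain ⟨i, hi⟩ := hrot n n.2
  refine ⟨i, ?_⟩
  set v := ∑ c : C, ((c : Γ) : L ≃ₗ[ℚ] L) 1 * cyclotomicAut p L (k c) w
  have hgv : ∀ a, g (v * a) = ((n : Γ) : L ≃ₗ[ℚ] L) v * cyclotomicAut p L (k ⟨g, hgΓ⟩) a := by
    intro a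
    have h1 : ∀ a, g a = g 1 * cyclotomicAut p L (k ⟨g, hgΓ⟩) a := hg ⟨g, hgΓ⟩
    have h2 : g v = ((n : Γ) : L ≃ₗ[ℚ] L) v := by
      have h3 : g = ((n : Γ) : L ≃ₗ[ℚ] L) * ((c : Γ) : L ≃ₗ[ℚ] L) := (congrArg Subtype.val hnc).symm
      rw [h3, LinearEquiv.mul_apply, hfix]
    rw [← h2, h1, h1 v, map_mul, mul_assoc]
  rcases hi with hi | hi
  · left
    intro a
    rw [hgv, hi, cyclotomicRotation_apply]
    ring
  · right
    intro a
    rw [hgv, hi, LinearEquiv.mul_apply, cyclotomicRotation_apply, LinearEquiv.neg_apply]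
    ring

end

section

variable (p : ℕ) [hp : Fact p.Prime] {L : Type*} [Field L] [CharZero L]
  [IsCyclotomicExtension {p} ℚ L]

/-- A maximal finite symplectic group contained in a conjugate, by a scalar, of a finite symplectic
group is equal to it. -/
theorem eq_map_conj_of_le {Γ : Subgroup (L ≃ₗ[ℚ] L)} (h1 : cyclotomicRotation p L 1 ∈ Γ)
    (hmax : ∀ Δ : Subgroup (L ≃ₗ[ℚ] L), Finite Δ → IsSymplecticLinearGroup Δ → Γ ≤ Δ → Δ = Γ)
    {Δ : Subgroup (L ≃ₗ[ℚ] L)} [Finite Δ] {θ : L} (hθ0 : θ ≠ 0)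
    (hθ : cyclotomicAut p L (-1) θ = -θ) (hcomm : ∀ g ∈ Δ, ∀ a, g (θ * a) = θ * g a) (u : Lˣ)
    (hle : Γ ≤ Δ.map (MulAut.conj (DistribMulAction.toModuleAut ℚ L u)).toMonoidHom) :
    Δ.map (MulAut.conj (DistribMulAction.toModuleAut ℚ L u)).toMonoidHom = Γ := by
  have hfin : Finite (Δ.map (MulAut.conj (DistribMulAction.toModuleAut ℚ L u)).toMonoidHom) :=
    Finite.of_surjective _ (MonoidHom.subgroupMap_surjective
      (MulAut.conj (DistribMulAction.toModuleAut ℚ L u)).toMonoidHom Δ)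
  refine hmax _ hfin ((isSymplecticLinearGroup_iff_exists_mul p (hle h1)).2
    ⟨θ, hθ0, hθ, ?_⟩) hle
  rintro _ ⟨g, hg, rfl⟩ a
  change (u : L) * g ((u⁻¹ : Lˣ) * (θ * a)) = θ * ((u : L) * g ((u⁻¹ : Lˣ) * a))
  rw [mul_left_comm, hcomm g hg, mul_left_comm]

/-- The units of `ℤ/p` acting on the cyclic group of order `p`. -/
def zmodUnitsMulAut : (ZMod p)ˣ →* MulAut (Multiplicative (ZMod p)) :=
  (MulAutMultiplicative (ZMod p)).symm.toMonoidHom.comp AddAut.mulLeft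

theorem zmodUnitsMulAut_apply (k : (ZMod p)ˣ) (i : Multiplicative (ZMod p)) :
    zmodUnitsMulAut p k i = .ofAdd (k * i.toAdd) := rfl

theorem zmodUnitsMulAut_injective : Function.Injective (zmodUnitsMulAut p) := by
  intro k l h
  have := congrArg Multiplicative.toAdd (DFunLike.congr_fun h (.ofAdd 1))
  simpa [zmodUnitsMulAut_apply, Units.ext_iff] using this

variable (L) in
/-- The rotations as a homomorphism. -/
noncomputable def cyclotomicRotationHom : Multiplicative (ZMod p) →* (L ≃ₗ[ℚ] L) where
  toFun i := cyclotomicRotation p L i.toAdd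
  map_one' := by ext a; simp
  map_mul' i j := by ext a; simp [AddChar.map_add_eq_mul, mul_assoc]

variable (L) in
/-- The Galois group as linear operators. -/
noncomputable def cyclotomicAutHom : (ZMod p)ˣ →* (L ≃ₗ[ℚ] L) where
  toFun k := (cyclotomicAut p L k).toLinearEquiv
  map_one' := by ext a; simp
  map_mul' k l := by ext a; simp

/-- The action of the group of order two by signs. -/
def zmodTwoNegHom (V : Type*) [AddCommGroup V] [Module ℚ V] : Multiplicative (ZMod 2) →* (V ≃ₗ[ℚ] V) where
  toFun s := LinearEquiv.neg ℚ ^ s.toAdd.val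
  map_one' := by simp
  map_mul' s t := by
    have h2 : (LinearEquiv.neg ℚ : V ≃ₗ[ℚ] V) ^ 2 = 1 := by
      ext a
      simp [pow_two]
    rw [toAdd_mul, ZMod.val_add, ← pow_add]
    exact (pow_eq_pow_mod _ h2).symm

variable (L) in
/-- The monomial representation of `C₂ × (C_p ⋊ C)` on the cyclotomic field. -/
noncomputable def monomialRep {C : Type*} [Group C] (ε : C →* (ZMod p)ˣ) :
    Multiplicative (ZMod 2) × (Multiplicative (ZMod p) ⋊[(zmodUnitsMulAut p).comp ε] C) →*
      (L ≃ₗ[ℚ] L) :=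
  (zmodTwoNegHom L).noncommCoprod (SemidirectProduct.lift (cyclotomicRotationHom p L)
    ((cyclotomicAutHom p L).comp ε) (by
      intro g
      ext i a
      change cyclotomicChar p L (ε g * i) * a = cyclotomicAut p L (ε g)
        (cyclotomicChar p L i * (cyclotomicAut p L (ε g)).symm a)
      rw [map_mul (cyclotomicAut p L _), cyclotomicAut_char, AlgEquiv.apply_symm_apply])) (by
    intro s g
    refine Commute.pow_left ?_ _
    ext a
    simp)

theorem monomialRep_apply {C : Type*} [Group C] (ε : C →* (ZMod p)ˣ) (s : Multiplicative (ZMod 2))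
    (q : Multiplicative (ZMod p) ⋊[(zmodUnitsMulAut p).comp ε] C) (a : L) :
    monomialRep p L ε (s, q) a = zmodTwoNegHom L s
      (cyclotomicChar p L q.left.toAdd * cyclotomicAut p L (ε q.right) a) := rfl

theorem zmodTwoNegHom_eq (V : Type*) [AddCommGroup V] [Module ℚ V] (s : Multiplicative (ZMod 2)) :
    s = 1 ∧ zmodTwoNegHom V s = 1 ∨ s = .ofAdd 1 ∧ zmodTwoNegHom V s = LinearEquiv.neg ℚ := by
  obtain ⟨s, rfl⟩ := Multiplicative.ofAdd.surjective s
  fin_cases s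
  · exact .inl ⟨rfl, pow_zero _⟩
  · exact .inr ⟨rfl, pow_one _⟩

theorem monomialRep_injective (hodd : Odd p) {C : Type*} [Group C] {ε : C →* (ZMod p)ˣ}
    (hε : Function.Injective ε) : Function.Injective (monomialRep p L ε) := by
  rw [injective_iff_map_eq_one]
  rintro ⟨s, q⟩ h
  have h1 := LinearEquiv.congr_fun h 1
  rw [monomialRep_apply, map_one, mul_one] at h1
  have hs : s = 1 ∧ zmodTwoNegHom L s = 1 := by
    refine (zmodTwoNegHom_eq L s).resolve_right fun ⟨_, h2⟩ => ?_
    rw [h2] at h1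
    have h3 : cyclotomicChar p L q.left.toAdd = -1 := neg_eq_iff_eq_neg.1 h1
    have h4 : cyclotomicChar p L q.left.toAdd ^ p = 1 := by
      rw [← AddChar.map_nsmul_eq_pow, nsmul_eq_mul, CharP.cast_eq_zero, zero_mul,
        AddChar.map_zero_eq_one]
    rw [h3, hodd.neg_one_pow] at h4
    norm_num at h4
  rw [hs.2] at h1
  have hq : q.left = 1 := by
    have : cyclotomicChar p L q.left.toAdd = cyclotomicChar p L 0 := by
      rw [AddChar.map_zero_eq_one]; exact h1
    exact Multiplicative.toAdd.injective (cyclotomicChar_injective p this)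
  refine Prod.ext hs.1 (SemidirectProduct.ext hq (hε ((cyclotomicAut p L).injective ?_)))
  ext a
  have h2 := LinearEquiv.congr_fun h a
  rw [monomialRep_apply, hs.2, hq, toAdd_one, AddChar.map_zero_eq_one, one_mul] at h2
  simpa using h2

/-- An odd divisor of `p - 1` gives a subgroup of the Galois group without complex conjugation,
hence a totally imaginary element it fixes. -/
theorem exists_cyclotomicAut_neg_one_eq_neg {H : Subgroup (ZMod p)ˣ} (hH : -1 ∉ H) :
    ∃ θ : L, θ ≠ 0 ∧ cyclotomicAut p L (-1) θ = -θ ∧ ∀ k ∈ H, cyclotomicAut p L k θ = θ := by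
  have : FiniteDimensional ℚ L := IsCyclotomicExtension.finiteDimensional {p} ℚ L
  let H' : Subgroup (L ≃ₐ[ℚ] L) := H.map (cyclotomicAut p L).toMonoidHom
  have h1 : cyclotomicAut p L (-1) ∉ H' := by
    rintro ⟨k, hk, h⟩
    exact hH ((cyclotomicAut p L).injective h ▸ hk)
  rw [← IntermediateField.fixingSubgroup_fixedField H', IntermediateField.mem_fixingSubgroup_iff]
    at h1
  push Not at h1
  obtain ⟨y, hy, hne⟩ := h1
  refine ⟨y - cyclotomicAut p L (-1) y, sub_ne_zero.2 (Ne.symm hne), ?_, fun k hk => ?_⟩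
  · rw [map_sub, ← AlgEquiv.mul_apply, ← map_mul]
    simp
  · have hky : cyclotomicAut p L k y = y := hy ⟨_, k, hk, rfl⟩
    rw [map_sub, ← AlgEquiv.mul_apply, ← map_mul, mul_comm, map_mul, AlgEquiv.mul_apply, hky]

/-- In the normal case a maximal finite symplectic group is `C₂ × (C_p ⋊ C_o)`. -/
theorem mulEquiv_of_normal (hodd : Odd p) {a o : ℕ} (hfact : p - 1 = 2 ^ a * o) (ho : Odd o)
    {Γ : Subgroup (L ≃ₗ[ℚ] L)} [Finite Γ] (h1 : cyclotomicRotation p L 1 ∈ Γ)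
    (hmax : ∀ Δ : Subgroup (L ≃ₗ[ℚ] L), Finite Δ → IsSymplecticLinearGroup Δ → Γ ≤ Δ → Δ = Γ)
    {θ : L} (hθ0 : θ ≠ 0) (hθ : cyclotomicAut p L (-1) θ = -θ) {v : L} (hv : v ≠ 0)
    (hΓ : ∀ g ∈ Γ, ∃ k ∈ cyclotomicStabilizer p θ, ∃ i,
      (∀ a, g (v * a) = v * (cyclotomicChar p L i * cyclotomicAut p L k a)) ∨
      ∀ a, g (v * a) = -(v * (cyclotomicChar p L i * cyclotomicAut p L k a))) :
    ∃ φ : Multiplicative (ZMod o) →* MulAut (Multiplicative (ZMod p)),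
        Function.Injective φ ∧
        Nonempty (Γ ≃* (Multiplicative (ZMod 2) ×
          (Multiplicative (ZMod p) ⋊[φ] Multiplicative (ZMod o)))) := by
  have hcard : Nat.card (ZMod p)ˣ = 2 ^ a * o := by
    rw [Nat.card_eq_fintype_card, ZMod.card_units, hfact]
  let K : Subgroup (ZMod p)ˣ := (powMonoidHom o).ker
  have hKcard : Nat.card K = o := by
    rw [IsCyclic.card_powMonoidHom_ker, hcard, Nat.gcd_eq_right (Dvd.intro_left _ rfl)]
  have hK1 : -1 ∉ K := by
    intro h
    have h2 : (-1 : (ZMod p)ˣ) ^ o = 1 := h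
    rw [ho.neg_one_pow] at h2
    have : Fact (2 < p) := ⟨hp.out.two_le.lt_of_ne (by rintro rfl; exact absurd hodd (by decide))⟩
    have h3 := congrArg Units.val h2
    rw [Units.val_neg, Units.val_one] at h3
    exact ZMod.neg_one_ne_one h3
  have hHK : cyclotomicStabilizer p θ ≤ K := by
    intro k hk
    have hd : Nat.card (cyclotomicStabilizer p θ) ∣ o := by
      refine Nat.Coprime.dvd_of_dvd_mul_left (Nat.Coprime.pow_right a
        (Nat.coprime_two_right.2 (odd_card_cyclotomicStabilizer p hθ0 hθ))) ?_
      rw [← hcard]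
      exact (cyclotomicStabilizer p θ).card_subgroup_dvd_card
    have h2 : (⟨k, hk⟩ : cyclotomicStabilizer p θ) ^ o = 1 :=
      orderOf_dvd_iff_pow_eq_one.1 ((orderOf_dvd_natCard _).trans hd)
    exact congrArg Subtype.val h2
  let e : Multiplicative (ZMod o) ≃* K := mulEquivOfCyclicCardEq (by
    rw [hKcard, Nat.card_congr Multiplicative.toAdd, Nat.card_zmod])
  let ε : Multiplicative (ZMod o) →* (ZMod p)ˣ := K.subtype.comp e.toMonoidHom
  have hε : Function.Injective ε := K.subtype_injective.comp e.injective
  refine ⟨(zmodUnitsMulAut p).comp ε, (zmodUnitsMulAut_injective p).comp hε, ?_⟩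
  have : NeZero o := ⟨by rintro rfl; exact absurd ho (by decide)⟩
  have hfin : Finite (monomialRep p L ε).range := by
    have : Finite (Multiplicative (ZMod p) ⋊[(zmodUnitsMulAut p).comp ε] Multiplicative (ZMod o)) :=
      Finite.of_equiv _ SemidirectProduct.equivProd.symm
    exact Finite.of_surjective _ (monomialRep p L ε).rangeRestrict_surjective
  obtain ⟨η, hη0, hη, hηK⟩ := exists_cyclotomicAut_neg_one_eq_neg p (L := L) hK1
  let u := Units.mk0 v hv
  let c := MulAut.conj (DistribMulAction.toModuleAut ℚ L u)
  have heq := eq_map_conj_of_le p h1 hmax (Δ := (monomialRep p L ε).range) hη0 hη (by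
    rintro _ ⟨⟨s, q⟩, rfl⟩ a
    rw [monomialRep_apply, monomialRep_apply, map_mul (cyclotomicAut p L _),
      hηK (ε q.right) (e q.right).2]
    rcases zmodTwoNegHom_eq L s with h | h <;> rw [h.2]
    · exact mul_left_comm _ _ _
    · rw [LinearEquiv.neg_apply, LinearEquiv.neg_apply]; ring) u (by
    intro g hg
    obtain ⟨k, hk, i, hi⟩ := hΓ g hg
    have hik : ε (e.symm ⟨k, hHK hk⟩) = k := by
      change ((e (e.symm ⟨k, hHK hk⟩) : K) : (ZMod p)ˣ) = k
      rw [e.apply_symm_apply]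
    have key : ∀ s : Multiplicative (ZMod 2), (∀ a, g (v * a) = zmodTwoNegHom L s
        (v * (cyclotomicChar p L i * cyclotomicAut p L k a))) →
        g ∈ (monomialRep p L ε).range.map c.toMonoidHom := by
      intro s hs
      refine ⟨_, ⟨(s, ⟨.ofAdd i, e.symm ⟨k, hHK hk⟩⟩), rfl⟩, LinearEquiv.ext fun b => ?_⟩
      change v * monomialRep p L ε (s, ⟨.ofAdd i, e.symm ⟨k, hHK hk⟩⟩) (v⁻¹ * b) = g b
      rw [← mul_inv_cancel_left₀ hv b, hs, inv_mul_cancel_left₀ hv, monomialRep_apply, hik]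
      rcases zmodTwoNegHom_eq L s with h | h <;> rw [h.2]
      · rfl
      · exact mul_neg _ _
    rcases hi with hi | hi
    · exact key 1 fun a => by rw [map_one]; exact hi a
    · exact key (.ofAdd 1) fun a => by
        rw [((zmodTwoNegHom_eq L (.ofAdd 1)).resolve_left fun h => absurd h.1 (by decide)).2]
        exact hi a)
  have e1 := (monomialRep p L ε).ofInjective (monomialRep_injective p hodd hε)
  have e2 := Subgroup.equivMapOfInjective (monomialRep p L ε).range c.toMonoidHom c.injective
  exact ⟨((e1.trans e2).trans (MulEquiv.subgroupCongr heq)).symm⟩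

end

section

theorem sum_eq_zero_add_sum_units {F M : Type*} [Field F] [Fintype F] [DecidableEq F]
    [AddCommMonoid M] (f : F → M) : ∑ x, f x = f 0 + ∑ u : Fˣ, f u := by
  rw [Fintype.sum_eq_add_sum_compl 0]
  congr 1
  rw [← Equiv.sum_comp unitsEquivNeZero.symm]
  refine Finset.sum_subtype _ (fun x => ?_) _ |>.trans (Finset.sum_congr rfl fun x _ => ?_)
  · simp
  · exact congrArg f (congrArg Subtype.val (unitsEquivNeZero.apply_symm_apply x)).symm

variable (p : ℕ) [hp : Fact p.Prime] (L : Type*) [Field L] [CharZero L]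
  [IsCyclotomicExtension {p} ℚ L]

/-- The quadratic Gauss sum of the `p`-th cyclotomic field. -/
noncomputable def quadraticGaussSum : L :=
  gaussSum ((quadraticChar (ZMod p)).ringHomComp (Int.castRingHom L)) (cyclotomicChar p L)

variable {L}

theorem quadraticGaussSum_eq :
    quadraticGaussSum p L = ∑ x, (quadraticChar (ZMod p) x : L) * cyclotomicChar p L x := rfl

theorem isPrimitive_cyclotomicChar : (cyclotomicChar p L).IsPrimitive :=
  AddChar.zmod_char_primitive_of_eq_one_only_at_zero p _ fun _ ha =>
    cyclotomicChar_injective p (ha.trans (AddChar.map_zero_eq_one _).symm)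

theorem sum_quadraticChar_mul_cyclotomicChar {c : ZMod p} (hc : c ≠ 0) :
    ∑ x, (quadraticChar (ZMod p) x : L) * cyclotomicChar p L (c * x) =
      quadraticChar (ZMod p) c * quadraticGaussSum p L := by
  have h := gaussSum_mulShift ((quadraticChar (ZMod p)).ringHomComp (Int.castRingHom L))
    (cyclotomicChar p L) (Units.mk0 c hc)
  rw [quadraticGaussSum, ← h, ← mul_assoc]
  have h1 : (quadraticChar (ZMod p) c : L) *
      ((quadraticChar (ZMod p)).ringHomComp (Int.castRingHom L)) (Units.mk0 c hc : (ZMod p)ˣ) = 1 := by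
    have := quadraticChar_sq_one hc
    rw [sq] at this
    rw [MulChar.ringHomComp_apply, Units.val_mk0, eq_intCast]
    exact_mod_cast this
  rw [h1, one_mul]
  rfl

theorem cyclotomicAut_quadraticGaussSum (k : (ZMod p)ˣ) :
    cyclotomicAut p L k (quadraticGaussSum p L) =
      quadraticChar (ZMod p) k * quadraticGaussSum p L := by
  rw [← sum_quadraticChar_mul_cyclotomicChar p k.ne_zero, quadraticGaussSum_eq, map_sum]
  exact Finset.sum_congr rfl fun x _ => by
    rw [map_mul (cyclotomicAut p L k), map_intCast, cyclotomicAut_char]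

theorem quadraticChar_neg_one_eq_neg_one (hp3 : p % 4 = 3) : quadraticChar (ZMod p) (-1) = -1 := by
  rw [quadraticChar_neg_one_iff_not_isSquare, ZMod.exists_sq_eq_neg_one_iff]
  simpa using hp3

theorem quadraticGaussSum_sq (hp3 : p % 4 = 3) : quadraticGaussSum p L ^ 2 = -p := by
  have hp2 : ringChar (ZMod p) ≠ 2 := by
    rw [ZMod.ringChar_zmod_n]; rintro rfl; omega
  have h := gaussSum_sq (χ := (quadraticChar (ZMod p)).ringHomComp (Int.castRingHom L))
    ((MulChar.ringHomComp_ne_one_iff (RingHom.injective_int _)).2 (quadraticChar_ne_one hp2))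
    ((quadraticChar_isQuadratic (ZMod p)).comp _) (isPrimitive_cyclotomicChar p (L := L))
  rw [quadraticGaussSum, h, MulChar.ringHomComp_apply, quadraticChar_neg_one_eq_neg_one p hp3,
    ZMod.card]
  simp

theorem quadraticGaussSum_ne_zero (hp3 : p % 4 = 3) : quadraticGaussSum p L ≠ 0 := by
  intro h
  have := quadraticGaussSum_sq p (L := L) hp3
  rw [h] at this
  simp [hp.out.ne_zero] at this

theorem sum_cyclotomicChar_mul_sq (hp2 : p ≠ 2) {c : ZMod p} (hc : c ≠ 0) :
    ∑ t, cyclotomicChar p L (c * t ^ 2) = quadraticChar (ZMod p) c * quadraticGaussSum p L := by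
  have hp2' : ringChar (ZMod p) ≠ 2 := by rwa [ZMod.ringChar_zmod_n]
  rw [← sum_quadraticChar_mul_cyclotomicChar p hc,
    ← Finset.sum_fiberwise' Finset.univ (fun t : ZMod p => t ^ 2)
      (fun x => cyclotomicChar p L (c * x))]
  have h0 : ∑ x, cyclotomicChar p L (c * x) = 0 := by
    simp_rw [mul_comm c]
    rw [AddChar.sum_mulShift c (isPrimitive_cyclotomicChar p), if_neg hc, Nat.cast_zero]
  rw [← add_zero (∑ x, (quadraticChar (ZMod p) x : L) * _), ← h0, ← Finset.sum_add_distrib]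
  refine Finset.sum_congr rfl fun x _ => ?_
  have := quadraticChar_card_sqrts hp2' x
  rw [Finset.sum_const, nsmul_eq_mul, ← add_one_mul]
  congr 1
  rw [← Int.cast_one, ← Int.cast_add, ← this, Int.cast_natCast]
  congr 2
  ext t
  simp

theorem sum_cyclotomicChar_mul_sq_add (hp2 : p ≠ 2) {c : ZMod p} (hc : c ≠ 0) (b : ZMod p) :
    ∑ t, cyclotomicChar p L (c * t ^ 2 + 2 * t * b) =
      cyclotomicChar p L (-(b ^ 2 * c⁻¹)) * (quadraticChar (ZMod p) c * quadraticGaussSum p L) := by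
  rw [← sum_cyclotomicChar_mul_sq p hp2 hc, Finset.mul_sum,
    ← Equiv.sum_comp (Equiv.addRight (-(b * c⁻¹)))]
  refine Finset.sum_congr rfl fun t _ => ?_
  rw [← AddChar.map_add_eq_mul]
  congr 1
  simp only [Equiv.coe_addRight]
  field_simp
  ring

variable (L) in
/-- The restriction to the `p`-th cyclotomic field of the Weil operator. -/
noncomputable def weilMap : L →ₗ[ℚ] L where
  toFun a := (quadraticGaussSum p L)⁻¹ * ∑ t : (ZMod p)ˣ, (quadraticChar (ZMod p) t : L) *
    (cyclotomicChar p L (2 * t) * cyclotomicAut p L (t ^ 2) a)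
  map_add' a b := by simp only [map_add, mul_add, Finset.sum_add_distrib]
  map_smul' c a := by
    simp only [map_rat_smul, mul_smul_comm, ← Finset.smul_sum, RingHom.id_apply]

theorem weilMap_apply (a : L) : weilMap p L a = (quadraticGaussSum p L)⁻¹ *
    ∑ t : (ZMod p)ˣ, (quadraticChar (ZMod p) t : L) *
      (cyclotomicChar p L (2 * t) * cyclotomicAut p L (t ^ 2) a) := rfl

theorem cyclotomicAut_sq_quadraticGaussSum (k : (ZMod p)ˣ) :
    cyclotomicAut p L (k ^ 2) (quadraticGaussSum p L) = quadraticGaussSum p L := by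
  rw [cyclotomicAut_quadraticGaussSum, Units.val_pow_eq_pow_val, quadraticChar_sq_one' k.ne_zero,
    Int.cast_one, one_mul]

theorem weilMap_quadraticGaussSum_mul (a : L) :
    weilMap p L (quadraticGaussSum p L * a) = quadraticGaussSum p L * weilMap p L a := by
  rw [weilMap_apply, weilMap_apply, mul_left_comm, Finset.mul_sum _ _ (quadraticGaussSum p L)]
  congr 1
  refine Finset.sum_congr rfl fun t _ => ?_
  rw [map_mul (cyclotomicAut p L _), cyclotomicAut_sq_quadraticGaussSum]
  ring

theorem weilMap_cyclotomicAut_sq (k : (ZMod p)ˣ) (a : L) :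
    weilMap p L (cyclotomicAut p L (k ^ 2) a) =
      cyclotomicAut p L ((k ^ 2)⁻¹) (weilMap p L a) := by
  have hg : cyclotomicAut p L ((k ^ 2)⁻¹) (quadraticGaussSum p L) = quadraticGaussSum p L := by
    rw [← inv_pow, cyclotomicAut_sq_quadraticGaussSum]
  rw [weilMap_apply, weilMap_apply, map_mul (cyclotomicAut p L _), map_inv₀, hg, map_sum]
  congr 1
  rw [← Equiv.sum_comp (Equiv.mulLeft ((k ^ 2)⁻¹))]
  refine Finset.sum_congr rfl fun t _ => ?_
  rw [map_mul (cyclotomicAut p L _), map_mul (cyclotomicAut p L _), map_intCast,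
    cyclotomicAut_char, Equiv.coe_mulLeft, Units.val_mul, map_mul (quadraticChar (ZMod p)),
    ← inv_pow, Units.val_pow_eq_pow_val, quadraticChar_sq_one' (Units.ne_zero _), one_mul,
    ← AlgEquiv.mul_apply, ← map_mul (cyclotomicAut p L), ← AlgEquiv.mul_apply,
    ← map_mul (cyclotomicAut p L), mul_left_comm (2 : ZMod p)]
  congr 4
  rw [inv_pow, mul_pow, mul_right_comm]
  group

theorem sum_quadraticChar_mul_cyclotomicAut_sq (hp3 : p % 4 = 3) (a : L) :
    ∑ t : (ZMod p)ˣ, (quadraticChar (ZMod p) t : L) * cyclotomicAut p L (t ^ 2) a = 0 := by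
  have h : ∑ t : (ZMod p)ˣ, (quadraticChar (ZMod p) t : L) * cyclotomicAut p L (t ^ 2) a =
      -∑ t : (ZMod p)ˣ, (quadraticChar (ZMod p) t : L) * cyclotomicAut p L (t ^ 2) a := by
    rw [← Finset.sum_neg_distrib, ← Equiv.sum_comp (Equiv.neg (ZMod p)ˣ)]
    refine Finset.sum_congr rfl fun t _ => ?_
    rw [Equiv.neg_apply, neg_sq, Units.val_neg, ← neg_one_mul (t : ZMod p),
      map_mul (quadraticChar (ZMod p)), quadraticChar_neg_one_eq_neg_one p hp3]
    push_cast
    ring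
  exact self_eq_neg.1 h

theorem weilMap_cyclotomicChar_mul_weilMap (hp3 : p % 4 = 3) (c : ZMod p) (a : L) :
    weilMap p L (cyclotomicChar p L c * weilMap p L a) =
      ((quadraticGaussSum p L) ^ 2)⁻¹ * ∑ u : (ZMod p)ˣ, (quadraticChar (ZMod p) u : L) *
        (cyclotomicAut p L (u ^ 2) a *
          ∑ t, cyclotomicChar p L (c * t ^ 2 + 2 * t * (1 + u))) := by
  have hsum : ∀ u : (ZMod p)ˣ, ∑ t, cyclotomicChar p L (c * t ^ 2 + 2 * t * (1 + u)) =
      1 + ∑ t : (ZMod p)ˣ, cyclotomicChar p L (c * t ^ 2 + 2 * t * (1 + u)) := fun u => by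
    rw [sum_eq_zero_add_sum_units]
    simp
  simp_rw [hsum, mul_add, mul_one, Finset.sum_add_distrib,
    sum_quadraticChar_mul_cyclotomicAut_sq p hp3, zero_add, Finset.mul_sum]
  rw [Finset.sum_comm, weilMap_apply, Finset.mul_sum]
  refine Finset.sum_congr rfl fun t _ => ?_
  rw [weilMap_apply, map_mul (cyclotomicAut p L _), map_mul (cyclotomicAut p L _), map_inv₀,
    cyclotomicAut_sq_quadraticGaussSum, map_sum, Finset.mul_sum, Finset.mul_sum, Finset.mul_sum,
    Finset.mul_sum, Finset.mul_sum, ← Equiv.sum_comp (Equiv.mulLeft t⁻¹)]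
  refine Finset.sum_congr rfl fun u _ => ?_
  rw [map_mul (cyclotomicAut p L _), map_mul (cyclotomicAut p L _), map_intCast,
    cyclotomicAut_char, cyclotomicAut_char, ← AlgEquiv.mul_apply, ← map_mul (cyclotomicAut p L),
    Equiv.coe_mulLeft, ← mul_pow, mul_inv_cancel_left]
  have h1 : (quadraticChar (ZMod p) u : L) = quadraticChar (ZMod p) t *
      quadraticChar (ZMod p) ((t⁻¹ * u : (ZMod p)ˣ) : ZMod p) := by
    rw [← Int.cast_mul, ← map_mul (quadraticChar (ZMod p)), ← Units.val_mul, mul_inv_cancel_left]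
  have h2 : cyclotomicChar p L (c * t ^ 2 + (2 * t + 2 * t * u)) = cyclotomicChar p L (2 * t) *
      (cyclotomicChar p L ((t ^ 2 : (ZMod p)ˣ) * c) *
        cyclotomicChar p L ((t ^ 2 : (ZMod p)ˣ) * (2 * ((t⁻¹ * u : (ZMod p)ˣ) : ZMod p)))) := by
    rw [← AddChar.map_add_eq_mul, ← AddChar.map_add_eq_mul]
    congr 1
    push_cast
    have := t.ne_zero
    field_simp
    ring
  dsimp only
  rw [h1, h2]
  ring

theorem weilMap_weilMap (hp3 : p % 4 = 3) (a : L) : weilMap p L (weilMap p L a) = a := by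
  have hp2 : (2 : ZMod p) ≠ 0 := by
    intro h
    have := (ZMod.natCast_eq_zero_iff 2 p).1 (by exact_mod_cast h)
    have := Nat.le_of_dvd two_pos this
    interval_cases p <;> omega
  have h := weilMap_cyclotomicChar_mul_weilMap p hp3 0 a
  rw [AddChar.map_zero_eq_one, one_mul] at h
  rw [h, Finset.sum_eq_single (-1)]
  · have h1 : ∀ t : ZMod p, 0 * t ^ 2 + 2 * t * (1 + ((-1 : (ZMod p)ˣ) : ZMod p)) = 0 := fun t => by
      push_cast
      ring
    simp_rw [h1, AddChar.map_zero_eq_one]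
    rw [neg_one_sq, map_one, Units.val_neg, Units.val_one,
      quadraticChar_neg_one_eq_neg_one p hp3, quadraticGaussSum_sq p hp3]
    have hp0 : (p : L) ≠ 0 := Nat.cast_ne_zero.2 hp.out.ne_zero
    simp
    field_simp
  · intro u _ hu
    have h1 : ∀ t : ZMod p, 0 * t ^ 2 + 2 * t * (1 + (u : ZMod p)) = t * (2 * (1 + u)) :=
      fun t => by ring
    simp_rw [h1]
    rw [AddChar.sum_mulShift _ (isPrimitive_cyclotomicChar p), if_neg, Nat.cast_zero, mul_zero,
      mul_zero]
    refine mul_ne_zero hp2 fun h => hu (Units.ext ?_)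
    rw [Units.val_neg, Units.val_one]
    linear_combination h
  · simp

theorem weilMap_cyclotomicChar_mul_weilMap_of_ne_zero (hp3 : p % 4 = 3) (c : (ZMod p)ˣ) (a : L) :
    weilMap p L (cyclotomicChar p L c * weilMap p L a) =
      -(cyclotomicChar p L (-↑c⁻¹) *
        weilMap p L (cyclotomicAut p L (c ^ 2) (cyclotomicChar p L (-↑c⁻¹) * a))) := by
  have hp2 : p ≠ 2 := by rintro rfl; omega
  have hg := quadraticGaussSum_ne_zero p (L := L) hp3
  rw [weilMap_cyclotomicChar_mul_weilMap p hp3, weilMap_apply, Finset.mul_sum, Finset.mul_sum,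
    Finset.mul_sum, ← Finset.sum_neg_distrib, ← Equiv.sum_comp (Equiv.mulLeft (-c))]
  refine Finset.sum_congr rfl fun u _ => ?_
  rw [sum_cyclotomicChar_mul_sq_add p hp2 c.ne_zero, Equiv.coe_mulLeft,
    map_mul (cyclotomicAut p L _), map_mul (cyclotomicAut p L _), cyclotomicAut_char,
    cyclotomicAut_char, ← AlgEquiv.mul_apply, ← map_mul (cyclotomicAut p L)]
  have h1 : (quadraticChar (ZMod p) ((-c * u : (ZMod p)ˣ) : ZMod p) : L) =
      -(quadraticChar (ZMod p) c * quadraticChar (ZMod p) u) := by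
    rw [Units.val_mul, Units.val_neg, ← neg_one_mul (c : ZMod p), map_mul (quadraticChar (ZMod p)),
      map_mul (quadraticChar (ZMod p)), quadraticChar_neg_one_eq_neg_one p hp3]
    push_cast
    ring
  have h2 : (quadraticChar (ZMod p) c : L) * quadraticChar (ZMod p) c = 1 := by
    have := quadraticChar_sq_one c.ne_zero
    rw [sq] at this
    exact_mod_cast this
  have h3 : cyclotomicChar p L (-((1 + ((-c * u : (ZMod p)ˣ) : ZMod p)) ^ 2 * (c : ZMod p)⁻¹)) =
      cyclotomicChar p L (-↑c⁻¹) * cyclotomicChar p L (2 * u) *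
        cyclotomicChar p L ((u ^ 2 : (ZMod p)ˣ) * ((c ^ 2 : (ZMod p)ˣ) * -↑c⁻¹)) := by
    rw [← AddChar.map_add_eq_mul, ← AddChar.map_add_eq_mul]
    congr 1
    push_cast
    have := c.ne_zero
    field_simp
    ring
  have h4 : (-c * u) ^ 2 = u ^ 2 * c ^ 2 := by rw [mul_pow, neg_sq, mul_comm]
  rw [h1, h3, h4]
  have h5 : ((quadraticGaussSum p L) ^ 2)⁻¹ * quadraticGaussSum p L = (quadraticGaussSum p L)⁻¹ := by
    rw [sq, _root_.mul_inv_rev, mul_assoc, inv_mul_cancel₀ hg, mul_one]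
  generalize cyclotomicAut p L (u ^ 2 * c ^ 2) a = s
  generalize cyclotomicChar p L (-↑c⁻¹) = e₁
  generalize cyclotomicChar p L (2 * u) = e₂
  generalize cyclotomicChar p L ((u ^ 2 : (ZMod p)ˣ) * ((c ^ 2 : (ZMod p)ˣ) * -↑c⁻¹)) = e₃
  linear_combination (-(quadraticChar (ZMod p) u : L) * s * e₁ * e₂ * e₃) *
    ((quadraticChar (ZMod p) c : L) * quadraticChar (ZMod p) c * h5 +
      (quadraticGaussSum p L)⁻¹ * h2)

end

section

variable (p : ℕ) [hp : Fact p.Prime]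

open scoped Pointwise in
/-- A group generated by elements satisfying the relations between the translations, dilations and
the Fourier transform in the Weil representation of `SL₂(p)` is finite. -/
theorem finite_closure_of_weil_relations {E Z : Type*} [Group E] [Group Z] [Finite Z] {N : Z →* E}
    {X : ZMod p → E} {σ : (ZMod p)ˣ →* E} {T : E} {z : Z} (hN : ∀ s g, N s * g = g * N s)
    (hX : ∀ i j, X i * X j = X (i + j)) (hσX : ∀ k i, σ k * X i = X (k * i) * σ k)
    (hT : T * T = 1) (hTσ : ∀ k, T * σ (k ^ 2) = σ ((k ^ 2)⁻¹) * T)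
    (hTX : ∀ c : (ZMod p)ˣ, T * X c * T = N z * X (-↑c⁻¹) * T * σ (c ^ 2) * X (-↑c⁻¹)) :
    Finite (Subgroup.closure
      ({T} ∪ Set.range N ∪ Set.range X ∪ Set.range fun k => σ (k ^ 2))) := by
  have hX0 : X 0 = 1 := by
    have := hX 0 0
    rwa [add_zero, mul_eq_left] at this
  let A : Z × ZMod p × (ZMod p)ˣ → E := fun q => N q.1 * X q.2.1 * σ (q.2.2 ^ 2)
  let B : Z × ZMod p × (ZMod p)ˣ × ZMod p → E := fun q =>
    N q.1 * X q.2.1 * σ (q.2.2.1 ^ 2) * T * X q.2.2.2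
  let S : Set E := Set.range A ∪ Set.range B
  have hfin : S.Finite := (Set.finite_range A).union (Set.finite_range B)
  have hAS : ∀ s i k, N s * X i * σ (k ^ 2) ∈ S := fun s i k => Or.inl ⟨(s, i, k), rfl⟩
  have hBS : ∀ s i k j, N s * X i * σ (k ^ 2) * T * X j ∈ S :=
    fun s i k j => Or.inr ⟨(s, i, k, j), rfl⟩
  have h1S : (1 : E) ∈ S := by simpa [hX0] using hAS 1 0 1
  have hTS : T ∈ S := by simpa [hX0] using hBS 1 0 1 0
  have hNS : ∀ s, ∀ g ∈ S, N s * g ∈ S := by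
    rintro s _ (⟨⟨s', i, k⟩, rfl⟩ | ⟨⟨s', i, k, j⟩, rfl⟩)
    · simpa only [A, map_mul, mul_assoc] using hAS (s * s') i k
    · simpa only [B, map_mul, mul_assoc] using hBS (s * s') i k j
  have hXS : ∀ i, ∀ g ∈ S, X i * g ∈ S := by
    rintro i' _ (⟨⟨s, i, k⟩, rfl⟩ | ⟨⟨s, i, k, j⟩, rfl⟩)
    · have h : X i' * A (s, i, k) = N s * X (i' + i) * σ (k ^ 2) := by
        simp only [A, ← hX, ← mul_assoc, hN]
      exact h ▸ hAS s _ k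
    · have h : X i' * B (s, i, k, j) = N s * X (i' + i) * σ (k ^ 2) * T * X j := by
        simp only [B, ← hX, ← mul_assoc, hN]
      exact h ▸ hBS s _ k j
  have hσS : ∀ k, ∀ g ∈ S, σ (k ^ 2) * g ∈ S := by
    rintro k' _ (⟨⟨s, i, k⟩, rfl⟩ | ⟨⟨s, i, k, j⟩, rfl⟩)
    · have h : σ (k' ^ 2) * A (s, i, k) =
          N s * X ((k' ^ 2 : (ZMod p)ˣ) * i) * σ ((k' * k) ^ 2) := by
        simp only [A, ← mul_assoc, ← hN, mul_pow, map_mul]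
        rw [mul_assoc (N s) (σ _), hσX, ← mul_assoc]
      exact h ▸ hAS s _ _
    · have h : σ (k' ^ 2) * B (s, i, k, j) =
          N s * X ((k' ^ 2 : (ZMod p)ˣ) * i) * σ ((k' * k) ^ 2) * T * X j := by
        simp only [B, ← mul_assoc, ← hN, mul_pow, map_mul]
        rw [mul_assoc (N s) (σ _), hσX, ← mul_assoc]
      exact h ▸ hBS s _ _ j
  have hSX : ∀ j, ∀ g ∈ S, g * X j ∈ S := by
    rintro j' _ (⟨⟨s, i, k⟩, rfl⟩ | ⟨⟨s, i, k, j⟩, rfl⟩)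
    · have h : A (s, i, k) * X j' = N s * X (i + (k ^ 2 : (ZMod p)ˣ) * j') * σ (k ^ 2) := by
        simp only [A, ← hX, mul_assoc, hσX]
      exact h ▸ hAS s _ k
    · have h : B (s, i, k, j) * X j' = N s * X i * σ (k ^ 2) * T * X (j + j') := by
        simp only [B, ← hX, mul_assoc]
      exact h ▸ hBS s i k _
  have hTA : ∀ i k, T * (X i * σ (k ^ 2)) ∈ S := fun i k => by
    have h : T * (X i * σ (k ^ 2)) =
        σ (k⁻¹ ^ 2) * (T * X (((k ^ 2)⁻¹ : (ZMod p)ˣ) * i)) := by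
      rw [inv_pow, ← mul_assoc (σ _), ← hTσ, mul_assoc, hσX, Units.mul_inv_cancel_left]
    exact h ▸ hσS _ _ (hSX _ _ hTS)
  have hTB : ∀ i k j, T * (X i * σ (k ^ 2) * T * X j) ∈ S := fun i k j => by
    have h : T * (X i * σ (k ^ 2) * T * X j) = T * X i * T * σ (k⁻¹ ^ 2) * X j := by
      have := hTσ k⁻¹
      rw [inv_pow, inv_inv] at this
      rw [inv_pow, mul_assoc _ T (σ _), this]
      simp only [mul_assoc]
    rw [h]
    refine hSX _ _ ?_
    obtain rfl | hi := eq_or_ne i 0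
    · rw [hX0, mul_one, hT, one_mul, ← mul_one (σ _)]
      exact hσS _ _ h1S
    · have h2 := hTX (Units.mk0 i hi)
      rw [Units.val_mk0] at h2
      rw [h2]
      generalize Units.mk0 i hi = c
      have h3 : N z * X (-↑c⁻¹) * T * σ (c ^ 2) * X (-↑c⁻¹) * σ (k⁻¹ ^ 2) =
          N z * (X (-↑c⁻¹) *
            (T * (X ((c ^ 2 : (ZMod p)ˣ) * -↑c⁻¹) * σ ((c * k⁻¹) ^ 2)))) := by
        rw [mul_pow, map_mul σ, ← mul_assoc (X (_ * _)), ← hσX]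
        simp only [mul_assoc]
      exact h3 ▸ hNS _ _ (hXS _ _ (hTA _ _))
  have hTmulS : ∀ g ∈ S, T * g ∈ S := by
    rintro _ (⟨⟨s, i, k⟩, rfl⟩ | ⟨⟨s, i, k, j⟩, rfl⟩)
    · have h : T * A (s, i, k) = N s * (T * (X i * σ (k ^ 2))) := by
        simp only [A, mul_assoc, hN]
      exact h ▸ hNS _ _ (hTA _ _)
    · have h : T * B (s, i, k, j) = N s * (T * (X i * σ (k ^ 2) * T * X j)) := by
        simp only [B, mul_assoc, hN]
      exact h ▸ hNS _ _ (hTB _ _ _)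
  have hle : Subgroup.closure ({T} ∪ Set.range N ∪ Set.range X ∪ Set.range fun k => σ (k ^ 2)) ≤
      MulAction.stabilizer E S := by
    rw [Subgroup.closure_le]
    intro g hg
    rw [SetLike.mem_coe, MulAction.mem_stabilizer_set_iff_smul_set_subset hfin]
    rintro _ ⟨f, hf, rfl⟩
    obtain ((rfl | ⟨s, rfl⟩) | ⟨i, rfl⟩) | ⟨k, rfl⟩ := hg
    exacts [hTmulS f hf, hNS s f hf, hXS i f hf, hσS k f hf]
  refine Set.Finite.to_subtype (hfin.subset fun g hg => ?_)
  have h := Set.smul_mem_smul_set (a := g) h1S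
  rwa [MulAction.mem_stabilizer_iff.1 (hle hg), smul_eq_mul, mul_one] at h

variable {L : Type*} [Field L] [CharZero L] [IsCyclotomicExtension {p} ℚ L]

variable (L) in
/-- The Weil operator as a linear automorphism. -/
noncomputable def weilEquiv (hp3 : p % 4 = 3) : L ≃ₗ[ℚ] L :=
  LinearEquiv.ofInvolutive (weilMap p L) (weilMap_weilMap p hp3)

theorem finite_closure_weilEquiv (hp3 : p % 4 = 3) : Finite (Subgroup.closure
    ({weilEquiv p L hp3} ∪ Set.range (zmodTwoNegHom L) ∪ Set.range (cyclotomicRotation p L) ∪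
      Set.range fun k => cyclotomicAutHom p L (k ^ 2))) := by
  refine finite_closure_of_weil_relations p (z := .ofAdd 1) (fun s g => ?_) (fun i j => ?_)
    (fun k i => ?_) ?_ (fun k => ?_) fun c => ?_
  · obtain ⟨-, h⟩ | ⟨-, h⟩ := zmodTwoNegHom_eq L s <;> rw [h] <;> ext a <;> simp
  · ext a
    simp [AddChar.map_add_eq_mul, mul_assoc]
  · ext a
    simp [cyclotomicAutHom, cyclotomicAut_char]
  · ext a
    exact weilMap_weilMap p hp3 a
  · ext a
    exact weilMap_cyclotomicAut_sq p k a
  · ext a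
    exact weilMap_cyclotomicChar_mul_weilMap_of_ne_zero p hp3 c a

/-- For `p ≡ 3 (mod 4)` the group generated by a rotation of order `p` is not normal in a maximal
finite symplectic group. -/
theorem not_normal_of_mod_four_eq_three (hp5 : 5 ≤ p) (hp3 : p % 4 = 3)
    {Γ : Subgroup (L ≃ₗ[ℚ] L)} [Finite Γ] (h1 : cyclotomicRotation p L 1 ∈ Γ)
    (hmax : ∀ Δ : Subgroup (L ≃ₗ[ℚ] L), Finite Δ → IsSymplecticLinearGroup Δ → Γ ≤ Δ → Δ = Γ)
    {θ : L} (hθ0 : θ ≠ 0) (hθ : cyclotomicAut p L (-1) θ = -θ) {v : L} (hv : v ≠ 0)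
    (hΓ : ∀ g ∈ Γ, ∃ k ∈ cyclotomicStabilizer p θ, ∃ i,
      (∀ a, g (v * a) = v * (cyclotomicChar p L i * cyclotomicAut p L k a)) ∨
      ∀ a, g (v * a) = -(v * (cyclotomicChar p L i * cyclotomicAut p L k a))) : False := by
  set Δ := Subgroup.closure
    ({weilEquiv p L hp3} ∪ Set.range (zmodTwoNegHom L) ∪ Set.range (cyclotomicRotation p L) ∪
      Set.range fun k => cyclotomicAutHom p L (k ^ 2)) with hΔ
  have hfin : Finite Δ := finite_closure_weilEquiv p hp3
  have hT : weilEquiv p L hp3 ∈ Δ := Subgroup.subset_closure (by simp)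
  have hN : ∀ s, zmodTwoNegHom L s ∈ Δ := fun s => Subgroup.subset_closure (by simp)
  have hX : ∀ i, cyclotomicRotation p L i ∈ Δ := fun i => Subgroup.subset_closure (by simp)
  have hσ : ∀ k, cyclotomicAutHom p L (k ^ 2) ∈ Δ := fun k => Subgroup.subset_closure (by simp)
  have hg0 := quadraticGaussSum_ne_zero p (L := L) hp3
  have hcomm : ∀ g ∈ Δ, ∀ a, g (quadraticGaussSum p L * a) = quadraticGaussSum p L * g a := by
    intro g hg a
    have hle : Δ ≤ Subgroup.centralizer
        {DistribMulAction.toModuleAut ℚ L (Units.mk0 (quadraticGaussSum p L) hg0)} := by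
      rw [hΔ, Subgroup.closure_le]
      intro f hf
      rw [SetLike.mem_coe, Subgroup.mem_centralizer_singleton_iff]
      ext b
      obtain ((rfl | ⟨s, rfl⟩) | ⟨i, rfl⟩) | ⟨k, rfl⟩ := hf
      · exact weilMap_quadraticGaussSum_mul p b
      · obtain ⟨-, h⟩ | ⟨-, h⟩ := zmodTwoNegHom_eq L s <;> rw [h] <;> simp
      · exact mul_left_comm _ _ _
      · exact (map_mul (cyclotomicAut p L (k ^ 2)) _ _).trans
          (by rw [Units.val_mk0, cyclotomicAut_sq_quadraticGaussSum]; rfl)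
    exact LinearEquiv.congr_fun (Subgroup.mem_centralizer_singleton_iff.1 (hle hg)) a
  have hodd := odd_card_cyclotomicStabilizer p hθ0 hθ
  have hle : Γ ≤ Δ.map
      (MulAut.conj (DistribMulAction.toModuleAut ℚ L (Units.mk0 v hv))).toMonoidHom := by
    intro g hg
    obtain ⟨k, hk, i, h⟩ := hΓ g hg
    obtain ⟨d, hd⟩ := hodd
    have hk2 : k = (k ^ (d + 1)) ^ 2 := by
      have h := congrArg Subtype.val (pow_card_eq_one' (x := (⟨k, hk⟩ : cyclotomicStabilizer p θ)))
      rw [hd, SubmonoidClass.coe_pow, OneMemClass.coe_one] at h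
      rw [← pow_mul, show (d + 1) * 2 = 2 * d + 1 + 1 by ring, pow_succ, h, one_mul]
    have hk3 : cyclotomicAutHom p L k ∈ Δ := by
      rw [hk2]
      exact hσ _
    have hav : ∀ a, v * (v⁻¹ * a) = a := mul_inv_cancel_left₀ hv
    obtain h | h := h
    · refine ⟨_, mul_mem (hX i) hk3, LinearEquiv.ext fun a => ?_⟩
      conv_rhs => rw [← hav a, h]
      rfl
    · refine ⟨_, mul_mem (hN (.ofAdd 1)) (mul_mem (hX i) hk3), LinearEquiv.ext fun a => ?_⟩
      have hneg : zmodTwoNegHom L (.ofAdd 1) = LinearEquiv.neg ℚ := by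
        obtain ⟨h, -⟩ | ⟨-, h⟩ := zmodTwoNegHom_eq L (.ofAdd 1)
        · exact absurd h (by decide)
        · exact h
      conv_rhs => rw [← hav a, h, ← mul_neg]
      rw [hneg]
      rfl
  have heq := eq_map_conj_of_le p h1 hmax hg0
    (by rw [cyclotomicAut_quadraticGaussSum]; simp [quadraticChar_neg_one_eq_neg_one p hp3])
    hcomm (Units.mk0 v hv) hle
  have hTΓ := heq.le (Subgroup.mem_map_of_mem _ hT)
  obtain ⟨k, -, i, h⟩ := hΓ _ hTΓ
  have hTv : ∀ a, MulAut.conj (DistribMulAction.toModuleAut ℚ L (Units.mk0 v hv))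
      (weilEquiv p L hp3) (v * a) = v * weilMap p L a := fun a =>
    congrArg (fun b => v * weilMap p L b) (inv_mul_cancel_left₀ hv a)
  obtain ⟨c, hc⟩ : ∃ c, ∀ a, weilMap p L a = c * cyclotomicAut p L k a := by
    obtain h | h := h
    · refine ⟨cyclotomicChar p L i, fun a => mul_left_cancel₀ hv ?_⟩
      exact (hTv a).symm.trans (h a)
    · refine ⟨-cyclotomicChar p L i, fun a => mul_left_cancel₀ hv ?_⟩
      rw [neg_mul, mul_neg]
      exact (hTv a).symm.trans (h a)
  have hrel : ∀ a, weilMap p L (cyclotomicChar p L 1 * weilMap p L a) =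
      -(cyclotomicChar p L (-1) * weilMap p L (cyclotomicChar p L (-1) * a)) := fun a => by
    simpa using weilMap_cyclotomicChar_mul_weilMap_of_ne_zero p hp3 1 a
  have hmul : ∀ j a, weilMap p L (cyclotomicChar p L j * a) =
      cyclotomicChar p L (k * j) * weilMap p L a := fun j a => by
    rw [hc, hc, map_mul (cyclotomicAut p L k), cyclotomicAut_char, mul_left_comm]
  have hm : ∀ a, weilMap p L a = -cyclotomicChar p L (1 + k + k) * a := fun a => by
    have h := hrel a
    rw [hmul, hmul, weilMap_weilMap p hp3, mul_one] at h
    rw [AddChar.map_add_eq_mul, neg_mul, mul_assoc, h, mul_neg, neg_neg, ← mul_assoc, ← mul_assoc,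
      ← AddChar.map_add_eq_mul, ← AddChar.map_add_eq_mul]
    simp
  generalize -cyclotomicChar p L (1 + k + k) = m at hm
  have h2 : m * m = 1 := by
    have h := weilMap_weilMap p hp3 (1 : L)
    rwa [hm, hm, mul_one] at h
  have h3 : m = -cyclotomicChar p L 3 := by
    have h := hrel 1
    rw [hm, hm, hm, mul_one, mul_one, mul_left_comm, h2, mul_one] at h
    have h1 : cyclotomicChar p L (-1) * cyclotomicChar p L 1 = 1 := by
      rw [← AddChar.map_add_eq_mul, neg_add_cancel, AddChar.map_zero_eq_one]
    rw [show (3 : ZMod p) = 1 + 1 + 1 by norm_num, AddChar.map_add_eq_mul, AddChar.map_add_eq_mul]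
    linear_combination (cyclotomicChar p L 1) ^ 2 * h -
      m * (cyclotomicChar p L (-1) * cyclotomicChar p L 1 + 1) * h1
  rw [h3, neg_mul_neg, ← AddChar.map_add_eq_mul, ← AddChar.map_zero_eq_one (cyclotomicChar p L)] at h2
  have h6 := cyclotomicChar_injective p h2
  have h7 : ((6 : ℕ) : ZMod p) = 0 := by
    push_cast
    rw [← h6]
    norm_num
  have h8 := (ZMod.natCast_eq_zero_iff 6 p).1 h7
  have h9 := Nat.le_of_dvd (by norm_num) h8
  omega

end

section

variable (p : ℕ) [hp : Fact p.Prime] {L : Type*} [Field L] [CharZero L]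
  [IsCyclotomicExtension {p} ℚ L]

theorem neg_mem_of_maximal {Γ : Subgroup (L ≃ₗ[ℚ] L)} [Finite Γ]
    (h1 : cyclotomicRotation p L 1 ∈ Γ)
    (hmax : ∀ Δ : Subgroup (L ≃ₗ[ℚ] L), Finite Δ → IsSymplecticLinearGroup Δ → Γ ≤ Δ → Δ = Γ)
    {θ : L} (hθ0 : θ ≠ 0) (hθ : cyclotomicAut p L (-1) θ = -θ)
    (hcomm : ∀ g ∈ Γ, ∀ a, g (θ * a) = θ * g a) : LinearEquiv.neg ℚ ∈ Γ := by
  have hN : ∀ s (g : L ≃ₗ[ℚ] L), Commute (zmodTwoNegHom L s) g := fun s g => by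
    obtain ⟨-, h⟩ | ⟨-, h⟩ := zmodTwoNegHom_eq L s <;> rw [h]
    · exact Commute.one_left g
    · ext a
      simp
  let f := MonoidHom.noncommCoprod (zmodTwoNegHom L) Γ.subtype fun s g => hN s g
  have hf : ∀ s (g : Γ), f (s, g) = zmodTwoNegHom L s * g := fun _ _ => rfl
  have hle : Γ ≤ f.range := fun g hg => ⟨(1, ⟨g, hg⟩), by rw [hf, map_one, one_mul]⟩
  have hfin : Finite f.range := Finite.of_surjective _ f.rangeRestrict_surjective
  have heq := hmax f.range hfin
    ((isSymplecticLinearGroup_iff_exists_mul p (hle h1)).2 ⟨θ, hθ0, hθ, by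
      rintro _ ⟨⟨s, g⟩, rfl⟩ a
      obtain ⟨-, h⟩ | ⟨-, h⟩ := zmodTwoNegHom_eq L s <;> simp [hf, h, hcomm g g.2]⟩) hle
  rw [← heq]
  refine ⟨(.ofAdd 1, 1), ?_⟩
  obtain ⟨h, -⟩ | ⟨-, h⟩ := zmodTwoNegHom_eq L (.ofAdd 1)
  · exact absurd h (by decide)
  · rw [hf, h, OneMemClass.coe_one, mul_one]

/-- The structure of the maximal finite symplectic groups on the `p`-th cyclotomic field which
contain the rotations. -/
theorem mulEquiv_of_maximal (hp5 : 5 ≤ p) {a o : ℕ} (hfact : p - 1 = 2 ^ a * o) (ho : Odd o)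
    {Γ : Subgroup (L ≃ₗ[ℚ] L)} [Finite Γ] (h1 : cyclotomicRotation p L 1 ∈ Γ)
    (hsymp : IsSymplecticLinearGroup Γ)
    (hmax : ∀ Δ : Subgroup (L ≃ₗ[ℚ] L), Finite Δ → IsSymplecticLinearGroup Δ → Γ ≤ Δ → Δ = Γ) :
    (p % 4 = 1 →
      ∃ φ : Multiplicative (ZMod o) →* MulAut (Multiplicative (ZMod p)),
        Function.Injective φ ∧
        Nonempty (Γ ≃* (Multiplicative (ZMod 2) ×
          (Multiplicative (ZMod p) ⋊[φ] Multiplicative (ZMod o))))) ∧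
    (p % 4 = 3 →
      Nonempty (Γ ≃* (Multiplicative (ZMod 2) ×
        Matrix.ProjectiveSpecialLinearGroup (Fin 2) (ZMod p)))) := by
  have hodd : Odd p := hp.out.odd_of_ne_two (by omega)
  obtain ⟨θ, hθ0, hθ, hcomm⟩ := (isSymplecticLinearGroup_iff_exists_mul p h1).1 hsymp
  have hneg := neg_mem_of_maximal p h1 hmax hθ0 hθ hcomm
  by_cases hnorm : ∀ g : Γ, ∃ i : ℕ,
      g * ⟨cyclotomicRotation p L 1, h1⟩ * g⁻¹ = (⟨cyclotomicRotation p L 1, h1⟩ : Γ) ^ i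
  · obtain ⟨v, hv, hΓ⟩ := exists_apply_mul_eq_of_normal p hodd rfl hθ0 hθ hcomm hnorm
    exact ⟨fun _ => mulEquiv_of_normal p hodd hfact ho h1 hmax hθ0 hθ hv hΓ,
      fun hp3 => (not_normal_of_mod_four_eq_three p hp5 hp3 h1 hmax hθ0 hθ hv hΓ).elim⟩
  · push Not at hnorm
    obtain ⟨hp3, h⟩ := mulEquiv_of_not_normal p hp5 (x := ⟨cyclotomicRotation p L 1, h1⟩)
      (z := ⟨_, hneg⟩) rfl rfl hθ0 hθ hcomm hnorm
    exact ⟨fun hp1 => by omega, fun _ => h⟩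

end

section Transport

open Polynomial

/-- A rational matrix of size `p - 1` and order `p` has characteristic polynomial `Φ_p`. -/
theorem charpoly_eq_cyclotomic_of_pow_eq_one {p : ℕ} [hp : Fact p.Prime]
    {M : Matrix (Fin (p - 1)) (Fin (p - 1)) ℚ} (h : M ^ p = 1) (h1 : M ≠ 1) :
    M.charpoly = cyclotomic p ℚ := by
  have hirr : Irreducible (cyclotomic p ℚ) := cyclotomic.irreducible_rat hp.out.pos
  have hdvd : minpoly ℚ M ∣ cyclotomic p ℚ * (X - 1) := by
    rw [cyclotomic_prime_mul_X_sub_one]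
    exact minpoly.dvd ℚ M (by simp [h])
  have hΦ : cyclotomic p ℚ ∣ minpoly ℚ M := by
    by_contra hnd
    have hcop : IsCoprime (minpoly ℚ M) (cyclotomic p ℚ) :=
      (hirr.coprime_iff_not_dvd.2 hnd).symm
    obtain ⟨q, hq⟩ := hcop.dvd_of_dvd_mul_left hdvd
    have h0 : aeval M (X - 1 : ℚ[X]) = 0 := by
      rw [hq, map_mul, minpoly.aeval, zero_mul]
    exact h1 (sub_eq_zero.1 (by simpa using h0))
  refine eq_of_monic_of_dvd_of_natDegree_le (cyclotomic.monic p ℚ) M.charpoly_monic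
    (hΦ.trans (Matrix.minpoly_dvd_charpoly M)) ?_
  rw [Matrix.charpoly_natDegree_eq_dim, natDegree_cyclotomic, Nat.totient_prime hp.out,
    Fintype.card_fin]

/-- The rational representation of dimension `p - 1` given by a matrix of order `p` is the
regular representation of the `p`-th cyclotomic field. -/
theorem exists_linearEquiv_mulVec_eq (p : ℕ) [hp : Fact p.Prime] (L : Type*) [Field L]
    [CharZero L] [IsCyclotomicExtension {p} ℚ L]
    {M : Matrix (Fin (p - 1)) (Fin (p - 1)) ℚ} (h : M ^ p = 1) (h1 : M ≠ 1) :
    ∃ e : L ≃ₗ[ℚ] (Fin (p - 1) → ℚ), ∀ a, e (cyclotomicChar p L 1 * a) = M *ᵥ e a := by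
  have hζ := isPrimitiveRoot_cyclotomicChar_one (L := L) p
  have hroot : aeval M (minpoly ℚ (hζ.powerBasis ℚ).gen) = 0 := by
    rw [IsPrimitiveRoot.powerBasis_gen, ← cyclotomic_eq_minpoly_rat hζ hp.out.pos,
      ← charpoly_eq_cyclotomic_of_pow_eq_one h h1, Matrix.aeval_self_charpoly]
  let ψ : L →ₐ[ℚ] Matrix (Fin (p - 1)) (Fin (p - 1)) ℚ := (hζ.powerBasis ℚ).lift M hroot
  have hψ : ψ (cyclotomicChar p L 1) = M := by
    have := (hζ.powerBasis ℚ).lift_gen M hroot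
    rwa [IsPrimitiveRoot.powerBasis_gen] at this
  have hp1 : 0 < p - 1 := Nat.sub_pos_of_lt hp.out.one_lt
  let u : Fin (p - 1) → ℚ := fun _ => 1
  have hu : u ≠ 0 := fun h0 => one_ne_zero (congrFun h0 ⟨0, hp1⟩)
  let f : L →ₗ[ℚ] (Fin (p - 1) → ℚ) :=
    { toFun := fun a => ψ a *ᵥ u
      map_add' := fun a b => by rw [map_add, Matrix.add_mulVec]
      map_smul' := fun c a => by
        rw [_root_.map_smul, Matrix.smul_mulVec, RingHom.id_apply] }
  have hf : Function.Injective f := by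
    refine (injective_iff_map_eq_zero f).2 fun a ha => by_contra fun ha0 => hu ?_
    have h2 : ψ a⁻¹ *ᵥ (ψ a *ᵥ u) = u := by
      rw [Matrix.mulVec_mulVec, ← map_mul ψ, inv_mul_cancel₀ ha0, map_one, Matrix.one_mulVec]
    have h3 : ψ a *ᵥ u = 0 := ha
    rw [← h2, h3, Matrix.mulVec_zero]
  have : FiniteDimensional ℚ L := IsCyclotomicExtension.finiteDimensional {p} ℚ L
  have hrank : Module.finrank ℚ L = Module.finrank ℚ (Fin (p - 1) → ℚ) := by
    rw [IsCyclotomicExtension.finrank L (cyclotomic.irreducible_rat hp.out.pos),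
      Nat.totient_prime hp.out, Module.finrank_fin_fun]
  refine ⟨LinearEquiv.ofInjectiveOfFinrankEq f hf hrank, fun a => ?_⟩
  change ψ (cyclotomicChar p L 1 * a) *ᵥ u = M *ᵥ (ψ a *ᵥ u)
  rw [map_mul ψ, hψ, Matrix.mulVec_mulVec]

variable {V : Type*} [AddCommGroup V] [Module ℚ V] {m : ℕ}

/-- Invertible matrices as automorphisms of a vector space with chosen coordinates. -/
noncomputable def glEquivOfCoordinates (e : V ≃ₗ[ℚ] (Fin m → ℚ)) :
    GL (Fin m) ℚ ≃* (V ≃ₗ[ℚ] V) :=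
  (Matrix.GeneralLinearGroup.toLin.trans
    (LinearMap.GeneralLinearGroup.congrLinearEquiv e.symm)).trans
    (LinearMap.GeneralLinearGroup.generalLinearEquiv ℚ V)

theorem apply_glEquivOfCoordinates (e : V ≃ₗ[ℚ] (Fin m → ℚ)) (g : GL (Fin m) ℚ) (a : V) :
    e (glEquivOfCoordinates e g a) = (g : Matrix (Fin m) (Fin m) ℚ) *ᵥ e a := by
  rw [← e.eq_symm_apply]
  rfl

theorem mul_mul_transpose_eq_iff {A g : Matrix (Fin m) (Fin m) ℚ} (hA : IsUnit A)
    (hg : IsUnit g) : g * A * gᵀ = A ↔ gᵀ * A⁻¹ * g = A⁻¹ := by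
  have hA' := (Matrix.isUnit_iff_isUnit_det A).1 hA
  have hg' := (Matrix.isUnit_iff_isUnit_det g).1 hg
  constructor
  · intro h
    have h1 : A⁻¹ * (g * A * gᵀ) = 1 := by rw [h, Matrix.nonsing_inv_mul A hA']
    have h2 : gᵀ * (A⁻¹ * g * A) = 1 := by
      apply mul_eq_one_comm.1
      rw [← h1]
      simp only [mul_assoc]
    calc gᵀ * A⁻¹ * g = gᵀ * (A⁻¹ * g * A) * A⁻¹ := by
          simp only [mul_assoc, Matrix.mul_nonsing_inv A hA', mul_one]
      _ = A⁻¹ := by rw [h2, one_mul]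
  · intro h
    have h1 : (gᵀ * A⁻¹ * g) * A = 1 := by rw [h, Matrix.nonsing_inv_mul A hA']
    have h2 : (A⁻¹ * g * A) * gᵀ = 1 := by
      apply mul_eq_one_comm.1
      rw [← h1]
      simp only [mul_assoc]
    calc g * A * gᵀ = A * ((A⁻¹ * g * A) * gᵀ) := by
          simp only [← mul_assoc, Matrix.mul_nonsing_inv A hA', one_mul]
      _ = A := by rw [h2, mul_one]

theorem IsSymplecticGroup.map_glEquivOfCoordinates (e : V ≃ₗ[ℚ] (Fin m → ℚ))
    {H : Subgroup (GL (Fin m) ℚ)} (hH : IsSymplecticGroup H) :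
    IsSymplecticLinearGroup (H.map (glEquivOfCoordinates e).toMonoidHom) := by
  obtain ⟨A, hskew, hA, hinv⟩ := hH
  have hAi : (A⁻¹)ᵀ = -A⁻¹ := by
    rw [Matrix.transpose_nonsing_inv, hskew]
    refine Matrix.inv_eq_left_inv ?_
    rw [neg_mul_neg, Matrix.nonsing_inv_mul A ((Matrix.isUnit_iff_isUnit_det A).1 hA)]
  have hB : ∀ a b, (Matrix.toLinearMap₂' ℚ A⁻¹).compl₁₂ (e : V →ₗ[ℚ] _) (e : V →ₗ[ℚ] _) a b =
      e a ⬝ᵥ (A⁻¹ *ᵥ e b) := fun a b => by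
    simp [Matrix.toLinearMap₂'_apply']
  refine ⟨(Matrix.toLinearMap₂' ℚ A⁻¹).compl₁₂ (e : V →ₗ[ℚ] _) (e : V →ₗ[ℚ] _),
    fun a b => ?_, fun a ha => ?_, ?_⟩
  · rw [hB, hB, Matrix.dotProduct_mulVec, ← Matrix.mulVec_transpose, hAi, Matrix.neg_mulVec,
      neg_dotProduct, dotProduct_comm]
  · have h0 : e a ᵥ* A⁻¹ = 0 := by
      refine dotProduct_eq_zero _ fun w => ?_
      rw [← Matrix.dotProduct_mulVec, ← e.apply_symm_apply w, ← hB, ha]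
    have hinj := Matrix.vecMul_injective_iff_isUnit.2 (Matrix.isUnit_nonsing_inv_iff.2 hA)
    exact e.map_eq_zero_iff.1 (hinj (h0.trans (Matrix.zero_vecMul _).symm))
  · rintro _ ⟨g, hg, rfl⟩ a b
    have h := (mul_mul_transpose_eq_iff hA g.isUnit).1 (hinv g hg)
    change (Matrix.toLinearMap₂' ℚ A⁻¹).compl₁₂ (e : V →ₗ[ℚ] _) (e : V →ₗ[ℚ] _)
      (glEquivOfCoordinates e g a) (glEquivOfCoordinates e g b) = _
    rw [hB, hB, apply_glEquivOfCoordinates, apply_glEquivOfCoordinates]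
    nth_rw 2 [← h]
    rw [← Matrix.mulVec_mulVec, ← Matrix.mulVec_mulVec, Matrix.dotProduct_mulVec (e a),
      Matrix.vecMul_transpose]

theorem IsSymplecticLinearGroup.comap_glEquivOfCoordinates (e : V ≃ₗ[ℚ] (Fin m → ℚ))
    {Δ : Subgroup (V ≃ₗ[ℚ] V)} (hΔ : IsSymplecticLinearGroup Δ) :
    IsSymplecticGroup (Δ.comap (glEquivOfCoordinates e).toMonoidHom) := by
  obtain ⟨B, hskew, hnd, hinv⟩ := hΔ
  let N : Matrix (Fin m) (Fin m) ℚ := LinearMap.toMatrix₂' ℚ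
    (B.compl₁₂ (e.symm : _ →ₗ[ℚ] V) (e.symm : _ →ₗ[ℚ] V))
  have hN : ∀ v w, v ⬝ᵥ (N *ᵥ w) = B (e.symm v) (e.symm w) := fun v w => by
    rw [← Matrix.toLinearMap₂'_apply', Matrix.toLinearMap₂'_toMatrix']
    rfl
  have hext : ∀ {P Q : Matrix (Fin m) (Fin m) ℚ},
      (∀ v w, v ⬝ᵥ (P *ᵥ w) = v ⬝ᵥ (Q *ᵥ w)) → P = Q := fun {P Q} h => by
    apply (Matrix.toLinearMap₂' ℚ (S₁ := ℚ) (S₂ := ℚ)).injective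
    refine LinearMap.ext₂ fun v w => ?_
    rw [Matrix.toLinearMap₂'_apply', Matrix.toLinearMap₂'_apply', h]
  have hNt : Nᵀ = -N := hext fun v w => by
    rw [Matrix.neg_mulVec, dotProduct_neg, hN, Matrix.mulVec_transpose, dotProduct_comm,
      ← Matrix.dotProduct_mulVec, hN, hskew]
  have hNu : IsUnit N := by
    refine Matrix.vecMul_injective_iff_isUnit.1 ?_
    refine (injective_iff_map_eq_zero (Matrix.vecMulLinear N)).2 fun v hv => ?_
    refine e.symm.map_eq_zero_iff.1 (hnd _ fun b => ?_)
    rw [← e.symm_apply_apply b, ← hN, Matrix.dotProduct_mulVec]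
    exact (congrArg (· ⬝ᵥ e b) hv).trans (zero_dotProduct _)
  have hNd := (Matrix.isUnit_iff_isUnit_det N).1 hNu
  refine ⟨N⁻¹, ?_, Matrix.isUnit_nonsing_inv_iff.2 hNu, fun g hg => ?_⟩
  · rw [Matrix.transpose_nonsing_inv, hNt]
    refine Matrix.inv_eq_left_inv ?_
    rw [neg_mul_neg, Matrix.nonsing_inv_mul N hNd]
  · rw [mul_mul_transpose_eq_iff (Matrix.isUnit_nonsing_inv_iff.2 hNu) g.isUnit,
      Matrix.nonsing_inv_nonsing_inv N hNd]
    have key : ∀ v, e.symm ((g : Matrix (Fin m) (Fin m) ℚ) *ᵥ v) =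
        glEquivOfCoordinates e g (e.symm v) := fun v => by
      rw [e.symm_apply_eq, apply_glEquivOfCoordinates, e.apply_symm_apply]
    refine hext fun v w => ?_
    rw [← Matrix.mulVec_mulVec, ← Matrix.mulVec_mulVec, Matrix.dotProduct_mulVec v,
      Matrix.vecMul_transpose, hN, hN, key, key]
    exact hinv _ hg _ _

end Transport

/-- The s.i.m.f. subgroups of `GL_{p−1}(ℚ)` of order divisible by `p`: for
`p ≡ 1 (mod 4)` they are isomorphic to `C₂ × (C_p ⋊ C_o)` (with `C_o` acting faithfully
on `C_p`), and for `p ≡ 3 (mod 4)` to `C₂ × PSL(2,p)`, where `p − 1 = 2^a·o`, `o` odd. -/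
theorem simf_dim_p_sub_one {p a o : ℕ} (hp : p.Prime) (hp5 : 5 ≤ p)
    (hfact : p - 1 = 2 ^ a * o) (ho : Odd o)
    (G : Subgroup (GL (Fin (p - 1)) ℚ))
    (hG : IsSIMF G) (hdvd : p ∣ Nat.card G) :
    (p % 4 = 1 →
      ∃ φ : Multiplicative (ZMod o) →* MulAut (Multiplicative (ZMod p)),
        Function.Injective φ ∧
        Nonempty (G ≃* (Multiplicative (ZMod 2) ×
          (Multiplicative (ZMod p) ⋊[φ] Multiplicative (ZMod o))))) ∧
    (p % 4 = 3 →
      Nonempty (G ≃* (Multiplicative (ZMod 2) ×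
        Matrix.ProjectiveSpecialLinearGroup (Fin 2) (ZMod p)))) := by
  have : Fact p.Prime := ⟨hp⟩
  obtain ⟨hfin, hsymp, -, hmax⟩ := hG
  have : Finite G := hfin
  obtain ⟨x, hx⟩ := exists_prime_orderOf_dvd_card' p hdvd
  have hxp : ((x : GL (Fin (p - 1)) ℚ) : Matrix (Fin (p - 1)) (Fin (p - 1)) ℚ) ^ p = 1 := by
    exact congrArg (fun y : G => (y : GL (Fin (p - 1)) ℚ).val)
      (orderOf_dvd_iff_pow_eq_one.1 hx.dvd)
  have hx1 : ((x : GL (Fin (p - 1)) ℚ) : Matrix (Fin (p - 1)) (Fin (p - 1)) ℚ) ≠ 1 := by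
    intro h
    have : x = 1 := Subtype.ext (Units.ext h)
    rw [this, orderOf_one] at hx
    omega
  have : IsCyclotomicExtension {p} ℚ (CyclotomicField p ℚ) :=
    have : NeZero (p : ℚ) := ⟨Nat.cast_ne_zero.2 hp.ne_zero⟩
    CyclotomicField.isCyclotomicExtension p ℚ
  obtain ⟨e, he⟩ := exists_linearEquiv_mulVec_eq p (CyclotomicField p ℚ) hxp hx1
  let Ψ := glEquivOfCoordinates e
  have : Finite (G.map Ψ.toMonoidHom) := .of_equiv G (Ψ.subgroupMap G).toEquiv
  have hrot : cyclotomicRotation p (CyclotomicField p ℚ) 1 ∈ G.map Ψ.toMonoidHom := by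
    refine ⟨x, x.2, LinearEquiv.ext fun a => e.injective ?_⟩
    rw [cyclotomicRotation_apply, he]
    exact apply_glEquivOfCoordinates e _ a
  have hmax' : ∀ Δ : Subgroup (CyclotomicField p ℚ ≃ₗ[ℚ] CyclotomicField p ℚ), Finite Δ →
      IsSymplecticLinearGroup Δ → G.map Ψ.toMonoidHom ≤ Δ → Δ = G.map Ψ.toMonoidHom := by
    intro Δ hΔ hΔs hle
    have hΔfin : (Δ : Set (CyclotomicField p ℚ ≃ₗ[ℚ] CyclotomicField p ℚ)).Finite := hΔ
    have hcomap := hmax (Δ.comap Ψ.toMonoidHom)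
      (hΔfin.preimage (f := Ψ) Ψ.injective.injOn)
      (hΔs.comap_glEquivOfCoordinates e) (Subgroup.map_le_iff_le_comap.1 hle)
    rw [← hcomap, Subgroup.map_comap_eq_self_of_surjective Ψ.surjective]
  obtain ⟨h1, h3⟩ := mulEquiv_of_maximal p hp5 hfact ho hrot
    (hsymp.map_glEquivOfCoordinates e) hmax'
  refine ⟨fun h => ?_, fun h => ?_⟩
  · obtain ⟨φ, hφ, ⟨E⟩⟩ := h1 h
    exact ⟨φ, hφ, ⟨(Ψ.subgroupMap G).trans E⟩⟩
  · obtain ⟨E⟩ := h3 h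
    exact ⟨(Ψ.subgroupMap G).trans E⟩
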